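/- The determinant of the 2×2 matrix of 6-loop Bessel moments equals 5π⁶/192: M(1,7,1)·(32M(2,6,3) − 64M(2,6,5)) − M(2,6,1)·(32M(1,7,3) − 64M(1,7,5)) = 5π⁶/192. -/

import Mathlib

open scoped Real

/-- The modified Bessel function `I₀(x) = (1/π)∫₀^π e^{x cos θ} dθ`. -/
noncomputable def besselI0 (x : ℝ) : ℝ :=
  (1 / π) * ∫ θ in (0 : ℝ)..π, Real.exp (x * Real.cos θ)

/-- The modified Bessel function `K₀(x) = ∫₀^∞ e^{-x cosh t} dt`. -/
noncomputable def besselK0 (x : ℝ) : ℝ :=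
  ∫ t in Set.Ioi (0 : ℝ), Real.exp (-(x * Real.cosh t))

/-- The Bessel moment `M(a,b,c) = ∫₀^∞ I₀(x)^a K₀(x)^b x^c dx`. -/
noncomputable def besselMoment (a b c : ℕ) : ℝ :=
  ∫ x in Set.Ioi (0 : ℝ), besselI0 x ^ a * besselK0 x ^ b * x ^ c

namespace BesselMoment

open MeasureTheory Set Filter Topology

/-- The exponential transform `∫₀^π g(θ) e^{z cos θ} dθ` of a density on `[0, π]`. -/
noncomputable def cosTransform (g : ℝ → ℝ) (z : ℂ) : ℂ :=
  ∫ θ in (0 : ℝ)..π, (g θ : ℂ) * Complex.exp (z * Real.cos θ)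

lemma norm_exp_mul_cos_le (z : ℂ) (θ : ℝ) :
    ‖Complex.exp (z * Real.cos θ)‖ ≤ Real.exp ‖z‖ := by
  rw [Complex.norm_exp]
  apply Real.exp_le_exp.2
  calc (z * (Real.cos θ : ℂ)).re ≤ ‖z * (Real.cos θ : ℂ)‖ := Complex.re_le_norm _
    _ = ‖z‖ * |Real.cos θ| := by rw [norm_mul, Complex.norm_real, Real.norm_eq_abs]
    _ ≤ ‖z‖ := mul_le_of_le_one_right (norm_nonneg _) (Real.abs_cos_le_one θ)

lemma intervalIntegrable_cosTransform {g : ℝ → ℝ} (hg : IntervalIntegrable g volume 0 π) (z : ℂ) :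
    IntervalIntegrable (fun θ => (g θ : ℂ) * Complex.exp (z * Real.cos θ)) volume 0 π :=
  IntervalIntegrable.mul_continuousOn (f := fun θ => (g θ : ℂ)) ⟨hg.1.ofReal, hg.2.ofReal⟩
    (Continuous.continuousOn (by fun_prop))

lemma intervalIntegrable_mul_cos {g : ℝ → ℝ} (hg : IntervalIntegrable g volume 0 π) :
    IntervalIntegrable (fun θ => g θ * Real.cos θ) volume 0 π :=
  hg.mul_continuousOn Real.continuous_cos.continuousOn

lemma hasDerivAt_cosTransform {g : ℝ → ℝ} (hg : IntervalIntegrable g volume 0 π) (z : ℂ) :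
    HasDerivAt (cosTransform g) (cosTransform (fun θ => g θ * Real.cos θ) z) z := by
  have key := intervalIntegral.hasDerivAt_integral_of_dominated_loc_of_deriv_le
    (μ := volume) (a := 0) (b := π) (x₀ := z) (s := Metric.ball z 1)
    (F := fun w θ => (g θ : ℂ) * Complex.exp (w * Real.cos θ))
    (F' := fun w θ => ((g θ * Real.cos θ : ℝ) : ℂ) * Complex.exp (w * Real.cos θ))
    (bound := fun θ => |g θ| * Real.exp (‖z‖ + 1))
    (Metric.ball_mem_nhds _ one_pos)
    (Eventually.of_forall fun w =>
      (intervalIntegrable_cosTransform hg w).def'.aestronglyMeasurable)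
    (intervalIntegrable_cosTransform hg z)
    (intervalIntegrable_cosTransform (intervalIntegrable_mul_cos hg) z).def'.aestronglyMeasurable
    ?_ (hg.abs.mul_const _) ?_
  · exact key.2
  · refine Eventually.of_forall fun θ _ w hw => ?_
    have hw' : ‖w‖ ≤ ‖z‖ + 1 := by
      have := norm_le_norm_add_norm_sub' w z
      have h2 := mem_ball_iff_norm.1 hw
      linarith
    rw [norm_mul, Complex.norm_real, Real.norm_eq_abs, abs_mul]
    have h1 : |g θ| * |Real.cos θ| ≤ |g θ| :=
      mul_le_of_le_one_right (abs_nonneg _) (Real.abs_cos_le_one θ)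
    exact mul_le_mul h1 ((norm_exp_mul_cos_le w θ).trans (Real.exp_le_exp.2 hw'))
      (norm_nonneg _) (abs_nonneg _)
  · refine Eventually.of_forall fun θ _ w _ => ?_
    have h := ((hasDerivAt_id w).mul_const ((Real.cos θ : ℝ) : ℂ)).cexp.const_mul (g θ : ℂ)
    refine h.congr_deriv ?_
    simp only [id]
    push_cast
    ring

lemma cosTransform_ofReal_im (g : ℝ → ℝ) (x : ℝ) : (cosTransform g x).im = 0 := by
  have : cosTransform g x = ((∫ θ in (0 : ℝ)..π, g θ * Real.exp (x * Real.cos θ) : ℝ) : ℂ) := by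
    unfold cosTransform
    rw [← intervalIntegral.integral_ofReal]
    congr 1
    ext θ
    push_cast
    rfl
  rw [this, Complex.ofReal_im]

/-- A transform with density symmetric about `π/2` is real on the imaginary axis. -/
lemma cosTransform_mul_I_im {g : ℝ → ℝ} (hg : ∀ θ, g (π - θ) = g θ) (y : ℝ) :
    (cosTransform g (y * Complex.I)).im = 0 := by
  rw [← Complex.conj_eq_iff_im]
  unfold cosTransform
  have h := intervalIntegral.integral_comp_sub_left (a := 0) (b := π)
    (fun θ => (g θ : ℂ) * Complex.exp (y * Complex.I * Real.cos θ)) π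
  rw [sub_self, sub_zero] at h
  conv_rhs => rw [← h]
  rw [intervalIntegral.integral_of_le Real.pi_pos.le, intervalIntegral.integral_of_le
    Real.pi_pos.le, ← integral_conj]
  congr 1
  ext θ
  rw [map_mul, Complex.conj_ofReal, ← Complex.exp_conj, hg, Real.cos_pi_sub]
  congr 2
  rw [map_mul, map_mul, Complex.conj_ofReal, Complex.conj_I, Complex.conj_ofReal]
  push_cast
  ring

/-- The density of `I₀`. -/
noncomputable def densI : ℝ → ℝ := fun _ => 1 / π

/-- The density of the entire part of the logarithmic solution. -/
noncomputable def densE : ℝ → ℝ := fun θ => 2 / π * Real.log (Real.sin θ)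

lemma intervalIntegrable_densI : IntervalIntegrable densI volume 0 π :=
  intervalIntegrable_const

lemma intervalIntegrable_densE : IntervalIntegrable densE volume 0 π :=
  IntervalIntegrable.const_mul intervalIntegrable_log_sin _

/-- Complex extension of `I₀`. -/
noncomputable def cI : ℂ → ℂ := cosTransform densI

/-- The derivative of `cI`. -/
noncomputable def cI' : ℂ → ℂ := cosTransform (fun θ => densI θ * Real.cos θ)

/-- The entire part of the logarithmic solution. -/
noncomputable def cE : ℂ → ℂ := cosTransform densE

/-- The derivative of `cE`. -/
noncomputable def cE' : ℂ → ℂ := cosTransform (fun θ => densE θ * Real.cos θ)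

lemma hasDerivAt_cI (z : ℂ) : HasDerivAt cI (cI' z) z :=
  hasDerivAt_cosTransform intervalIntegrable_densI z

lemma hasDerivAt_cE (z : ℂ) : HasDerivAt cE (cE' z) z :=
  hasDerivAt_cosTransform intervalIntegrable_densE z

lemma cI_zero : cI 0 = 1 := by
  simp only [cI, cosTransform, densI, zero_mul, Complex.exp_zero, mul_one]
  rw [intervalIntegral.integral_const]
  simp [Real.pi_ne_zero]

lemma cI_ofReal (x : ℝ) : cI x = besselI0 x := by
  unfold cI cosTransform densI besselI0
  rw [← intervalIntegral.integral_const_mul, ← intervalIntegral.integral_ofReal]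
  congr 1
  ext θ
  push_cast
  rfl

lemma besselOp_cosTransform {g : ℝ → ℝ} (hg : IntervalIntegrable g volume 0 π) (z : ℂ) :
    z * cosTransform (fun θ => g θ * Real.cos θ * Real.cos θ) z
      + cosTransform (fun θ => g θ * Real.cos θ) z - z * cosTransform g z
      = ∫ θ in (0 : ℝ)..π, (g θ : ℂ) * ((Real.cos θ - z * Real.sin θ ^ 2)
          * Complex.exp (z * Real.cos θ)) := by
  have h0 := intervalIntegrable_cosTransform hg z
  have h1 := intervalIntegrable_cosTransform (intervalIntegrable_mul_cos hg) z
  have h2 := intervalIntegrable_cosTransform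
    (intervalIntegrable_mul_cos (intervalIntegrable_mul_cos hg)) z
  unfold cosTransform
  rw [← intervalIntegral.integral_const_mul, ← intervalIntegral.integral_const_mul,
    ← intervalIntegral.integral_add (h2.const_mul z) h1,
    ← intervalIntegral.integral_sub ((h2.const_mul z).add h1) (h0.const_mul z)]
  congr 1
  ext θ
  have : ((Real.sin θ : ℝ) : ℂ) ^ 2 = 1 - ((Real.cos θ : ℝ) : ℂ) ^ 2 := by
    rw [← Complex.ofReal_pow, Real.sin_sq]
    push_cast
    ring
  rw [this]
  push_cast
  ring

lemma hasDerivAt_sin_mul_exp (z : ℂ) (θ : ℝ) :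
    HasDerivAt (fun θ : ℝ => (Real.sin θ : ℂ) * Complex.exp (z * Real.cos θ))
      ((Real.cos θ - z * Real.sin θ ^ 2) * Complex.exp (z * Real.cos θ)) θ := by
  have h1 := (Real.hasDerivAt_sin θ).ofReal_comp
  have h2 := ((Real.hasDerivAt_cos θ).ofReal_comp.const_mul z).cexp
  refine (h1.mul h2).congr_deriv ?_
  push_cast
  ring

lemma cI_ode (z : ℂ) :
    z * cosTransform (fun θ => densI θ * Real.cos θ * Real.cos θ) z + cI' z - z * cI z = 0 := by
  unfold cI' cI
  rw [besselOp_cosTransform intervalIntegrable_densI]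
  simp only [densI]
  rw [intervalIntegral.integral_const_mul, intervalIntegral.integral_eq_sub_of_hasDerivAt
    (fun θ _ => hasDerivAt_sin_mul_exp z θ)]
  · simp
  · exact Continuous.intervalIntegrable (by fun_prop) _ _

lemma cE_ode (z : ℂ) :
    z * cosTransform (fun θ => densE θ * Real.cos θ * Real.cos θ) z + cE' z - z * cE z
      = -2 * cI' z := by
  have hi := intervalIntegrable_cosTransform (intervalIntegrable_mul_cos intervalIntegrable_densI) z
  have hE : IntervalIntegrable (fun θ : ℝ => (densE θ : ℂ) * ((Real.cos θ - z * Real.sin θ ^ 2)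
      * Complex.exp (z * Real.cos θ))) volume 0 π :=
    IntervalIntegrable.mul_continuousOn (f := fun θ => (densE θ : ℂ))
      ⟨intervalIntegrable_densE.1.ofReal, intervalIntegrable_densE.2.ofReal⟩ (Continuous.continuousOn (by fun_prop))
  unfold cE' cE cI'
  rw [besselOp_cosTransform intervalIntegrable_densE, ← sub_eq_zero]
  unfold cosTransform
  rw [← intervalIntegral.integral_const_mul, ← intervalIntegral.integral_sub hE (hi.const_mul _)]
  have hcont : Continuous fun θ : ℝ => ((2 / π * (Real.sin θ * Real.log (Real.sin θ)) : ℝ) : ℂ)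
      * Complex.exp (z * Real.cos θ) := by
    have := Real.continuous_mul_log.comp Real.continuous_sin
    have h2 : Continuous fun θ : ℝ => Real.sin θ * Real.log (Real.sin θ) := this
    fun_prop
  rw [intervalIntegral.integral_eq_sub_of_hasDerivAt_of_le Real.pi_pos.le hcont.continuousOn
    (fun θ hθ => ?_) (hE.sub (hi.const_mul _))]
  · simp
  · have hs : Real.sin θ ≠ 0 := (Real.sin_pos_of_mem_Ioo hθ).ne'
    have h1 := (((Real.hasDerivAt_sin θ).log hs).const_mul (2 / π)).ofReal_comp
    refine ((h1.mul (hasDerivAt_sin_mul_exp z θ)).congr_of_eventuallyEq ?_).congr_deriv ?_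
    · refine Eventually.of_forall fun t => ?_
      simp only [Pi.mul_apply]
      push_cast
      ring
    · have hs' : ((Real.sin θ : ℝ) : ℂ) ≠ 0 := Complex.ofReal_ne_zero.2 hs
      have hp : ((π : ℝ) : ℂ) ≠ 0 := Complex.ofReal_ne_zero.2 Real.pi_ne_zero
      simp only [densE, densI]
      push_cast at hs' ⊢
      field_simp
      ring

lemma hasDerivAt_cI' {z : ℂ} (hz : z ≠ 0) : HasDerivAt cI' (cI z - cI' z / z) z := by
  refine (hasDerivAt_cosTransform (intervalIntegrable_mul_cos intervalIntegrable_densI) z).congr_deriv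
    ?_
  have := cI_ode z
  generalize cosTransform (fun θ => densI θ * Real.cos θ * Real.cos θ) z = w at this ⊢
  field_simp
  linear_combination this

lemma hasDerivAt_cE' {z : ℂ} (hz : z ≠ 0) :
    HasDerivAt cE' (cE z - cE' z / z - 2 * cI' z / z) z := by
  refine (hasDerivAt_cosTransform (intervalIntegrable_mul_cos intervalIntegrable_densE) z).congr_deriv
    ?_
  have := cE_ode z
  generalize cosTransform (fun θ => densE θ * Real.cos θ * Real.cos θ) z = w at this ⊢
  field_simp
  linear_combination this

/-- The Wronskian identity for the entire parts. -/
lemma cI_cE_wronskian (z : ℂ) : cI z ^ 2 + z * (cI z * cE' z - cI' z * cE z) = 1 := by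
  have hd1 := fun z => hasDerivAt_cosTransform
    (intervalIntegrable_mul_cos intervalIntegrable_densI) z
  have hd2 := fun z => hasDerivAt_cosTransform
    (intervalIntegrable_mul_cos intervalIntegrable_densE) z
  have key : ∀ z, HasDerivAt (fun z => cI z ^ 2 + z * (cI z * cE' z - cI' z * cE z)) 0 z := by
    intro z
    have h1 : HasDerivAt cI' _ z := hd1 z
    have h2 : HasDerivAt cE' _ z := hd2 z
    refine (((hasDerivAt_cI z).pow 2).add ((hasDerivAt_id z).mul
      (((hasDerivAt_cI z).mul h2).sub (h1.mul (hasDerivAt_cE z))))).congr_deriv ?_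
    simp only [id, Pi.mul_apply, Pi.sub_apply]
    have e1 := cI_ode z
    have e2 := cE_ode z
    push_cast
    linear_combination cI z * e2 - cE z * e1
  have := is_const_of_deriv_eq_zero (fun z => (key z).differentiableAt) (fun z => (key z).deriv) z 0
  rw [this]
  simp [cI_zero]

lemma cI'_zero : cI' 0 = 0 := by
  simpa using cI_ode 0

lemma besselI0_pos (x : ℝ) : 0 < besselI0 x := by
  unfold besselI0
  have : 0 < ∫ θ in (0 : ℝ)..π, Real.exp (x * Real.cos θ) :=
    intervalIntegral.intervalIntegral_pos_of_pos
      (Continuous.intervalIntegrable (by fun_prop) _ _) (fun _ => Real.exp_pos _) Real.pi_pos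
  positivity

lemma cI_ofReal_ne_zero (x : ℝ) : cI x ≠ 0 := by
  rw [cI_ofReal]
  exact Complex.ofReal_ne_zero.2 (besselI0_pos x).ne'

/-- The multiple of `I₀` that turns the logarithmic solution into `K₀`. -/
noncomputable def coefK : ℝ := (besselK0 1 + (cE 1).re) / besselI0 1

/-- Complex extension of `K₀`. -/
noncomputable def cK (z : ℂ) : ℂ := -(Complex.log z * cI z + cE z) + coefK * cI z

/-- The derivative of `cK`. -/
noncomputable def cK' (z : ℂ) : ℂ :=
  -(cI z / z + Complex.log z * cI' z + cE' z) + coefK * cI' z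

/-- A solution `f` of `z f'' + f' = z f` on the slit plane, with derivative `f'`. -/
def IsBesselSol (f f' : ℂ → ℂ) : Prop :=
  ∀ z ∈ Complex.slitPlane, HasDerivAt f (f' z) z ∧ HasDerivAt f' (f z - f' z / z) z

lemma isBesselSol_cI : IsBesselSol cI cI' := fun z hz =>
  ⟨hasDerivAt_cI z, hasDerivAt_cI' (Complex.slitPlane_ne_zero hz)⟩

lemma isBesselSol_cK : IsBesselSol cK cK' := by
  intro z hz
  have h0 := Complex.slitPlane_ne_zero hz
  have hl := Complex.hasDerivAt_log hz
  constructor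
  · refine (((hl.mul (hasDerivAt_cI z)).add (hasDerivAt_cE z)).neg.add
      ((hasDerivAt_cI z).const_mul (coefK : ℂ))).congr_deriv ?_
    unfold cK'
    rw [div_eq_mul_inv]
    ring
  · refine (((((hasDerivAt_cI z).div (hasDerivAt_id z) h0).add (hl.mul (hasDerivAt_cI' h0))).add
      (hasDerivAt_cE' h0)).neg.add ((hasDerivAt_cI' h0).const_mul (coefK : ℂ))).congr_deriv ?_
    unfold cK cK'
    simp only [id]
    field_simp
    ring

lemma IsBesselSol.linComb {f f' g g' : ℂ → ℂ} (hf : IsBesselSol f f') (hg : IsBesselSol g g')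
    (a b : ℂ) : IsBesselSol (fun z => a * f z + b * g z) (fun z => a * f' z + b * g' z) := by
  intro z hz
  refine ⟨((hf z hz).1.const_mul a).add ((hg z hz).1.const_mul b),
    (((hf z hz).2.const_mul a).add ((hg z hz).2.const_mul b)).congr_deriv ?_⟩
  ring

lemma cI_cK_wronskian {z : ℂ} (hz : z ≠ 0) : z * (cI' z * cK z - cI z * cK' z) = 1 := by
  rw [← cI_cE_wronskian z]
  unfold cK cK'
  field_simp
  ring

/-- The integrals `∫₀^∞ cosh(t)ⁿ e^{-x cosh t} dt`. -/
noncomputable def coshMoment (n : ℕ) (x : ℝ) : ℝ :=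
  ∫ t in Ioi (0 : ℝ), Real.cosh t ^ n * Real.exp (-(x * Real.cosh t))

lemma coshMoment_zero (x : ℝ) : coshMoment 0 x = besselK0 x := by
  simp [coshMoment, besselK0]

lemma cosh_pow_mul_exp_le (n : ℕ) {x : ℝ} (hx : 0 < x) (t : ℝ) :
    Real.cosh t ^ n * Real.exp (-(x * Real.cosh t))
      ≤ 2 * (n + 1).factorial / x ^ (n + 1) * Real.exp (-t) := by
  have hc : 0 < Real.cosh t := Real.cosh_pos t
  have h1 := Real.pow_div_factorial_le_exp (x * Real.cosh t) (by positivity) (n + 1)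
  have h2 : 1 ≤ Real.cosh t * (2 * Real.exp (-t)) := by
    have : Real.exp t * Real.exp (-t) = 1 := by rw [← Real.exp_add]; simp
    rw [Real.cosh_eq]
    nlinarith [Real.exp_pos (-t)]
  have h3 : Real.exp (x * Real.cosh t) * Real.exp (-(x * Real.cosh t)) = 1 := by
    rw [← Real.exp_add]; simp
  rw [mul_pow, div_le_iff₀ (by positivity)] at h1
  have h4 : Real.cosh t ^ (n + 1) * Real.exp (-(x * Real.cosh t))
      ≤ (n + 1).factorial / x ^ (n + 1) := by
    rw [le_div_iff₀ (by positivity)]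
    have := mul_le_mul_of_nonneg_right h1 (Real.exp_pos (-(x * Real.cosh t))).le
    nlinarith
  calc Real.cosh t ^ n * Real.exp (-(x * Real.cosh t))
      ≤ (Real.cosh t ^ n * Real.exp (-(x * Real.cosh t)))
        * (Real.cosh t * (2 * Real.exp (-t))) := le_mul_of_one_le_right (by positivity) h2
    _ = (Real.cosh t ^ (n + 1) * Real.exp (-(x * Real.cosh t))) * (2 * Real.exp (-t)) := by ring
    _ ≤ ((n + 1).factorial / x ^ (n + 1)) * (2 * Real.exp (-t)) := by gcongr
    _ = _ := by ring

lemma integrableOn_exp_neg_Ioi : IntegrableOn (fun t : ℝ => Real.exp (-t)) (Ioi 0) := by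
  simpa using integrableOn_exp_mul_Ioi (a := -1) (by norm_num) 0

lemma integrableOn_coshMoment (n : ℕ) {x : ℝ} (hx : 0 < x) :
    IntegrableOn (fun t => Real.cosh t ^ n * Real.exp (-(x * Real.cosh t))) (Ioi 0) := by
  refine (integrableOn_exp_neg_Ioi.const_mul (2 * (n + 1).factorial / x ^ (n + 1))).mono'
    (Continuous.aestronglyMeasurable (by fun_prop)) (Eventually.of_forall fun t => ?_)
  have hc : 0 < Real.cosh t := Real.cosh_pos t
  rw [Real.norm_of_nonneg (by positivity)]
  exact cosh_pow_mul_exp_le n hx t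

lemma hasDerivAt_coshMoment (n : ℕ) {x : ℝ} (hx : 0 < x) :
    HasDerivAt (coshMoment n) (-coshMoment (n + 1) x) x := by
  have key := hasDerivAt_integral_of_dominated_loc_of_deriv_le
    (μ := volume.restrict (Ioi (0 : ℝ))) (x₀ := x) (s := Ioi (x / 2))
    (F := fun y t => Real.cosh t ^ n * Real.exp (-(y * Real.cosh t)))
    (F' := fun y t => -(Real.cosh t ^ (n + 1) * Real.exp (-(y * Real.cosh t))))
    (bound := fun t => Real.cosh t ^ (n + 1) * Real.exp (-(x / 2 * Real.cosh t)))
    (Ioi_mem_nhds (by linarith))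
    (Eventually.of_forall fun w => Continuous.aestronglyMeasurable (by fun_prop))
    (integrableOn_coshMoment n hx)
    (Continuous.aestronglyMeasurable (by fun_prop))
    ?_ (integrableOn_coshMoment (n + 1) (by positivity)) ?_
  · refine key.2.congr_deriv ?_
    rw [integral_neg]
    rfl
  · refine Eventually.of_forall fun t y hy => ?_
    have hc : 0 < Real.cosh t := Real.cosh_pos t
    rw [norm_neg, Real.norm_of_nonneg (by positivity)]
    have : x / 2 ≤ y := le_of_lt hy
    gcongr
  · refine Eventually.of_forall fun t y _ => ?_
    have h := (((hasDerivAt_id y).mul_const (Real.cosh t)).neg.exp).const_mul (Real.cosh t ^ n)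
    refine h.congr_deriv ?_
    simp only [id, Pi.neg_apply]
    ring

lemma tendsto_exp_neg_mul_cosh {x : ℝ} (hx : 0 < x) :
    Tendsto (fun t => Real.exp (-(x * Real.cosh t))) atTop (𝓝 0) := by
  have h := cosh_pow_mul_exp_le 0 hx
  refine squeeze_zero (fun t => (Real.exp_pos _).le) (fun t => by simpa using h t) ?_
  have := (Real.tendsto_exp_neg_atTop_nhds_zero).const_mul (2 / x)
  simpa using this

lemma coshMoment_ode {x : ℝ} (hx : 0 < x) :
    x * coshMoment 2 x - coshMoment 1 x - x * coshMoment 0 x = 0 := by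
  have i0 := integrableOn_coshMoment 0 hx
  have i1 := integrableOn_coshMoment 1 hx
  have i2 := integrableOn_coshMoment 2 hx
  have key := integral_Ioi_of_hasDerivAt_of_tendsto' (a := 0) (m := 0)
    (f := fun t => Real.sinh t * Real.exp (-(x * Real.cosh t)))
    (f' := fun t => Real.cosh t ^ 1 * Real.exp (-(x * Real.cosh t))
      - (x * (Real.cosh t ^ 2 * Real.exp (-(x * Real.cosh t)))
        - x * (Real.cosh t ^ 0 * Real.exp (-(x * Real.cosh t)))))
    (fun t _ => ?_) (i1.sub ((i2.const_mul x).sub (i0.const_mul x))) ?_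
  · have hi : IntegrableOn (fun t => x * (Real.cosh t ^ 2 * Real.exp (-(x * Real.cosh t)))
        - x * (Real.cosh t ^ 0 * Real.exp (-(x * Real.cosh t)))) (Ioi 0) :=
      (i2.const_mul x).sub (i0.const_mul x)
    rw [integral_sub i1 hi, integral_sub (i2.const_mul x) (i0.const_mul x), integral_const_mul, integral_const_mul] at key
    simp only [Real.sinh_zero, zero_mul, sub_zero] at key
    unfold coshMoment
    linarith
  · refine ((Real.hasDerivAt_sinh t).mul
      ((Real.hasDerivAt_cosh t).const_mul x).neg.exp).congr_deriv ?_
    simp only [Pi.neg_apply]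
    have : Real.sinh t ^ 2 = Real.cosh t ^ 2 - 1 := by linarith [Real.cosh_sq t]
    linear_combination (-x * Real.exp (-(x * Real.cosh t))) * this
  · have h := cosh_pow_mul_exp_le 1 hx
    refine squeeze_zero_norm (a := fun t => 2 * (1 + 1).factorial / x ^ (1 + 1) * Real.exp (-t))
      (fun t => ?_) ?_
    · refine le_trans ?_ (h t)
      rw [norm_mul, Real.norm_of_nonneg (Real.exp_pos _).le, pow_one, Real.norm_eq_abs]
      gcongr
      rw [abs_le]
      constructor
      · rw [Real.sinh_eq, Real.cosh_eq]; linarith [Real.exp_pos t, Real.exp_pos (-t)]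
      · exact (Real.sinh_lt_cosh t).le
    · have := (Real.tendsto_exp_neg_atTop_nhds_zero).const_mul
        (2 * ((1 + 1).factorial : ℝ) / x ^ (1 + 1))
      rwa [mul_zero] at this

lemma integral_sinh_exp {x : ℝ} (hx : 0 < x) :
    IntegrableOn (fun t => Real.sinh t * Real.exp (-(x * Real.cosh t))) (Ioi 0) ∧
    x * ∫ t in Ioi (0 : ℝ), Real.sinh t * Real.exp (-(x * Real.cosh t)) = Real.exp (-x) := by
  have i1 : IntegrableOn (fun t => Real.sinh t * Real.exp (-(x * Real.cosh t))) (Ioi 0) := by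
    refine (integrableOn_coshMoment 1 hx).mono' (Continuous.aestronglyMeasurable (by fun_prop)) ?_
    refine (ae_restrict_mem measurableSet_Ioi).mono fun t ht => ?_
    have : 0 ≤ Real.sinh t := Real.sinh_nonneg_iff.2 (le_of_lt ht)
    rw [Real.norm_of_nonneg (by positivity), pow_one]
    have := (Real.sinh_lt_cosh t).le
    gcongr
  refine ⟨i1, ?_⟩
  have key := integral_Ioi_of_hasDerivAt_of_tendsto' (a := 0) (m := 0)
    (f := fun t => - Real.exp (-(x * Real.cosh t)))
    (f' := fun t => x * (Real.sinh t * Real.exp (-(x * Real.cosh t))))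
    (fun t _ => ?_) (i1.const_mul x) ?_
  · rw [integral_const_mul] at key
    simpa using key
  · refine (((Real.hasDerivAt_cosh t).const_mul x).neg.exp.neg).congr_deriv ?_
    simp only [Pi.neg_apply]
    ring
  · simpa using (tendsto_exp_neg_mul_cosh hx).neg

lemma coshMoment_one_bounds {x : ℝ} (hx : 0 < x) :
    Real.exp (-x) ≤ x * coshMoment 1 x ∧ x * coshMoment 1 x ≤ Real.exp (-x) + x ∧
      x * coshMoment 1 x ≤ Real.exp (-x) + x * coshMoment 0 x := by
  obtain ⟨i1, e1⟩ := integral_sinh_exp hx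
  have i2 : IntegrableOn (fun t => Real.exp (-t) * Real.exp (-(x * Real.cosh t))) (Ioi 0) := by
    refine integrableOn_exp_neg_Ioi.mono' (Continuous.aestronglyMeasurable (by fun_prop))
      (Eventually.of_forall fun t => ?_)
    rw [Real.norm_of_nonneg (by positivity)]
    have : 0 ≤ x * Real.cosh t := mul_nonneg hx.le (Real.cosh_pos t).le
    exact mul_le_of_le_one_right (Real.exp_pos _).le (Real.exp_le_one_iff.2 (by linarith))
  have e : coshMoment 1 x = (∫ t in Ioi (0 : ℝ), Real.sinh t * Real.exp (-(x * Real.cosh t)))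
      + ∫ t in Ioi (0 : ℝ), Real.exp (-t) * Real.exp (-(x * Real.cosh t)) := by
    rw [← integral_add i1 i2]
    unfold coshMoment
    congr 1
    ext t
    rw [Real.cosh_eq, Real.sinh_eq]
    ring
  have b0 : 0 ≤ ∫ t in Ioi (0 : ℝ), Real.exp (-t) * Real.exp (-(x * Real.cosh t)) :=
    integral_nonneg fun t => by positivity
  have b1 : ∫ t in Ioi (0 : ℝ), Real.exp (-t) * Real.exp (-(x * Real.cosh t)) ≤ 1 := by
    rw [← integral_exp_neg_Ioi_zero]
    refine setIntegral_mono i2 integrableOn_exp_neg_Ioi fun t => ?_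
    have : 0 ≤ x * Real.cosh t := mul_nonneg hx.le (Real.cosh_pos t).le
    exact mul_le_of_le_one_right (Real.exp_pos _).le (Real.exp_le_one_iff.2 (by linarith))
  have b2 : ∫ t in Ioi (0 : ℝ), Real.exp (-t) * Real.exp (-(x * Real.cosh t)) ≤ coshMoment 0 x := by
    refine setIntegral_mono_on i2 (integrableOn_coshMoment 0 hx) measurableSet_Ioi fun t ht => ?_
    rw [pow_zero]
    gcongr
    exact Real.exp_le_one_iff.2 (by simpa using (le_of_lt ht : (0 : ℝ) ≤ t))
  rw [e, mul_add, e1]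
  refine ⟨?_, ?_, ?_⟩ <;> nlinarith

lemma coshMoment_nonneg (n : ℕ) (x : ℝ) : 0 ≤ coshMoment n x :=
  integral_nonneg fun t => by have := Real.cosh_pos t; positivity

lemma coshMoment_zero_le_one {x : ℝ} (hx : 0 < x) : coshMoment 0 x ≤ coshMoment 1 x := by
  refine setIntegral_mono (integrableOn_coshMoment 0 hx) (integrableOn_coshMoment 1 hx) fun t => ?_
  have := Real.one_le_cosh t
  simp only [pow_zero, pow_one]
  gcongr

lemma ofReal_mem_slitPlane {x : ℝ} (hx : 0 < x) : (x : ℂ) ∈ Complex.slitPlane :=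
  Complex.ofReal_mem_slitPlane.2 hx

lemma IsBesselSol.hasDerivAt_real {f f' : ℂ → ℂ} (hf : IsBesselSol f f') {x : ℝ} (hx : 0 < x) :
    HasDerivAt (fun x : ℝ => f x) (f' x) x ∧
      HasDerivAt (fun x : ℝ => f' x) (f x - f' x / x) x :=
  ⟨(hf x (ofReal_mem_slitPlane hx)).1.comp_ofReal, (hf x (ofReal_mem_slitPlane hx)).2.comp_ofReal⟩

lemma eqOn_const_of_hasDerivAt_zero {f : ℝ → ℂ} (h : ∀ x > 0, HasDerivAt f 0 x) {x y : ℝ}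
    (hx : 0 < x) (hy : 0 < y) : f x = f y :=
  isOpen_Ioi.is_const_of_deriv_eq_zero isPreconnected_Ioi
    (fun z hz => (h z hz).differentiableAt.differentiableWithinAt) (fun z hz => (h z hz).deriv) hx hy

lemma coshMoment_cI_wronskian {x : ℝ} (hx : 0 < x) :
    (x : ℂ) * (coshMoment 1 x * cI x + coshMoment 0 x * cI' x) = 1 := by
  set W : ℝ → ℂ := fun x => (x : ℂ) * (coshMoment 1 x * cI x + coshMoment 0 x * cI' x) with hW
  have hconst : ∀ x > 0, HasDerivAt W 0 x := by
    intro x hx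
    have h0 := (hasDerivAt_coshMoment 0 hx).ofReal_comp
    have h1 := (hasDerivAt_coshMoment 1 hx).ofReal_comp
    obtain ⟨g0, g1⟩ := isBesselSol_cI.hasDerivAt_real hx
    refine ((hasDerivAt_id x).ofReal_comp.mul ((h1.mul g0).add (h0.mul g1))).congr_deriv ?_
    have ode : (x : ℂ) * coshMoment 2 x - coshMoment 1 x - x * coshMoment 0 x = 0 := by
      exact_mod_cast coshMoment_ode hx
    have hx' : (x : ℂ) ≠ 0 := Complex.ofReal_ne_zero.2 hx.ne'
    simp only [id, Pi.add_apply, Pi.mul_apply, Nat.reduceAdd, zero_add]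
    push_cast
    field_simp
    linear_combination (-cI x) * ode
  have hlim : Tendsto W (𝓝[>] 0) (𝓝 1) := by
    have hcI : Tendsto (fun x : ℝ => cI x) (𝓝[>] 0) (𝓝 1) := by
      have : ContinuousAt (fun x : ℝ => cI x) 0 :=
        ContinuousAt.comp (hasDerivAt_cI _).continuousAt Complex.continuous_ofReal.continuousAt
      have h2 := this.tendsto
      rw [Complex.ofReal_zero, cI_zero] at h2
      exact h2.mono_left nhdsWithin_le_nhds
    have hcI' : Tendsto (fun x : ℝ => cI' x) (𝓝[>] 0) (𝓝 0) := by
      have : ContinuousAt (fun x : ℝ => cI' x) 0 :=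
        ContinuousAt.comp (hasDerivAt_cosTransform
          (intervalIntegrable_mul_cos intervalIntegrable_densI) _).continuousAt
            Complex.continuous_ofReal.continuousAt
      have h2 := this.tendsto
      rw [Complex.ofReal_zero, cI'_zero] at h2
      exact h2.mono_left nhdsWithin_le_nhds
    have hexp : Tendsto (fun x : ℝ => Real.exp (-x)) (𝓝[>] 0) (𝓝 1) := by
      have : Continuous fun x : ℝ => Real.exp (-x) := by fun_prop
      have h2 := this.tendsto 0
      simp only [neg_zero, Real.exp_zero] at h2
      exact h2.mono_left nhdsWithin_le_nhds
    have hid : Tendsto (fun x : ℝ => x) (𝓝[>] 0) (𝓝 0) := nhdsWithin_le_nhds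
    have hK1 : Tendsto (fun x : ℝ => x * coshMoment 1 x) (𝓝[>] 0) (𝓝 1) := by
      have hu := hexp.add hid
      rw [add_zero] at hu
      refine tendsto_of_tendsto_of_tendsto_of_le_of_le' hexp hu ?_ ?_
      · exact eventually_mem_nhdsWithin.mono fun x hx => (coshMoment_one_bounds hx).1
      · exact eventually_mem_nhdsWithin.mono fun x hx => (coshMoment_one_bounds hx).2.1
    have t1 : Tendsto (fun x : ℝ => ((x * coshMoment 1 x : ℝ) : ℂ) * cI x) (𝓝[>] 0) (𝓝 1) := by
      have := ((Complex.continuous_ofReal.tendsto _).comp hK1).mul hcI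
      simpa using this
    have t2 : Tendsto (fun x : ℝ => ((x * coshMoment 0 x : ℝ) : ℂ) * cI' x) (𝓝[>] 0) (𝓝 0) := by
      have hb := hK1.mul hcI'.norm
      rw [norm_zero, mul_zero] at hb
      refine squeeze_zero_norm' ?_ hb
      refine eventually_mem_nhdsWithin.mono fun x hx => ?_
      have hx : 0 < x := hx
      rw [norm_mul, Complex.norm_real,
        Real.norm_of_nonneg (mul_nonneg hx.le (coshMoment_nonneg 0 x))]
      have := coshMoment_zero_le_one hx
      gcongr
    have := t1.add t2
    rw [add_zero] at this
    refine this.congr fun x => ?_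
    simp only [hW]
    push_cast
    ring
  have : Tendsto W (𝓝[>] 0) (𝓝 (W x)) := by
    refine tendsto_const_nhds.congr' ?_
    exact eventually_mem_nhdsWithin.mono fun y hy => eqOn_const_of_hasDerivAt_zero hconst hx hy
  exact tendsto_nhds_unique this hlim

lemma cK_one : cK (1 : ℝ) = besselK0 1 := by
  have hE : cE (1 : ℝ) = ((cE 1).re : ℂ) := by
    apply Complex.ext
    · simp
    · rw [Complex.ofReal_im]
      exact cosTransform_ofReal_im _ 1
  unfold cK
  rw [cI_ofReal, hE, coefK, Complex.ofReal_one, Complex.log_one]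
  have : (besselI0 1 : ℂ) ≠ 0 := Complex.ofReal_ne_zero.2 (besselI0_pos 1).ne'
  push_cast
  field_simp
  ring

lemma cK_ofReal_aux {x : ℝ} (hx : 0 < x) : cK x = coshMoment 0 x := by
  have hconst : ∀ x > 0, HasDerivAt (fun x : ℝ => (coshMoment 0 x - cK x) / cI x) 0 x := by
    intro x hx
    have h0 := (hasDerivAt_coshMoment 0 hx).ofReal_comp
    obtain ⟨g0, g1⟩ := isBesselSol_cI.hasDerivAt_real hx
    obtain ⟨k0, k1⟩ := isBesselSol_cK.hasDerivAt_real hx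
    have hx' : (x : ℂ) ≠ 0 := Complex.ofReal_ne_zero.2 hx.ne'
    refine ((h0.sub k0).div g0 (cI_ofReal_ne_zero x)).congr_deriv ?_
    rw [div_eq_zero_iff]
    left
    have w1 := coshMoment_cI_wronskian hx
    have w2 := cI_cK_wronskian hx'
    apply mul_left_cancel₀ hx'
    simp only [Pi.sub_apply, zero_add]
    push_cast
    linear_combination w2 - w1
  have h := eqOn_const_of_hasDerivAt_zero hconst hx one_pos
  rw [cK_one, coshMoment_zero, coshMoment_zero, sub_self, zero_div, div_eq_zero_iff] at h
  have := h.resolve_right (cI_ofReal_ne_zero x)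
  rw [coshMoment_zero]
  exact (sub_eq_zero.1 this).symm

lemma cK_ofReal {x : ℝ} (hx : 0 < x) : cK x = besselK0 x := by
  rw [cK_ofReal_aux hx, coshMoment_zero]

lemma cK'_ofReal {x : ℝ} (hx : 0 < x) : cK' x = ((-coshMoment 1 x : ℝ) : ℂ) := by
  have h1 := (isBesselSol_cK.hasDerivAt_real hx).1
  have h2 := (hasDerivAt_coshMoment 0 hx).ofReal_comp
  have h3 : (fun x : ℝ => cK x) =ᶠ[𝓝 x] fun x => (coshMoment 0 x : ℂ) :=
    eventually_of_mem (Ioi_mem_nhds hx) fun y hy => cK_ofReal_aux hy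
  exact h1.unique (h2.congr_of_eventuallyEq h3)

lemma cI_mul_I_im (y : ℝ) : (cI (y * Complex.I)).im = 0 :=
  cosTransform_mul_I_im (fun _ => rfl) y

lemma cE_mul_I_im (y : ℝ) : (cE (y * Complex.I)).im = 0 :=
  cosTransform_mul_I_im (fun θ => by simp [densE, Real.sin_pi_sub]) y

/-- `J₀`, as the value of `cI` on the imaginary axis. -/
noncomputable def realJ (y : ℝ) : ℝ := (cI (y * Complex.I)).re

/-- The real part of `cK` on the imaginary axis. -/
noncomputable def realX (y : ℝ) : ℝ := (cK (y * Complex.I)).re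

lemma cI_mul_I (y : ℝ) : cI (y * Complex.I) = realJ y :=
  Complex.ext (by simp [realJ]) (by simp [cI_mul_I_im])

lemma cK_mul_I {y : ℝ} (hy : 0 < y) :
    cK (y * Complex.I) = realX y - (π / 2) * Complex.I * realJ y := by
  have hlog : (Complex.log (y * Complex.I)).im = π / 2 := by
    rw [Complex.log_im, Complex.arg_real_mul _ hy, Complex.arg_I]
  apply Complex.ext
  · simp [realX]
  · have e1 : cK (y * Complex.I) = -(Complex.log (y * Complex.I) * realJ y
        + cE (y * Complex.I)) + coefK * realJ y := by rw [← cI_mul_I]; rfl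
    rw [e1]
    simp [hlog, cE_mul_I_im]

lemma hasDerivAt_arctan_div_div {r : ℝ} (hr : 0 < r) (u : ℝ) :
    HasDerivAt (fun u => Real.arctan (u / r) / r) (1 / (r ^ 2 + u ^ 2)) u := by
  refine (((hasDerivAt_id u).div_const r).arctan.div_const r).congr_deriv ?_
  simp only [id]
  field_simp

lemma arctan_div_div_mem {r : ℝ} (hr : 0 < r) {u : ℝ} (hu : 0 ≤ u) :
    0 ≤ Real.arctan (u / r) / r ∧ Real.arctan (u / r) / r ≤ 2 / r := by
  have h0 : 0 ≤ Real.arctan (u / r) := Real.arctan_nonneg.2 (by positivity)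
  have h1 := (Real.arctan_lt_pi_div_two (u / r)).le
  have := Real.pi_lt_four
  exact ⟨by positivity, by gcongr; linarith⟩

lemma exp_two_le_eight : Real.exp 2 ≤ 8 := by
  have h := Real.exp_one_lt_d9
  have : Real.exp 2 = Real.exp 1 * Real.exp 1 := by rw [← Real.exp_add]; norm_num
  rw [this]
  nlinarith [Real.exp_pos 1]

/-- Solutions of `y'' = -(1 - q) y` with `q` small stay close to harmonic oscillations. -/
lemma oscillation_bound {r M : ℝ} (hr : 1 ≤ r) (hM : 0 < M) {y y' q : ℝ → ℂ}
    (hy : ∀ u ≥ 0, HasDerivAt y (y' u) u)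
    (hy' : ∀ u ≥ 0, HasDerivAt y' (-(1 - q u) * y u) u)
    (hq : ∀ u ≥ 0, ‖q u‖ ≤ 1 / (4 * (r ^ 2 + u ^ 2)))
    (h0 : ‖y 0‖ ≤ M) (h1 : ‖y' 0‖ ≤ M) {u : ℝ} (hu : 0 ≤ u) :
    ‖y u - (y 0 * Real.cos u + y' 0 * Real.sin u)‖ ≤ 16 * M / r := by
  have hr0 : 0 < r := by linarith
  set v : ℝ → ℂ × ℂ := fun u => (Complex.exp (u * Complex.I) * (y u + Complex.I * y' u),
    Complex.exp (-(u * Complex.I)) * (y u - Complex.I * y' u)) with hv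
  set v' : ℝ → ℂ × ℂ := fun u => (Complex.I * Complex.exp (u * Complex.I) * (q u * y u),
    -Complex.I * Complex.exp (-(u * Complex.I)) * (q u * y u)) with hv'
  have hn1 : ∀ u : ℝ, ‖Complex.exp (-(u * Complex.I))‖ = 1 := fun u => by
    rw [← neg_mul, ← Complex.ofReal_neg]; exact Complex.norm_exp_ofReal_mul_I _
  have hm1 : ∀ (u : ℝ) (w : ℂ), ‖Complex.exp (-(u * Complex.I)) * w‖ = ‖w‖ := fun u w => by
    rw [norm_mul, hn1, one_mul]
  have hm2 : ∀ (u : ℝ) (w : ℂ), ‖Complex.exp (u * Complex.I) * w‖ = ‖w‖ := fun u w => by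
    rw [norm_mul, Complex.norm_exp_ofReal_mul_I, one_mul]
  have hee : ∀ u : ℝ, Complex.exp (u * Complex.I) * Complex.exp (-(u * Complex.I)) = 1 := fun u => by
    rw [← Complex.exp_add]; simp
  have hder : ∀ u ≥ 0, HasDerivAt v (v' u) u := by
    intro u hu
    have e1 := ((hasDerivAt_id u).ofReal_comp.mul_const Complex.I).cexp
    have e2 := ((hasDerivAt_id u).ofReal_comp.mul_const Complex.I).neg.cexp
    have a1 := (e1.mul ((hy u hu).add ((hy' u hu).const_mul Complex.I)))
    have a2 := (e2.mul ((hy u hu).sub ((hy' u hu).const_mul Complex.I)))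
    refine (a1.prodMk a2).congr_deriv ?_
    simp only [hv', id, Pi.add_apply, Pi.sub_apply, Pi.neg_apply, Prod.mk.injEq, Complex.ofReal_one]
    constructor
    · linear_combination (Complex.exp (u * Complex.I) * y' u) * Complex.I_sq
    · linear_combination (Complex.exp (-(u * Complex.I)) * y' u) * Complex.I_sq
  have hvy : ∀ u, ‖y u‖ ≤ ‖v u‖ := by
    intro u
    have e : y u = (Complex.exp (-(u * Complex.I)) * (v u).1 + Complex.exp (u * Complex.I) * (v u).2) / 2 := by
      simp only [hv]
      linear_combination (-y u) * hee u
    have i1 := norm_fst_le (v u)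
    have i2 := norm_snd_le (v u)
    rw [e, norm_div]
    have : ‖Complex.exp (-(u * Complex.I)) * (v u).1 + Complex.exp (u * Complex.I) * (v u).2‖
        ≤ ‖v u‖ + ‖v u‖ := by
      exact (norm_add_le _ _).trans
        (add_le_add ((hm1 _ _).trans_le i1) ((hm2 _ _).trans_le i2))
    rw [Complex.norm_ofNat]
    linarith
  have hv0 : ‖v 0‖ ≤ 2 * M := by
    have e : v 0 = (y 0 + Complex.I * y' 0, y 0 - Complex.I * y' 0) := by simp [hv]
    rw [e, Prod.norm_mk]
    apply max_le
    · refine (norm_add_le _ _).trans ?_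
      rw [norm_mul, Complex.norm_I]; linarith
    · refine (norm_sub_le _ _).trans ?_
      rw [norm_mul, Complex.norm_I]; linarith
  have hv'n : ∀ u ≥ 0, ‖v' u‖ ≤ 1 / (4 * (r ^ 2 + u ^ 2)) * ‖y u‖ := by
    intro u hu
    simp only [hv', Prod.norm_mk, norm_mul, norm_neg, Complex.norm_I, hn1,
      Complex.norm_exp_ofReal_mul_I, one_mul, max_self]
    have := hq u hu
    gcongr
  have hcont : ∀ b, ContinuousOn v (Icc 0 b) := fun b x hx =>
    (hder x hx.1).continuousAt.continuousWithinAt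
  have hpos : ∀ x : ℝ, 0 < r ^ 2 + x ^ 2 := fun x => by positivity
  have hbound : ∀ u ≥ 0, ‖v u‖ ≤ 16 * M := by
    intro u hu
    have hB : ∀ x, HasDerivAt (fun u => 2 * M * Real.exp (Real.arctan (u / r) / r))
        (2 * M * (Real.exp (Real.arctan (x / r) / r) * (1 / (r ^ 2 + x ^ 2)))) x := fun x =>
      ((hasDerivAt_arctan_div_div hr0 x).exp).const_mul _
    have := image_norm_le_of_norm_deriv_right_lt_deriv_boundary (hcont u)
      (fun x hx => (hder x hx.1).hasDerivWithinAt) (by simpa using hv0) hB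
      (fun x hx hx2 => ?_) ⟨hu, le_rfl⟩
    · refine this.trans ?_
      have h2 : Real.arctan (u / r) / r ≤ 2 := (arctan_div_div_mem hr0 hu).2.trans (by
        rw [div_le_iff₀ hr0]; linarith)
      have h3 := (Real.exp_le_exp.2 h2).trans exp_two_le_eight
      nlinarith
    · refine (hv'n x hx.1).trans_lt ?_
      have h4 := hvy x
      rw [hx2] at h4
      calc 1 / (4 * (r ^ 2 + x ^ 2)) * ‖y x‖
          ≤ 1 / (4 * (r ^ 2 + x ^ 2)) * (2 * M * Real.exp (Real.arctan (x / r) / r)) := by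
            have := hpos x
            gcongr
        _ = (1 / 4) * (2 * M * (Real.exp (Real.arctan (x / r) / r) * (1 / (r ^ 2 + x ^ 2)))) := by
            have := (hpos x).ne'
            field_simp
        _ < _ := by
            have : 0 < 2 * M * (Real.exp (Real.arctan (x / r) / r) * (1 / (r ^ 2 + x ^ 2))) := by
              have := hpos x
              positivity
            linarith
  have hdiff : ‖v u - v 0‖ ≤ 4 * M * (Real.arctan (u / r) / r) := by
    have hB : ∀ x, HasDerivAt (fun u => 4 * M * (Real.arctan (u / r) / r))
        (4 * M * (1 / (r ^ 2 + x ^ 2))) x := fun x =>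
      (hasDerivAt_arctan_div_div hr0 x).const_mul _
    refine image_norm_le_of_norm_deriv_right_le_deriv_boundary (f := fun u => v u - v 0)
      ((hcont u).sub continuousOn_const)
      (fun x hx => ((hder x hx.1).sub_const _).hasDerivWithinAt) (by simp) hB
      (fun x hx => ?_) ⟨hu, le_rfl⟩
    refine (hv'n x hx.1).trans ?_
    calc 1 / (4 * (r ^ 2 + x ^ 2)) * ‖y x‖
        ≤ 1 / (4 * (r ^ 2 + x ^ 2)) * (16 * M) := by
          have := hpos x
          have := (hvy x).trans (hbound x hx.1)
          gcongr
      _ = 4 * M * (1 / (r ^ 2 + x ^ 2)) := by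
          have := (hpos x).ne'
          field_simp
          norm_num
  have hcs : Complex.exp (u * Complex.I) = Complex.cos u + Complex.sin u * Complex.I :=
    Complex.exp_mul_I _
  have hcs' : Complex.exp (-(u * Complex.I)) = Complex.cos u - Complex.sin u * Complex.I := by
    rw [← neg_mul, Complex.exp_mul_I, Complex.cos_neg, Complex.sin_neg]; ring
  have e : y u - (y 0 * Real.cos u + y' 0 * Real.sin u)
      = (Complex.exp (-(u * Complex.I)) * (v u - v 0).1
        + Complex.exp (u * Complex.I) * (v u - v 0).2) / 2 := by
    simp only [hv, Prod.fst_sub, Prod.snd_sub]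
    rw [Complex.ofReal_zero, zero_mul, neg_zero, Complex.exp_zero, one_mul, one_mul]
    push_cast
    have h3 : (Complex.cos u : ℂ) = (Complex.exp (u * Complex.I) + Complex.exp (-(u * Complex.I))) / 2 := by
      rw [hcs, hcs']; ring
    have h4 : (Complex.sin u : ℂ) = (Complex.exp (-(u * Complex.I)) - Complex.exp (u * Complex.I)) * Complex.I / 2 := by
      rw [hcs, hcs']; linear_combination (Complex.sin u) * Complex.I_sq
    rw [h3, h4]
    linear_combination (-y u) * hee u
  have i1 := norm_fst_le (v u - v 0)
  have i2 := norm_snd_le (v u - v 0)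
  have hfin : ‖v u - v 0‖ ≤ 16 * M / r := by
    refine hdiff.trans ?_
    have := (arctan_div_div_mem hr0 hu).2
    calc 4 * M * (Real.arctan (u / r) / r) ≤ 4 * M * (2 / r) := by gcongr
      _ = 8 * M / r := by ring
      _ ≤ 16 * M / r := by gcongr; linarith
  rw [e, norm_div, Complex.norm_ofNat, div_le_iff₀ (by norm_num)]
  refine (norm_add_le _ _).trans ?_
  rw [hm1, hm2]
  linarith

/-- The closed first quadrant. -/
def quad : Set ℂ := {z | 0 ≤ z.re ∧ 0 ≤ z.im}

/-- The open first quadrant. -/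
def quadInt : Set ℂ := {z | 0 < z.re ∧ 0 < z.im}

lemma mem_slitPlane_of_mem_quad {z : ℂ} (hz : z ∈ quad) (h0 : z ≠ 0) : z ∈ Complex.slitPlane := by
  rw [Complex.mem_slitPlane_iff]
  by_contra! h
  exact h0 (Complex.ext (le_antisymm h.1 hz.1) h.2)

lemma add_mul_I_mem_quad {z : ℂ} (hz : z ∈ quad) {u : ℝ} (hu : 0 ≤ u) :
    z + u * Complex.I ∈ quad := by
  constructor
  · simpa using hz.1
  · simpa using add_nonneg hz.2 hu

lemma sq_add_sq_le_norm_sq {s : ℂ} (hs : s ∈ quad) {u : ℝ} (hu : 0 ≤ u) :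
    ‖s‖ ^ 2 + u ^ 2 ≤ ‖s + u * Complex.I‖ ^ 2 := by
  rw [← Complex.normSq_eq_norm_sq, ← Complex.normSq_eq_norm_sq, Complex.normSq_apply,
    Complex.normSq_apply]
  simp
  nlinarith [mul_nonneg hs.2 hu]

lemma norm_le_norm_add {s : ℂ} (hs : s ∈ quad) {u : ℝ} (hu : 0 ≤ u) :
    ‖s‖ ≤ ‖s + u * Complex.I‖ := by
  have := sq_add_sq_le_norm_sq hs hu
  exact le_of_sq_le_sq (by nlinarith [sq_nonneg u]) (norm_nonneg _)

/-- The principal square root. -/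
noncomputable def csqrt (z : ℂ) : ℂ := Complex.exp (Complex.log z / 2)

lemma csqrt_sq {z : ℂ} (hz : z ≠ 0) : csqrt z ^ 2 = z := by
  rw [csqrt, ← Complex.exp_nat_mul]
  rw [Nat.cast_ofNat, mul_div_cancel₀ _ two_ne_zero, Complex.exp_log hz]

lemma norm_csqrt {z : ℂ} (hz : z ≠ 0) : ‖csqrt z‖ = √‖z‖ := by
  rw [eq_comm, Real.sqrt_eq_iff_eq_sq (norm_nonneg _) (norm_nonneg _), ← norm_pow, csqrt_sq hz]

lemma hasDerivAt_csqrt {z : ℂ} (hz : z ∈ Complex.slitPlane) :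
    HasDerivAt csqrt (csqrt z / (2 * z)) z := by
  refine ((Complex.hasDerivAt_log hz).div_const 2).cexp.congr_deriv ?_
  have := Complex.slitPlane_ne_zero hz
  simp only [csqrt]
  field_simp

/-- The derivative of `csqrt * f`. -/
noncomputable def liouville' (f f' : ℂ → ℂ) (z : ℂ) : ℂ :=
  csqrt z * f' z + csqrt z * f z / (2 * z)

lemma IsBesselSol.oscillation {f f' : ℂ → ℂ} (hf : IsBesselSol f f') {s : ℂ} (hs : s ∈ quad)
    (h1 : 1 ≤ ‖s‖) {M : ℝ} (hM : 0 < M) (hM0 : ‖csqrt s * f s‖ ≤ M) (hM1 : ‖liouville' f f' s‖ ≤ M)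
    {u : ℝ} (hu : 0 ≤ u) :
    ‖csqrt (s + u * Complex.I) * f (s + u * Complex.I)
      - (csqrt s * f s * Real.cos u + Complex.I * liouville' f f' s * Real.sin u)‖
      ≤ 16 * M / ‖s‖ := by
  have hslit : ∀ u ≥ (0 : ℝ), s + u * Complex.I ∈ Complex.slitPlane := fun u hu =>
    mem_slitPlane_of_mem_quad (add_mul_I_mem_quad hs hu)
      (norm_pos_iff.1 (by linarith [norm_le_norm_add hs hu]))
  have hline : ∀ u : ℝ, HasDerivAt (fun u : ℝ => s + u * Complex.I) Complex.I u := fun u => by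
    simpa using ((hasDerivAt_id u).ofReal_comp.mul_const Complex.I).const_add s
  have key := oscillation_bound h1 hM
    (y := fun u => csqrt (s + u * Complex.I) * f (s + u * Complex.I))
    (y' := fun u => Complex.I * liouville' f f' (s + u * Complex.I))
    (q := fun u => 1 / (4 * (s + u * Complex.I) ^ 2)) ?_ ?_ ?_ ?_ ?_ hu
  · simpa using key
  · intro u hu
    have hz := hslit u hu
    have h := ((hasDerivAt_csqrt hz).mul (hf _ hz).1).comp u (hline u)
    refine h.congr_deriv ?_
    simp only [liouville']
    ring
  · intro u hu
    have hz := hslit u hu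
    have h0 := Complex.slitPlane_ne_zero hz
    have h := ((((hasDerivAt_csqrt hz).mul (hf _ hz).2).add
      (((hasDerivAt_csqrt hz).mul (hf _ hz).1).div ((hasDerivAt_id _).const_mul 2)
        (mul_ne_zero two_ne_zero h0))).comp u (hline u)).const_mul Complex.I
    refine h.congr_deriv ?_
    simp only [Pi.mul_apply, id]
    generalize s + u * Complex.I = z at *
    field_simp
    simp only [Complex.I_sq]
    ring
  · intro u hu
    have hz := norm_le_norm_add hs hu
    have h2 := sq_add_sq_le_norm_sq hs hu
    rw [norm_div, norm_one, norm_mul, norm_pow, Complex.norm_ofNat]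
    have : 0 < ‖s‖ ^ 2 + u ^ 2 := by positivity
    gcongr
  · simpa using hM0
  · simpa using hM1

lemma csqrt_liouville_bound {f f' : ℂ → ℂ} {s : ℂ} (h1 : 1 ≤ ‖s‖) {M : ℝ}
    (h2 : √‖s‖ * ‖f s‖ ≤ M) (h3 : √‖s‖ * ‖f' s‖ ≤ M) :
    ‖csqrt s * f s‖ ≤ 2 * M ∧ ‖liouville' f f' s‖ ≤ 2 * M := by
  have h0 : s ≠ 0 := norm_pos_iff.1 (by linarith)
  have hM : 0 ≤ M := le_trans (by positivity) h2
  refine ⟨by rw [norm_mul, norm_csqrt h0]; linarith, ?_⟩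
  refine (norm_add_le _ _).trans ?_
  rw [norm_div, norm_mul, norm_mul, norm_csqrt h0, norm_mul, Complex.norm_ofNat]
  have : √‖s‖ * ‖f s‖ / (2 * ‖s‖) ≤ M := by
    rw [div_le_iff₀ (by positivity)]
    nlinarith
  linarith

lemma IsBesselSol.norm_le_of_start {f f' : ℂ → ℂ} (hf : IsBesselSol f f') {s : ℂ} (hs : s ∈ quad)
    (h1 : 1 ≤ ‖s‖) {M : ℝ} (hM : 0 < M) (h2 : √‖s‖ * ‖f s‖ ≤ M) (h3 : √‖s‖ * ‖f' s‖ ≤ M)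
    {u : ℝ} (hu : 0 ≤ u) :
    √‖s + u * Complex.I‖ * ‖f (s + u * Complex.I)‖ ≤ 40 * M := by
  obtain ⟨b0, b1⟩ := csqrt_liouville_bound h1 h2 h3
  have key := hf.oscillation hs h1 (by positivity : 0 < 2 * M) b0 b1 hu
  have hz : s + u * Complex.I ≠ 0 := norm_pos_iff.1 (by linarith [norm_le_norm_add hs hu])
  rw [← norm_csqrt hz, ← norm_mul]
  have e1 : 16 * (2 * M) / ‖s‖ ≤ 32 * M := by
    rw [div_le_iff₀ (by linarith)]
    nlinarith
  have e2 : ‖csqrt s * f s * Real.cos u + Complex.I * liouville' f f' s * Real.sin u‖ ≤ 4 * M := by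
    refine (norm_add_le _ _).trans ?_
    rw [norm_mul, norm_mul (Complex.I * _), norm_mul Complex.I, Complex.norm_I, one_mul,
      Complex.norm_real, Complex.norm_real]
    have c1 : ‖Real.cos u‖ ≤ 1 := Real.abs_cos_le_one u
    have c2 : ‖Real.sin u‖ ≤ 1 := Real.abs_sin_le_one u
    have := mul_le_mul b0 c1 (norm_nonneg _) (by linarith)
    have := mul_le_mul b1 c2 (norm_nonneg _) (by linarith)
    linarith
  have := norm_le_norm_add_norm_sub' (csqrt (s + u * Complex.I) * f (s + u * Complex.I))
    (csqrt s * f s * Real.cos u + Complex.I * liouville' f f' s * Real.sin u)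
  linarith

lemma IsBesselSol.continuousOn {f f' : ℂ → ℂ} (hf : IsBesselSol f f') :
    ContinuousOn f Complex.slitPlane ∧ ContinuousOn f' Complex.slitPlane :=
  ⟨fun z hz => (hf z hz).1.continuousAt.continuousWithinAt,
    fun z hz => (hf z hz).2.continuousAt.continuousWithinAt⟩

lemma isClosed_quad : IsClosed quad :=
  (isClosed_le continuous_const Complex.continuous_re).inter
    (isClosed_le continuous_const Complex.continuous_im)

lemma IsBesselSol.bounded_on_arc {f f' : ℂ → ℂ} (hf : IsBesselSol f f') :
    ∃ M > 0, ∀ s ∈ quad, ‖s‖ = 1 → √‖s‖ * ‖f s‖ ≤ M ∧ √‖s‖ * ‖f' s‖ ≤ M := by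
  have hc : IsCompact (Metric.sphere (0 : ℂ) 1 ∩ quad) :=
    (isCompact_sphere 0 1).inter_right isClosed_quad
  have hsub : Metric.sphere (0 : ℂ) 1 ∩ quad ⊆ Complex.slitPlane := fun z hz =>
    mem_slitPlane_of_mem_quad hz.2 (norm_pos_iff.1 (by
      have : ‖z‖ = 1 := mem_sphere_zero_iff_norm.1 hz.1
      linarith))
  obtain ⟨C1, h1⟩ := hc.exists_bound_of_continuousOn (hf.continuousOn.1.mono hsub)
  obtain ⟨C2, h2⟩ := hc.exists_bound_of_continuousOn (hf.continuousOn.2.mono hsub)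
  refine ⟨max (max C1 C2) 1, by positivity, fun s hs hs1 => ?_⟩
  have hm : s ∈ Metric.sphere (0 : ℂ) 1 ∩ quad := ⟨mem_sphere_zero_iff_norm.2 hs1, hs⟩
  rw [hs1, Real.sqrt_one, one_mul, one_mul]
  exact ⟨(h1 s hm).trans ((le_max_left _ _).trans (le_max_left _ _)),
    (h2 s hm).trans ((le_max_right _ _).trans (le_max_left _ _))⟩

/-- Exponential bounds on the real axis propagate to the quadrant. -/
lemma IsBesselSol.quad_bound {f f' : ℂ → ℂ} (hf : IsBesselSol f f') {σ C : ℝ} (hC : 0 < C)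
    (h : ∀ x : ℝ, 1 ≤ x → √x * ‖f x‖ ≤ C * Real.exp (σ * x) ∧ √x * ‖f' x‖ ≤ C * Real.exp (σ * x)) :
    ∃ D > 0, ∀ z ∈ quad, 1 ≤ ‖z‖ → √‖z‖ * ‖f z‖ ≤ D * Real.exp (σ * z.re) := by
  obtain ⟨M, hM, harc⟩ := hf.bounded_on_arc
  refine ⟨40 * C + 40 * M * Real.exp |σ|, by positivity, fun z hz h1 => ?_⟩
  have hpos := Real.exp_pos (σ * z.re)
  have hza : 0 ≤ 40 * M * Real.exp |σ| * Real.exp (σ * z.re) := by positivity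
  have hzb : 0 ≤ 40 * C * Real.exp (σ * z.re) := by positivity
  rcases le_or_gt 1 z.re with hx | hx
  · have hn : ‖(z.re : ℂ)‖ = z.re := by
      rw [Complex.norm_real, Real.norm_of_nonneg hz.1]
    have hq : (z.re : ℂ) ∈ quad := ⟨by simpa using hz.1, by simp⟩
    have := hf.norm_le_of_start (s := (z.re : ℂ)) (M := C * Real.exp (σ * z.re)) hq
      (by rw [hn]; exact hx) (by positivity)
      (by rw [hn]; exact (h _ hx).1) (by rw [hn]; exact (h _ hx).2) hz.2
    rw [Complex.re_add_im] at this
    linarith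
  · set t := √(1 - z.re ^ 2) with ht
    have hz1 := hz.1
    have hsq : t ^ 2 = 1 - z.re ^ 2 := Real.sq_sqrt (by nlinarith)
    have ht0 : 0 ≤ t := Real.sqrt_nonneg _
    have hle : t ≤ z.im := by
      apply le_of_sq_le_sq _ hz.2
      have : 1 ≤ ‖z‖ ^ 2 := by nlinarith
      rw [← Complex.normSq_eq_norm_sq, Complex.normSq_apply] at this
      nlinarith
    have hq : (z.re + t * Complex.I : ℂ) ∈ quad := ⟨by simpa using hz.1, by simpa using ht0⟩
    have hn : ‖(z.re + t * Complex.I : ℂ)‖ = 1 := by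
      rw [Complex.norm_add_mul_I, hsq]
      simp
    obtain ⟨b1, b2⟩ := harc _ hq hn
    have := hf.norm_le_of_start hq hn.ge hM b1 b2 (sub_nonneg.2 hle)
    have e : (z.re + t * Complex.I : ℂ) + ((z.im - t : ℝ) : ℂ) * Complex.I = z := by
      conv_rhs => rw [← Complex.re_add_im z]
      push_cast
      ring
    rw [e] at this
    refine this.trans ?_
    have h5 : 1 ≤ Real.exp |σ| * Real.exp (σ * z.re) := by
      rw [← Real.exp_add]
      apply Real.one_le_exp
      have := neg_abs_le (σ * z.re)
      rw [abs_mul, abs_of_nonneg hz.1] at this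
      nlinarith [abs_nonneg σ]
    nlinarith

lemma sqrt_mul_besselI0_le {x : ℝ} (hx : 0 < x) : √x * besselI0 x ≤ Real.exp x := by
  have hb : 0 < 2 * x / π ^ 2 := by positivity
  have hinteg : IntegrableOn (fun θ : ℝ => Real.exp x * Real.exp (-(2 * x / π ^ 2) * θ ^ 2)) (Ioi 0) :=
    ((integrable_exp_neg_mul_sq hb).const_mul _).integrableOn
  have h1 : ∫ θ in (0 : ℝ)..π, Real.exp (x * Real.cos θ)
      ≤ Real.exp x * (√(π / (2 * x / π ^ 2)) / 2) := by
    rw [← integral_gaussian_Ioi, ← integral_const_mul,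
      intervalIntegral.integral_of_le Real.pi_pos.le]
    refine le_trans ?_ (setIntegral_mono_set hinteg (Eventually.of_forall fun θ => by positivity)
      (show Ioc (0 : ℝ) π ⊆ Ioi 0 from Ioc_subset_Ioi_self).eventuallyLE)
    refine setIntegral_mono_on ?_ (hinteg.mono_set Ioc_subset_Ioi_self) measurableSet_Ioc
      fun θ hθ => ?_
    · exact (Continuous.integrableOn_Icc (by fun_prop)).mono_set Ioc_subset_Icc_self
    · rw [← Real.exp_add]
      apply Real.exp_le_exp.2
      have := Real.cos_le_one_sub_mul_cos_sq (x := θ) (abs_le.2 ⟨by linarith [hθ.1, Real.pi_pos], hθ.2⟩)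
      calc x * Real.cos θ ≤ x * (1 - 2 / π ^ 2 * θ ^ 2) := by gcongr
        _ = _ := by ring
  have h2 : √x * √(π / (2 * x / π ^ 2)) ≤ 2 * π := by
    rw [← Real.sqrt_mul hx.le, Real.sqrt_le_left (by positivity)]
    have : x * (π / (2 * x / π ^ 2)) = π ^ 2 * (π / 2) := by field_simp
    rw [this]
    nlinarith [Real.pi_lt_four, sq_nonneg π]
  unfold besselI0
  calc √x * (1 / π * ∫ θ in (0 : ℝ)..π, Real.exp (x * Real.cos θ))
      ≤ √x * (1 / π * (Real.exp x * (√(π / (2 * x / π ^ 2)) / 2))) := by gcongr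
    _ = (√x * √(π / (2 * x / π ^ 2))) * (Real.exp x / (2 * π)) := by
        field_simp
    _ ≤ (2 * π) * (Real.exp x / (2 * π)) := by gcongr
    _ = Real.exp x := by field_simp

lemma norm_cI'_ofReal_le (x : ℝ) : ‖cI' x‖ ≤ besselI0 x := by
  unfold cI' cosTransform besselI0
  rw [← intervalIntegral.integral_const_mul]
  refine intervalIntegral.norm_integral_le_of_norm_le Real.pi_pos.le
    (Eventually.of_forall fun θ _ => ?_) (Continuous.intervalIntegrable (by fun_prop) _ _)
  simp only [densI]
  rw [norm_mul, Complex.norm_real, norm_mul, Complex.norm_exp,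
    Real.norm_of_nonneg (by positivity : (0 : ℝ) ≤ 1 / π), ← Complex.ofReal_mul, Complex.ofReal_re]
  have : ‖Real.cos θ‖ ≤ 1 := Real.abs_cos_le_one θ
  have h2 : 1 / π * ‖Real.cos θ‖ ≤ 1 / π := mul_le_of_le_one_right (by positivity) this
  gcongr

lemma one_add_sq_div_two_le_cosh (t : ℝ) : 1 + t ^ 2 / 2 ≤ Real.cosh t := by
  have h : Real.cosh t = 1 + 2 * Real.sinh (t / 2) ^ 2 := by
    have e : Real.cosh t = Real.cosh (2 * (t / 2)) := by ring_nf
    rw [e, Real.cosh_two_mul, Real.cosh_sq]; ring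
  have h2 : (t / 2) ^ 2 ≤ Real.sinh (t / 2) ^ 2 := by
    rw [sq_le_sq]
    rcases le_total 0 (t / 2) with h0 | h0
    · rw [abs_of_nonneg h0, abs_of_nonneg (Real.sinh_nonneg_iff.2 h0)]
      exact Real.self_le_sinh_iff.2 h0
    · rw [abs_of_nonpos h0, abs_of_nonpos (Real.sinh_nonpos_iff.2 h0)]
      exact neg_le_neg (Real.sinh_le_self_iff.2 h0)
  rw [h]
  nlinarith

lemma sqrt_mul_coshMoment_zero_le {x : ℝ} (hx : 0 < x) :
    √x * coshMoment 0 x ≤ 2 * Real.exp (-x) := by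
  have hinteg : IntegrableOn (fun t : ℝ => Real.exp (-x) * Real.exp (-(x / 2) * t ^ 2)) (Ioi 0) :=
    ((integrable_exp_neg_mul_sq (by positivity : 0 < x / 2)).const_mul _).integrableOn
  have h1 : coshMoment 0 x ≤ Real.exp (-x) * (√(π / (x / 2)) / 2) := by
    rw [← integral_gaussian_Ioi, ← integral_const_mul]
    refine setIntegral_mono (integrableOn_coshMoment 0 hx) hinteg fun t => ?_
    simp only
    rw [← Real.exp_add, pow_zero, one_mul]
    apply Real.exp_le_exp.2
    have := one_add_sq_div_two_le_cosh t
    nlinarith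
  have h2 : √x * √(π / (x / 2)) ≤ 4 := by
    rw [← Real.sqrt_mul hx.le, Real.sqrt_le_left (by positivity)]
    have : x * (π / (x / 2)) = 2 * π := by field_simp
    rw [this]
    nlinarith [Real.pi_lt_four]
  calc √x * coshMoment 0 x ≤ √x * (Real.exp (-x) * (√(π / (x / 2)) / 2)) := by gcongr
    _ = (√x * √(π / (x / 2))) * (Real.exp (-x) / 2) := by ring
    _ ≤ 4 * (Real.exp (-x) / 2) := by gcongr
    _ = _ := by ring

lemma sqrt_mul_coshMoment_one_le {x : ℝ} (hx : 1 ≤ x) :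
    √x * coshMoment 1 x ≤ 3 * Real.exp (-x) := by
  have hx0 : 0 < x := by linarith
  have h := (coshMoment_one_bounds hx0).2.2
  have h0 := sqrt_mul_coshMoment_zero_le hx0
  have hs : 1 ≤ √x := Real.one_le_sqrt.2 hx
  have hsx : √x * √x = x := Real.mul_self_sqrt hx0.le
  have h3 : √x * (√x * coshMoment 1 x) ≤ √x * (3 * Real.exp (-x)) := by
    calc √x * (√x * coshMoment 1 x) = x * coshMoment 1 x := by rw [← mul_assoc, hsx]
      _ ≤ Real.exp (-x) + √x * (√x * coshMoment 0 x) := by rw [← mul_assoc, hsx]; exact h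
      _ ≤ √x * Real.exp (-x) + √x * (2 * Real.exp (-x)) := by
          gcongr
          exact le_mul_of_one_le_left (Real.exp_pos _).le hs
      _ = _ := by ring
  exact le_of_mul_le_mul_left h3 (by linarith)

lemma cI_quad_bound :
    ∃ D > 0, ∀ z ∈ quad, 1 ≤ ‖z‖ → √‖z‖ * ‖cI z‖ ≤ D * Real.exp z.re := by
  have := isBesselSol_cI.quad_bound (σ := 1) one_pos fun x hx => ?_
  · simpa using this
  · have h := sqrt_mul_besselI0_le (lt_of_lt_of_le one_pos hx)
    rw [one_mul, one_mul, cI_ofReal, Complex.norm_real, Real.norm_of_nonneg (besselI0_pos x).le]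
    exact ⟨h, le_trans (by gcongr; exact norm_cI'_ofReal_le x) h⟩

lemma cK_quad_bound :
    ∃ D > 0, ∀ z ∈ quad, 1 ≤ ‖z‖ → √‖z‖ * ‖cK z‖ ≤ D * Real.exp (-z.re) := by
  have := isBesselSol_cK.quad_bound (σ := -1) (C := 3) (by norm_num) fun x hx => ?_
  · simpa using this
  · have hx0 : 0 < x := by linarith
    have h := sqrt_mul_coshMoment_zero_le hx0
    have h1 := sqrt_mul_coshMoment_one_le hx
    rw [neg_one_mul, cK_ofReal_aux hx0, cK'_ofReal hx0, Complex.norm_real, Complex.norm_real,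
      norm_neg, Real.norm_of_nonneg (coshMoment_nonneg _ x),
      Real.norm_of_nonneg (coshMoment_nonneg _ x)]
    exact ⟨by linarith [Real.exp_pos (-x)], h1⟩

lemma continuous_cI : Continuous cI :=
  continuous_iff_continuousAt.2 fun z => (hasDerivAt_cI z).continuousAt

lemma continuous_cE : Continuous cE :=
  continuous_iff_continuousAt.2 fun z => (hasDerivAt_cE z).continuousAt

lemma norm_log_le {z : ℂ} (h0 : z ≠ 0) (h1 : ‖z‖ ≤ 1) :
    ‖Complex.log z‖ ≤ 20 * ‖z‖ ^ (-(1 / 16) : ℝ) := by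
  have hz : 0 < ‖z‖ := norm_pos_iff.2 h0
  have h := Real.abs_log_mul_self_rpow_lt ‖z‖ (1 / 16) hz h1 (by norm_num)
  have hp : ‖z‖ ^ (1 / 16 : ℝ) * ‖z‖ ^ (-(1 / 16) : ℝ) = 1 := by
    rw [← Real.rpow_add hz]; simp
  have hq : 0 < ‖z‖ ^ (-(1 / 16) : ℝ) := Real.rpow_pos_of_pos hz _
  have hone : 1 ≤ ‖z‖ ^ (-(1 / 16) : ℝ) :=
    Real.one_le_rpow_of_pos_of_le_one_of_nonpos hz h1 (by norm_num)
  have h2 : |Real.log ‖z‖| ≤ 16 * ‖z‖ ^ (-(1 / 16) : ℝ) := by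
    rw [abs_mul, abs_of_pos (Real.rpow_pos_of_pos hz _)] at h
    calc |Real.log ‖z‖| = |Real.log ‖z‖| * (‖z‖ ^ (1 / 16 : ℝ) * ‖z‖ ^ (-(1 / 16) : ℝ)) := by
          rw [hp, mul_one]
      _ = (|Real.log ‖z‖| * ‖z‖ ^ (1 / 16 : ℝ)) * ‖z‖ ^ (-(1 / 16) : ℝ) := by ring
      _ ≤ 16 * ‖z‖ ^ (-(1 / 16) : ℝ) := by gcongr; linarith
  have h3 := Complex.norm_le_abs_re_add_abs_im (Complex.log z)
  rw [Complex.log_re, Complex.log_im] at h3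
  have h4 := Complex.abs_arg_le_pi z
  have := Real.pi_lt_four
  linarith

lemma small_bounds : ∃ D > 0, ∀ z : ℂ, z ≠ 0 → ‖z‖ ≤ 1 →
    ‖cI z‖ ≤ D ∧ ‖cK z‖ ≤ D * ‖z‖ ^ (-(1 / 16) : ℝ) := by
  have hc : IsCompact (Metric.closedBall (0 : ℂ) 1) := isCompact_closedBall 0 1
  obtain ⟨A, hA⟩ := hc.exists_bound_of_continuousOn continuous_cI.continuousOn
  obtain ⟨B, hB⟩ := hc.exists_bound_of_continuousOn continuous_cE.continuousOn
  have hA0 : 0 ≤ A := (norm_nonneg _).trans (hA 0 (by simp))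
  have hB0 : 0 ≤ B := (norm_nonneg _).trans (hB 0 (by simp))
  refine ⟨20 * A + B + |coefK| * A + A + 1, by positivity, fun z h0 h1 => ?_⟩
  have hz : 0 < ‖z‖ := norm_pos_iff.2 h0
  have hm : z ∈ Metric.closedBall (0 : ℂ) 1 := by simpa using h1
  have a := hA z hm
  have b := hB z hm
  have hone : 1 ≤ ‖z‖ ^ (-(1 / 16) : ℝ) :=
    Real.one_le_rpow_of_pos_of_le_one_of_nonpos hz h1 (by norm_num)
  have hl := norm_log_le h0 h1
  have hk : 0 ≤ |coefK| * A := by positivity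
  refine ⟨by linarith, ?_⟩
  set P := ‖z‖ ^ (-(1 / 16) : ℝ) with hP
  have h5 : ‖cK z‖ ≤ ‖Complex.log z‖ * ‖cI z‖ + ‖cE z‖ + |coefK| * ‖cI z‖ := by
    unfold cK
    refine (norm_add_le _ _).trans ?_
    rw [norm_neg, norm_mul (coefK : ℂ), Complex.norm_real, Real.norm_eq_abs, ← norm_mul]
    gcongr
    exact norm_add_le _ _
  calc ‖cK z‖ ≤ 20 * P * A + B + |coefK| * A := by
        refine h5.trans ?_
        gcongr
    _ ≤ 20 * P * A + B * P + |coefK| * A * P + (A + 1) * P := by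
        have : B ≤ B * P := le_mul_of_one_le_right hB0 hone
        have : |coefK| * A ≤ |coefK| * A * P := le_mul_of_one_le_right hk hone
        have : 0 ≤ (A + 1) * P := by positivity
        linarith
    _ = _ := by ring

/-- The weight `I₀^{8-b} K₀^b z`. -/
noncomputable def weight (b : ℕ) (z : ℂ) : ℂ := cI z ^ (8 - b) * cK z ^ b * z

lemma weight_bound_large : ∃ C > 0, ∀ b ≤ 8, ∀ z ∈ quad, 1 ≤ ‖z‖ →
    ‖weight b z‖ ≤ C * Real.exp ((8 - 2 * b) * z.re) / ‖z‖ ^ 3 := by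
  obtain ⟨D1, hD1, h1⟩ := cI_quad_bound
  obtain ⟨D2, hD2, h2⟩ := cK_quad_bound
  set D := max D1 D2 with hD
  have hD0 : 0 < D := lt_max_of_lt_left hD1
  refine ⟨D ^ 8, by positivity, fun b hb z hz hn => ?_⟩
  have hz0 : 0 < ‖z‖ := by linarith
  have a : √‖z‖ * ‖cI z‖ ≤ D * Real.exp z.re :=
    (h1 z hz hn).trans (by gcongr; exact le_max_left _ _)
  have k : √‖z‖ * ‖cK z‖ ≤ D * Real.exp (-z.re) :=
    (h2 z hz hn).trans (by gcongr; exact le_max_right _ _)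
  rw [le_div_iff₀ (by positivity)]
  have e4 : √‖z‖ ^ 8 = ‖z‖ ^ 4 := by
    rw [show 8 = 2 * 4 by norm_num, pow_mul, Real.sq_sqrt hz0.le]
  have e5 : √‖z‖ ^ 8 = √‖z‖ ^ (8 - b) * √‖z‖ ^ b := by
    rw [← pow_add, Nat.sub_add_cancel hb]
  have e6 : D ^ 8 = D ^ (8 - b) * D ^ b := by
    rw [← pow_add, Nat.sub_add_cancel hb]
  have e7 : Real.exp ((8 - 2 * b) * z.re) = Real.exp z.re ^ (8 - b) * Real.exp (-z.re) ^ b := by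
    rw [← Real.exp_nat_mul, ← Real.exp_nat_mul, ← Real.exp_add, Nat.cast_sub hb]
    congr 1
    push_cast
    ring
  calc ‖weight b z‖ * ‖z‖ ^ 3 = ‖cI z‖ ^ (8 - b) * ‖cK z‖ ^ b * √‖z‖ ^ 8 := by
        rw [weight, norm_mul, norm_mul, norm_pow, norm_pow, e4]; ring
    _ = (√‖z‖ * ‖cI z‖) ^ (8 - b) * (√‖z‖ * ‖cK z‖) ^ b := by rw [e5, mul_pow, mul_pow]; ring
    _ ≤ (D * Real.exp z.re) ^ (8 - b) * (D * Real.exp (-z.re)) ^ b := by gcongr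
    _ = _ := by rw [e6, e7, mul_pow, mul_pow]; ring

lemma weight_zero (b : ℕ) : weight b 0 = 0 := by simp [weight]

lemma weight_bound_small : ∃ C > 0, ∀ b ≤ 8, ∀ z : ℂ, ‖z‖ ≤ 1 →
    ‖weight b z‖ ≤ C * √‖z‖ := by
  obtain ⟨D, hD, h⟩ := small_bounds
  refine ⟨D ^ 8, by positivity, fun b hb z hn => ?_⟩
  rcases eq_or_ne z 0 with rfl | h0
  · simp [weight_zero]
  have hz : 0 < ‖z‖ := norm_pos_iff.2 h0
  obtain ⟨a, k⟩ := h z h0 hn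
  set P := ‖z‖ ^ (-(1 / 16) : ℝ) with hP
  have hP0 : 0 < P := Real.rpow_pos_of_pos hz _
  have hone : 1 ≤ P := Real.one_le_rpow_of_pos_of_le_one_of_nonpos hz hn (by norm_num)
  have e6 : D ^ 8 = D ^ (8 - b) * D ^ b := by
    rw [← pow_add, Nat.sub_add_cancel hb]
  have e7 : P ^ 8 * ‖z‖ = √‖z‖ := by
    rw [hP, ← Real.rpow_natCast, ← Real.rpow_mul hz.le, Real.sqrt_eq_rpow]
    nth_rewrite 2 [← Real.rpow_one ‖z‖]
    rw [← Real.rpow_add hz]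
    norm_num
  calc ‖weight b z‖ = ‖cI z‖ ^ (8 - b) * ‖cK z‖ ^ b * ‖z‖ := by
        rw [weight, norm_mul, norm_mul, norm_pow, norm_pow]
    _ ≤ D ^ (8 - b) * (D * P) ^ b * ‖z‖ := by gcongr
    _ = D ^ 8 * (P ^ b * ‖z‖) := by rw [e6, mul_pow]; ring
    _ ≤ D ^ 8 * (P ^ 8 * ‖z‖) := by gcongr
    _ = _ := by rw [e7]

lemma weight_bound : ∃ C > 0, ∀ b ≤ 8, ∀ z ∈ quad,
    ‖weight b z‖ ≤ C * Real.exp ((8 - 2 * b) * z.re) / (1 + ‖z‖ ^ 2) := by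
  obtain ⟨C1, hC1, h1⟩ := weight_bound_large
  obtain ⟨C2, hC2, h2⟩ := weight_bound_small
  refine ⟨2 * C1 + 2 * C2 * Real.exp 8, by positivity, fun b hb z hz => ?_⟩
  have hE := Real.exp_pos ((8 - 2 * b) * z.re)
  rcases le_total 1 ‖z‖ with hn | hn
  · refine (h1 b hb z hz hn).trans ?_
    rw [div_le_div_iff₀ (by positivity) (by positivity)]
    have : 1 + ‖z‖ ^ 2 ≤ 2 * ‖z‖ ^ 3 := by nlinarith [sq_nonneg ‖z‖, mul_nonneg (sub_nonneg.2 hn) (sq_nonneg ‖z‖)]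
    calc C1 * Real.exp ((8 - 2 * b) * z.re) * (1 + ‖z‖ ^ 2)
        ≤ C1 * Real.exp ((8 - 2 * b) * z.re) * (2 * ‖z‖ ^ 3) := by gcongr
      _ ≤ _ := by
        have : 0 ≤ 2 * C2 * Real.exp 8 * (Real.exp ((8 - 2 * b) * z.re) * ‖z‖ ^ 3) := by positivity
        nlinarith
  · refine (h2 b hb z hn).trans ?_
    rw [le_div_iff₀ (by positivity)]
    have hs : √‖z‖ ≤ 1 := Real.sqrt_le_one.2 hn
    have h5 : 1 ≤ Real.exp 8 * Real.exp ((8 - 2 * b) * z.re) := by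
      rw [← Real.exp_add]
      apply Real.one_le_exp
      have hre : z.re ≤ 1 := (Complex.re_le_norm z).trans hn
      have hb' : (b : ℝ) ≤ 8 := by exact_mod_cast hb
      nlinarith [hz.1]
    have h6 : 1 + ‖z‖ ^ 2 ≤ 2 := by nlinarith [norm_nonneg z]
    calc C2 * √‖z‖ * (1 + ‖z‖ ^ 2) ≤ C2 * 1 * 2 := by gcongr
      _ ≤ 2 * C2 * (Real.exp 8 * Real.exp ((8 - 2 * b) * z.re)) := by nlinarith
      _ ≤ _ := by nlinarith

lemma weight_differentiableAt (b : ℕ) {z : ℂ} (hz : z ∈ Complex.slitPlane) :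
    DifferentiableAt ℂ (weight b) z := by
  have h1 := (isBesselSol_cI z hz).1.differentiableAt
  have h2 := (isBesselSol_cK z hz).1.differentiableAt
  unfold weight
  fun_prop

lemma weight_continuousOn {b : ℕ} (hb : b ≤ 8) : ContinuousOn (weight b) quad := by
  intro z hz
  rcases eq_or_ne z 0 with rfl | h0
  · obtain ⟨C, hC, h⟩ := weight_bound_small
    rw [ContinuousWithinAt, weight_zero]
    apply Tendsto.mono_left _ nhdsWithin_le_nhds
    have ht : Tendsto (fun z : ℂ => C * √‖z‖) (𝓝 0) (𝓝 0) := by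
      have : Continuous fun z : ℂ => C * √‖z‖ := by fun_prop
      simpa using this.tendsto 0
    refine squeeze_zero_norm' ?_ ht
    filter_upwards [Metric.ball_mem_nhds (0 : ℂ) one_pos] with w hw
    exact h b hb w (by simpa using (mem_ball_zero_iff.1 hw).le)
  · exact (weight_differentiableAt b (mem_slitPlane_of_mem_quad hz h0)).continuousAt.continuousWithinAt

lemma isOpen_quadInt : IsOpen quadInt :=
  (isOpen_lt continuous_const Complex.continuous_re).inter
    (isOpen_lt continuous_const Complex.continuous_im)

lemma quadInt_subset_quad : quadInt ⊆ quad := fun _ hz => ⟨hz.1.le, hz.2.le⟩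

lemma quadInt_subset_slitPlane : quadInt ⊆ Complex.slitPlane := fun _ hz =>
  Complex.mem_slitPlane_iff.2 (Or.inl hz.1)

lemma mk_mem_quad {x y : ℝ} (hx : 0 ≤ x) (hy : 0 ≤ y) : (x + y * Complex.I : ℂ) ∈ quad :=
  ⟨by simpa using hx, by simpa using hy⟩

/-- Cauchy's theorem on a rectangle in the quadrant with a corner at the origin. -/
lemma rect_quad {f : ℂ → ℂ} (hc : ContinuousOn f quad) (hd : DifferentiableOn ℂ f quadInt)
    {X T : ℝ} (hX : 0 ≤ X) (hT : 0 ≤ T) :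
    (∫ x in (0 : ℝ)..X, f x) - (∫ x in (0 : ℝ)..X, f (x + T * Complex.I))
      + Complex.I * (∫ y in (0 : ℝ)..T, f (X + y * Complex.I))
      - Complex.I * (∫ y in (0 : ℝ)..T, f (y * Complex.I)) = 0 := by
  have key := Complex.integral_boundary_rect_eq_zero_of_continuousOn_of_differentiableOn f 0
    (X + T * Complex.I) ?_ ?_
  · simpa using key
  · refine hc.mono fun z hz => ?_
    simp only [Complex.mem_reProdIm, Complex.zero_re, Complex.zero_im, Complex.add_re,
      Complex.ofReal_re, Complex.mul_re, Complex.I_re, mul_zero, Complex.ofReal_im, Complex.I_im,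
      mul_one, sub_self, add_zero, Complex.add_im, Complex.mul_im, zero_add, uIcc_of_le hX,
      uIcc_of_le hT] at hz
    exact ⟨hz.1.1, hz.2.1⟩
  · refine hd.mono fun z hz => ?_
    simp only [Complex.mem_reProdIm, Complex.zero_re, Complex.zero_im, Complex.add_re,
      Complex.ofReal_re, Complex.mul_re, Complex.I_re, mul_zero, Complex.ofReal_im, Complex.I_im,
      mul_one, sub_self, add_zero, Complex.add_im, Complex.mul_im, zero_add, min_eq_left hX,
      min_eq_left hT] at hz
    exact ⟨hz.1.1, hz.2.1⟩

/-- Analytic functions on the quadrant, with quadratic decay along vertical lines. -/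
structure VertDecay (f : ℂ → ℂ) (C m : ℝ) : Prop where
  cont : ContinuousOn f quad
  diff : DifferentiableOn ℂ f quadInt
  pos : 0 < C
  bound : ∀ z ∈ quad, ‖f z‖ ≤ C * Real.exp (m * z.re) / (1 + ‖z‖ ^ 2)

/-- The primitive of `f` vanishing at `i∞`, up to sign. -/
noncomputable def vert (f : ℂ → ℂ) (z : ℂ) : ℂ :=
  Complex.I * ∫ u in Ioi (0 : ℝ), f (z + u * Complex.I)

lemma integrableOn_const_div_one_add_sq (K : ℝ) :
    IntegrableOn (fun u : ℝ => K / (1 + u ^ 2)) (Ioi 0) := by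
  simpa [div_eq_mul_inv] using (integrable_inv_one_add_sq.const_mul K).integrableOn

namespace VertDecay

variable {f : ℂ → ℂ} {C m : ℝ}

lemma norm_le_of_im (hf : VertDecay f C m) {z : ℂ} (hz : z ∈ quad) {u : ℝ} (hu : 0 ≤ u)
    (huz : u ≤ z.im) : ‖f z‖ ≤ C * Real.exp (m * z.re) / (1 + u ^ 2) := by
  refine (hf.bound z hz).trans ?_
  have h1 : u ^ 2 ≤ ‖z‖ ^ 2 := by
    have := (Complex.im_le_norm z)
    have : u ≤ ‖z‖ := huz.trans this
    gcongr
  have := hf.pos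
  gcongr

lemma norm_vertical_le (hf : VertDecay f C m) {z : ℂ} (hz : z ∈ quad) {u : ℝ} (hu : 0 ≤ u) :
    ‖f (z + u * Complex.I)‖ ≤ C * Real.exp (m * z.re) / (1 + u ^ 2) := by
  have := hf.norm_le_of_im (add_mul_I_mem_quad hz hu) hu (by simpa using hz.2)
  simpa using this

lemma aestronglyMeasurable (hf : VertDecay f C m) {z : ℂ} (hz : z ∈ quad) :
    AEStronglyMeasurable (fun u : ℝ => f (z + u * Complex.I)) (volume.restrict (Ioi 0)) := by
  refine ContinuousOn.aestronglyMeasurable ?_ measurableSet_Ioi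
  refine hf.cont.comp (Continuous.continuousOn (by fun_prop)) fun u hu => ?_
  exact add_mul_I_mem_quad hz (le_of_lt hu)

lemma integrableOn (hf : VertDecay f C m) {z : ℂ} (hz : z ∈ quad) :
    IntegrableOn (fun u : ℝ => f (z + u * Complex.I)) (Ioi 0) := by
  refine (integrableOn_const_div_one_add_sq (C * Real.exp (m * z.re))).mono'
    (hf.aestronglyMeasurable hz) ?_
  exact (ae_restrict_mem measurableSet_Ioi).mono fun u hu => hf.norm_vertical_le hz (le_of_lt hu)

lemma norm_vert_le (hf : VertDecay f C m) {z : ℂ} (hz : z ∈ quad) :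
    ‖vert f z‖ ≤ 2 * (C * Real.exp (m * z.re)) := by
  rw [vert, norm_mul, Complex.norm_I, one_mul]
  have h : ‖∫ u in Ioi (0 : ℝ), f (z + u * Complex.I)‖
      ≤ ∫ u in Ioi (0 : ℝ), C * Real.exp (m * z.re) / (1 + u ^ 2) :=
    norm_integral_le_of_norm_le (integrableOn_const_div_one_add_sq _)
      ((ae_restrict_mem measurableSet_Ioi).mono fun u hu => hf.norm_vertical_le hz (le_of_lt hu))
  refine h.trans ?_
  simp only [div_eq_mul_inv]
  rw [integral_const_mul, integral_Ioi_inv_one_add_sq, Real.arctan_zero, sub_zero, mul_comm]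
  have := Real.pi_lt_four
  have := hf.pos
  gcongr
  linarith

lemma continuousOn_vert (hf : VertDecay f C m) : ContinuousOn (vert f) quad := by
  intro z hz
  refine ContinuousWithinAt.mul continuousWithinAt_const ?_
  have hC := hf.pos
  have hnear : ∀ᶠ w in 𝓝[quad] z, |w.re| < |z.re| + 1 :=
    nhdsWithin_le_nhds ((by fun_prop : Continuous fun w : ℂ => |w.re|).continuousAt.eventually_lt
      continuousAt_const (by simp))
  refine continuousWithinAt_of_dominated
    (bound := fun u => C * Real.exp (|m| * (|z.re| + 1)) / (1 + u ^ 2)) ?_ ?_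
    (integrableOn_const_div_one_add_sq _) ?_
  · exact eventually_mem_nhdsWithin.mono fun w hw => hf.aestronglyMeasurable hw
  · filter_upwards [eventually_mem_nhdsWithin, hnear] with w hw hw2
    refine (ae_restrict_mem measurableSet_Ioi).mono fun u hu =>
      (hf.norm_vertical_le hw (le_of_lt hu)).trans ?_
    have : m * w.re ≤ |m| * (|z.re| + 1) := by
      refine (le_abs_self _).trans ?_
      rw [abs_mul]
      gcongr
    gcongr
  · refine (ae_restrict_mem measurableSet_Ioi).mono fun u hu => ?_
    have h1 := hf.cont (z + u * Complex.I) (add_mul_I_mem_quad hz (le_of_lt hu))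
    exact ContinuousWithinAt.comp (f := fun w : ℂ => w + u * Complex.I) h1
      (by fun_prop) fun w hw => add_mul_I_mem_quad hw (le_of_lt hu)

lemma differentiableOn_vert (hf : VertDecay f C m) : DifferentiableOn ℂ (vert f) quadInt := by
  intro z hz
  have hC := hf.pos
  obtain ⟨ρ, hρ, hre, him⟩ : ∃ ρ > 0, 2 * ρ < z.re ∧ 2 * ρ < z.im := by
    have h1 := hz.1
    have h2 := hz.2
    refine ⟨min z.re z.im / 4, by positivity, ?_, ?_⟩
    · have := min_le_left z.re z.im; linarith
    · have := min_le_right z.re z.im; linarith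
  have hball : ∀ w ∈ Metric.ball z ρ, ∀ v ∈ Metric.closedBall w ρ, ∀ u : ℝ, 0 ≤ u →
      v + u * Complex.I ∈ quadInt ∧ |v.re| ≤ |z.re| + 2 * ρ ∧ 0 < v.im := by
    intro w hw v hv u hu
    have h1 : ‖v - z‖ ≤ 2 * ρ := by
      have a1 := mem_ball_iff_norm.1 hw
      have a2 := mem_closedBall_iff_norm.1 hv
      calc ‖v - z‖ = ‖(v - w) + (w - z)‖ := by ring_nf
        _ ≤ ‖v - w‖ + ‖w - z‖ := norm_add_le _ _
        _ ≤ 2 * ρ := by linarith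
    have hr := (Complex.abs_re_le_norm (v - z)).trans h1
    have hi := (Complex.abs_im_le_norm (v - z)).trans h1
    rw [Complex.sub_re] at hr
    rw [Complex.sub_im] at hi
    have hi' := abs_le.1 hi
    have hr' := abs_le.1 hr
    refine ⟨⟨?_, ?_⟩, ?_, by linarith⟩
    · simp; linarith
    · simp; linarith
    · have := abs_sub_abs_le_abs_sub v.re z.re
      linarith
  have hderiv : ∀ w ∈ Metric.ball z ρ, ∀ u : ℝ, 0 ≤ u →
      HasDerivAt (fun w => f (w + u * Complex.I)) (deriv f (w + u * Complex.I)) w := by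
    intro w hw u hu
    have hm := (hball w hw w (Metric.mem_closedBall_self hρ.le) u hu).1
    have := (hf.diff.differentiableAt (isOpen_quadInt.mem_nhds hm)).hasDerivAt
    exact this.comp_add_const w (u * Complex.I)
  have key := hasDerivAt_integral_of_dominated_loc_of_deriv_le
    (μ := volume.restrict (Ioi (0 : ℝ))) (x₀ := z) (s := Metric.ball z ρ)
    (F := fun w u => f (w + u * Complex.I)) (F' := fun w u => deriv f (w + u * Complex.I))
    (bound := fun u => C * Real.exp (|m| * (|z.re| + 2 * ρ)) / ρ / (1 + u ^ 2))
    (Metric.ball_mem_nhds _ hρ) ?_ (hf.integrableOn (quadInt_subset_quad hz)) ?_ ?_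
    (integrableOn_const_div_one_add_sq _) ?_
  · exact (key.2.const_mul Complex.I).differentiableAt.differentiableWithinAt
  · filter_upwards [isOpen_quadInt.mem_nhds hz] with w hw
    exact hf.aestronglyMeasurable (quadInt_subset_quad hw)
  · refine ContinuousOn.aestronglyMeasurable ?_ measurableSet_Ioi
    refine (hf.diff.deriv isOpen_quadInt).continuousOn.comp
      (Continuous.continuousOn (by fun_prop)) fun u hu => ?_
    exact (hball z (Metric.mem_ball_self hρ) z (Metric.mem_closedBall_self hρ.le) u (le_of_lt hu)).1
  · refine (ae_restrict_mem measurableSet_Ioi).mono fun u hu w hw => ?_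
    have hu : 0 ≤ u := le_of_lt hu
    rw [div_right_comm]
    refine Complex.norm_deriv_le_of_forall_mem_sphere_norm_le hρ
      (hf.diff.diffContOnCl_ball fun v hv => ?_) fun v hv => ?_
    · have hv' : v - u * Complex.I ∈ Metric.closedBall w ρ := by
        rw [mem_closedBall_iff_norm] at hv ⊢
        rwa [sub_sub, add_comm (_ * _) w]
      have := (hball w hw _ hv' u hu).1
      rwa [sub_add_cancel] at this
    · have hv' : v - u * Complex.I ∈ Metric.closedBall w ρ := by
        have := Metric.sphere_subset_closedBall hv
        rw [mem_closedBall_iff_norm] at this ⊢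
        rwa [sub_sub, add_comm (_ * _) w]
      obtain ⟨b1, b2, b3⟩ := hball w hw _ hv' u hu
      rw [sub_add_cancel] at b1
      have e1 : (v - u * Complex.I).re = v.re := by simp
      have e2 : (v - u * Complex.I).im = v.im - u := by simp
      rw [e1] at b2
      rw [e2] at b3
      refine (hf.norm_le_of_im (quadInt_subset_quad b1) hu (by linarith)).trans ?_
      have : m * v.re ≤ |m| * (|z.re| + 2 * ρ) := by
        refine (le_abs_self _).trans ?_
        rw [abs_mul]
        gcongr
      gcongr
  · exact (ae_restrict_mem measurableSet_Ioi).mono fun u hu w hw => hderiv w hw u (le_of_lt hu)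

lemma integral_eq_vert_sub (hf : VertDecay f C m) {x : ℝ} (hx : 0 ≤ x) :
    ∫ t in (0 : ℝ)..x, f t = vert f 0 - vert f x := by
  have hC := hf.pos
  have hrect : ∀ T ≥ (0 : ℝ), (∫ t in (0 : ℝ)..x, f t)
      = (∫ t in (0 : ℝ)..x, f (t + T * Complex.I))
        + (Complex.I * (∫ y in (0 : ℝ)..T, f (0 + y * Complex.I))
          - Complex.I * (∫ y in (0 : ℝ)..T, f (x + y * Complex.I))) := by
    intro T hT
    have := rect_quad hf.cont hf.diff hx hT
    simp only [zero_add]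
    linear_combination this
  have h0 : (0 : ℂ) ∈ quad := ⟨le_rfl, le_rfl⟩
  have hxq : (x : ℂ) ∈ quad := by simpa using mk_mem_quad hx le_rfl
  have t1 : Tendsto (fun T : ℝ => ∫ t in (0 : ℝ)..x, f (t + T * Complex.I)) atTop (𝓝 0) := by
    have hb : Tendsto (fun T : ℝ => C * Real.exp (|m| * x) / (1 + T ^ 2) * |x - 0|) atTop (𝓝 0) := by
      have h2 : Tendsto (fun T : ℝ => 1 + T ^ 2) atTop atTop :=
        tendsto_atTop_add_const_left _ _ (tendsto_pow_atTop two_ne_zero)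
      simpa using (h2.const_div_atTop (C * Real.exp (|m| * x))).mul_const |x - 0|
    refine squeeze_zero_norm' ?_ hb
    filter_upwards [eventually_ge_atTop 0] with T hT
    refine intervalIntegral.norm_integral_le_of_norm_le_const fun t ht => ?_
    rw [uIoc_of_le hx] at ht
    have hb := hf.norm_le_of_im (mk_mem_quad ht.1.le hT) hT (by simp)
    refine hb.trans ?_
    have : m * (t + T * Complex.I : ℂ).re ≤ |m| * x := by
      refine (le_abs_self _).trans ?_
      rw [abs_mul]
      have : |(t + T * Complex.I : ℂ).re| ≤ x := by
        simp only [Complex.add_re, Complex.ofReal_re, Complex.mul_re, Complex.I_re, mul_zero,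
          Complex.ofReal_im, Complex.I_im, mul_one, sub_self, add_zero]
        rw [abs_of_pos ht.1]
        exact ht.2
      gcongr
    gcongr
  have t2 := (intervalIntegral_tendsto_integral_Ioi 0 (hf.integrableOn h0) tendsto_id).const_mul
    Complex.I
  have t3 := (intervalIntegral_tendsto_integral_Ioi 0 (hf.integrableOn hxq) tendsto_id).const_mul
    Complex.I
  have t4 := t1.add (t2.sub t3)
  rw [zero_add] at t4
  refine tendsto_nhds_unique (tendsto_const_nhds.congr' ?_) t4
  filter_upwards [eventually_ge_atTop 0] with T hT
  exact hrect T hT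

lemma tendsto_vert (hf : VertDecay f C m) (hm : m ≤ 0) :
    Tendsto (fun x : ℝ => vert f x) atTop (𝓝 0) := by
  have hC := hf.pos
  have hq : ∀ x : ℝ, 0 ≤ x → (x : ℂ) ∈ quad := fun x hx => by simpa using mk_mem_quad hx le_rfl
  have hle : ∀ x : ℝ, 0 ≤ x → ∀ u : ℝ, 0 < u →
      ‖f (x + u * Complex.I)‖ ≤ C / (1 + (x ^ 2 + u ^ 2)) := by
    intro x hx u hu
    refine (hf.bound _ (mk_mem_quad hx hu.le)).trans ?_
    have e1 : ‖(x + u * Complex.I : ℂ)‖ ^ 2 = x ^ 2 + u ^ 2 := by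
      rw [Complex.norm_add_mul_I, Real.sq_sqrt (by positivity)]
    have e2 : Real.exp (m * (x + u * Complex.I : ℂ).re) ≤ 1 := by
      apply Real.exp_le_one_iff.2
      simpa using mul_nonpos_of_nonpos_of_nonneg hm hx
    rw [e1]
    gcongr
    exact mul_le_of_le_one_right hC.le e2
  have key := tendsto_integral_filter_of_dominated_convergence
    (μ := volume.restrict (Ioi (0 : ℝ))) (l := atTop) (F := fun (x : ℝ) u => f (x + u * Complex.I))
    (f := fun _ => 0) (fun u => C / (1 + u ^ 2)) ?_ ?_ (integrableOn_const_div_one_add_sq C) ?_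
  · simpa [vert] using key.const_mul Complex.I
  · filter_upwards [eventually_ge_atTop 0] with x hx
    exact hf.aestronglyMeasurable (hq x hx)
  · filter_upwards [eventually_ge_atTop 0] with x hx
    refine (ae_restrict_mem measurableSet_Ioi).mono fun u hu => (hle x hx u hu).trans ?_
    gcongr
    nlinarith
  · refine (ae_restrict_mem measurableSet_Ioi).mono fun u hu => ?_
    have h2 : Tendsto (fun x : ℝ => 1 + (x ^ 2 + u ^ 2)) atTop atTop :=
      tendsto_atTop_add_const_left _ _
        (tendsto_atTop_add_const_right _ _ (tendsto_pow_atTop two_ne_zero))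
    refine squeeze_zero_norm' ?_ (h2.const_div_atTop C)
    filter_upwards [eventually_ge_atTop 0] with x hx
    exact hle x hx u hu

end VertDecay

lemma exists_weight_vertDecay :
    ∃ C, ∀ b ≤ 8, VertDecay (weight b) C (8 - 2 * b) := by
  obtain ⟨C, hC, h⟩ := weight_bound
  exact ⟨C, fun b hb => ⟨weight_continuousOn hb,
    fun z hz => (weight_differentiableAt b (quadInt_subset_slitPlane hz)).differentiableWithinAt,
    hC, h b hb⟩⟩

/-- A constant for which all weights decay vertically. -/
noncomputable def weightC : ℝ := exists_weight_vertDecay.choose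

lemma weight_vertDecay {b : ℕ} (hb : b ≤ 8) : VertDecay (weight b) weightC (8 - 2 * b) :=
  exists_weight_vertDecay.choose_spec b hb

/-- The primitive of `weight b` vanishing at `i∞`, up to sign. -/
noncomputable def prim (b : ℕ) : ℂ → ℂ := vert (weight b)

/-- The moments on the imaginary axis. -/
noncomputable def axisMoment (m : ℕ) : ℝ :=
  ∫ y in Ioi (0 : ℝ), realJ y ^ (8 - m) * realX y ^ m * y

lemma continuousOn_realJ : ContinuousOn realJ (Ioi 0) := by
  unfold realJ
  exact (Complex.continuous_re.comp (continuous_cI.comp (by fun_prop))).continuousOn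

lemma mul_I_mem_slitPlane {y : ℝ} (hy : 0 < y) : (y * Complex.I : ℂ) ∈ Complex.slitPlane := by
  rw [Complex.mem_slitPlane_iff]; right; simpa using hy.ne'

lemma continuousOn_realX : ContinuousOn realX (Ioi 0) := by
  unfold realX
  refine Complex.continuous_re.comp_continuousOn ?_
  intro y hy
  have h : ContinuousAt cK ((y : ℂ) * Complex.I) :=
    (isBesselSol_cK _ (mul_I_mem_slitPlane hy)).1.continuousAt
  have h2 : ContinuousAt (fun y : ℝ => (y : ℂ) * Complex.I) y := by fun_prop
  exact (ContinuousAt.comp (f := fun y : ℝ => (y : ℂ) * Complex.I) h h2).continuousWithinAt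

lemma integrableOn_axisMoment {m : ℕ} (hm : m ≤ 8) :
    IntegrableOn (fun y => realJ y ^ (8 - m) * realX y ^ m * y) (Ioi 0) := by
  refine (integrableOn_const_div_one_add_sq weightC).mono' ?_ ?_
  · refine ContinuousOn.aestronglyMeasurable ?_ measurableSet_Ioi
    have := continuousOn_realJ
    have := continuousOn_realX
    fun_prop
  · refine (ae_restrict_mem measurableSet_Ioi).mono fun y hy => ?_
    have hy' : 0 < y := hy
    have hb := (weight_vertDecay hm).bound (y * Complex.I) (by
      have := mk_mem_quad (le_refl 0) hy'.le
      simpa using this)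
    have e1 : ‖(y * Complex.I : ℂ)‖ ^ 2 = y ^ 2 := by simp
    have e2 : (y * Complex.I : ℂ).re = 0 := by simp
    rw [e1, e2, mul_zero, Real.exp_zero, mul_one] at hb
    refine le_trans ?_ hb
    rw [weight, norm_mul, norm_mul, norm_mul, norm_mul, norm_pow, norm_pow, norm_pow, norm_pow]
    have h1 : ‖realJ y‖ ≤ ‖cI (y * Complex.I)‖ := Complex.abs_re_le_norm _
    have h2 : ‖realX y‖ ≤ ‖cK (y * Complex.I)‖ := Complex.abs_re_le_norm _
    have h3 : ‖y‖ = ‖(y * Complex.I : ℂ)‖ := by simp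
    rw [h3]
    gcongr

lemma weight_mul_I {b : ℕ} (hb : b ≤ 8) {y : ℝ} (hy : 0 < y) :
    weight b (y * Complex.I) = Complex.I * ∑ m ∈ Finset.range (b + 1),
      ((b.choose m : ℂ) * (-((π / 2) * Complex.I)) ^ (b - m)) *
        ((realJ y ^ (8 - m) * realX y ^ m * y : ℝ) : ℂ) := by
  rw [weight, cI_mul_I, cK_mul_I hy, sub_eq_add_neg, add_pow, Finset.mul_sum, Finset.sum_mul,
    Finset.mul_sum]
  refine Finset.sum_congr rfl fun m hm => ?_
  have hm' : m ≤ b := Nat.lt_succ_iff.1 (Finset.mem_range.1 hm)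
  rw [show 8 - m = (8 - b) + (b - m) by omega, pow_add,
    show (-(π / 2 * Complex.I * realJ y) : ℂ) = (-((π / 2) * Complex.I)) * realJ y by ring, mul_pow]
  push_cast
  ring

lemma prim_zero {b : ℕ} (hb : b ≤ 8) :
    prim b 0 = -∑ m ∈ Finset.range (b + 1),
      ((b.choose m : ℂ) * (-((π / 2) * Complex.I)) ^ (b - m)) * (axisMoment m : ℂ) := by
  have h : ∫ u in Ioi (0 : ℝ), weight b (0 + u * Complex.I) =
      Complex.I * ∑ m ∈ Finset.range (b + 1),
      ((b.choose m : ℂ) * (-((π / 2) * Complex.I)) ^ (b - m)) * (axisMoment m : ℂ) := by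
    rw [setIntegral_congr_fun measurableSet_Ioi (g := fun y : ℝ => Complex.I *
      ∑ m ∈ Finset.range (b + 1), ((b.choose m : ℂ) * (-((π / 2) * Complex.I)) ^ (b - m)) *
        ((realJ y ^ (8 - m) * realX y ^ m * y : ℝ) : ℂ))
      (fun y hy => by simpa using weight_mul_I hb (y := y) hy)]
    rw [integral_const_mul, integral_finsetSum]
    · congr 1
      refine Finset.sum_congr rfl fun m hm => ?_
      rw [integral_const_mul, integral_complex_ofReal, axisMoment]
    · intro m hm
      have hm' : m ≤ b := Nat.lt_succ_iff.1 (Finset.mem_range.1 hm)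
      exact ((integrableOn_axisMoment (hm'.trans hb)).ofReal).const_mul _
  rw [prim, vert, h, ← mul_assoc, Complex.I_mul_I]
  ring

lemma weight_ofReal (b : ℕ) {x : ℝ} (hx : 0 < x) :
    weight b x = ((besselI0 x ^ (8 - b) * besselK0 x ^ b * x : ℝ) : ℂ) := by
  rw [weight, cI_ofReal, cK_ofReal hx]
  push_cast
  ring

lemma integral_weight_ofReal (b : ℕ) {x : ℝ} (hx : 0 ≤ x) :
    ∫ t in (0 : ℝ)..x, weight b t =
      ((∫ t in (0 : ℝ)..x, besselI0 t ^ (8 - b) * besselK0 t ^ b * t : ℝ) : ℂ) := by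
  rw [← intervalIntegral.integral_ofReal]
  refine intervalIntegral.integral_congr_ae (Eventually.of_forall fun t ht => ?_)
  rw [uIoc_of_le hx] at ht
  exact weight_ofReal b ht.1

lemma prim_ofReal_im {b : ℕ} (hb : b ≤ 8) {x : ℝ} (hx : 0 ≤ x) :
    (prim b x).im = (prim b 0).im := by
  have h := (weight_vertDecay hb).integral_eq_vert_sub hx
  rw [integral_weight_ofReal b hx] at h
  have := congrArg Complex.im h
  simp only [Complex.ofReal_im, Complex.sub_im] at this
  unfold prim
  linarith

lemma prim_zero_im {b : ℕ} (h4 : 4 ≤ b) (hb : b ≤ 8) : (prim b 0).im = 0 := by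
  have h4' : (4 : ℝ) ≤ b := by exact_mod_cast h4
  have ht := (weight_vertDecay hb).tendsto_vert (by linarith)
  have ht2 := (Complex.continuous_im.tendsto 0).comp ht
  refine tendsto_nhds_unique (tendsto_const_nhds.congr' ?_) ht2
  filter_upwards [eventually_ge_atTop (0 : ℝ)] with x hx
  exact (prim_ofReal_im hb hx).symm

lemma integrableOn_besselMoment {b : ℕ} (h4 : 5 ≤ b) (hb : b ≤ 8) (n : ℕ) :
    IntegrableOn (fun x => besselI0 x ^ (8 - b) * besselK0 x ^ b * x ^ (n + 1)) (Ioi 0) := by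
  have h4' : (5 : ℝ) ≤ b := by exact_mod_cast h4
  have hg : IntegrableOn (fun x : ℝ => weightC * (x ^ n * Real.exp (-x))) (Ioi 0) := by
    have := (Real.GammaIntegral_convergent (s := n + 1) (by positivity)).const_mul weightC
    refine this.congr ?_
    refine (ae_restrict_mem measurableSet_Ioi).mono fun x hx => ?_
    simp [mul_comm]
  refine hg.mono' ?_ ?_
  · refine ContinuousOn.aestronglyMeasurable ?_ measurableSet_Ioi
    have h1 : ContinuousOn (fun x : ℝ => (weight b x).re) (Ioi 0) := by
      refine Complex.continuous_re.comp_continuousOn ?_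
      refine (weight_continuousOn hb).comp Complex.continuous_ofReal.continuousOn fun x hx => ?_
      simpa using mk_mem_quad (le_of_lt hx) (le_refl 0)
    have h2 : ContinuousOn (fun x : ℝ => (weight b x).re * x ^ n) (Ioi 0) := by fun_prop
    refine h2.congr fun x hx => ?_
    simp only
    rw [weight_ofReal b hx, Complex.ofReal_re]
    ring
  · refine (ae_restrict_mem measurableSet_Ioi).mono fun x hx => ?_
    have hx' : 0 < x := hx
    have hb1 := (weight_vertDecay hb).bound x (by
      simpa using mk_mem_quad hx'.le (le_refl 0))
    rw [weight_ofReal b hx', Complex.norm_real, Complex.ofReal_re] at hb1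
    have hw : 0 < weightC := (weight_vertDecay hb).pos
    have hb2 : ‖besselI0 x ^ (8 - b) * besselK0 x ^ b * x‖ ≤ weightC * Real.exp (-x) := by
      refine hb1.trans ((div_le_self (by positivity) (by nlinarith [sq_nonneg ‖(x : ℂ)‖])).trans ?_)
      gcongr
      nlinarith
    calc _ = ‖besselI0 x ^ (8 - b) * besselK0 x ^ b * x‖ * x ^ n := by
          rw [pow_succ, ← mul_assoc, mul_right_comm, norm_mul _ (x ^ n),
            Real.norm_of_nonneg (pow_nonneg hx'.le n)]
      _ ≤ weightC * Real.exp (-x) * x ^ n := by gcongr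
      _ = _ := by ring

lemma prim_zero_eq {b : ℕ} (h4 : 5 ≤ b) (hb : b ≤ 8) :
    prim b 0 = besselMoment (8 - b) b 1 := by
  have h4' : (5 : ℝ) ≤ b := by exact_mod_cast h4
  have ht := (weight_vertDecay hb).tendsto_vert (by linarith)
  have hi := integrableOn_besselMoment h4 hb 0
  have h1 := intervalIntegral_tendsto_integral_Ioi 0 hi tendsto_id
  have h2 := (Complex.continuous_ofReal.tendsto _).comp h1
  have h3 : Tendsto (fun x : ℝ => prim b 0 - vert (weight b) x) atTop (𝓝 (prim b 0 - 0)) :=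
    tendsto_const_nhds.sub ht
  rw [sub_zero] at h3
  refine tendsto_nhds_unique (h3.congr' ?_) h2
  filter_upwards [eventually_ge_atTop (0 : ℝ)] with x hx
  have := (weight_vertDecay hb).integral_eq_vert_sub hx
  rw [integral_weight_ofReal b hx] at this
  rw [prim, ← this]
  simp

lemma prim_zero_re_im {b : ℕ} (hb : b ≤ 8) :
    (prim b 0).re = -∑ m ∈ Finset.range (b + 1), (b.choose m) * (-(π / 2)) ^ (b - m)
        * (Complex.I ^ (b - m)).re * axisMoment m ∧
    (prim b 0).im = -∑ m ∈ Finset.range (b + 1), (b.choose m) * (-(π / 2)) ^ (b - m)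
        * (Complex.I ^ (b - m)).im * axisMoment m := by
  have h : ∀ m, ((b.choose m : ℂ) * (-((π / 2) * Complex.I)) ^ (b - m)) * (axisMoment m : ℂ) =
      ((b.choose m * (-(π / 2)) ^ (b - m) * axisMoment m : ℝ) : ℂ) * Complex.I ^ (b - m) := by
    intro m
    rw [← neg_mul, mul_pow]
    push_cast
    ring
  rw [prim_zero hb]
  simp_rw [h]
  rw [Complex.neg_re, Complex.neg_im, Complex.re_sum, Complex.im_sum]
  simp only [Complex.re_ofReal_mul, Complex.im_ofReal_mul]
  constructor <;>
  · congr 1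
    refine Finset.sum_congr rfl fun m _ => ?_
    ring

/-- All moments that enter the determinant, in terms of three moments on the imaginary axis. -/
lemma moment_relations :
    (prim 0 0).im = 0 ∧ (prim 1 0).im = π / 2 * axisMoment 0 ∧
    (prim 2 0).im = π * axisMoment 1 ∧
    (prim 3 0).im = 3 * π / 2 * axisMoment 2 - π ^ 3 / 8 * axisMoment 0 ∧
    besselMoment 1 7 1 = 32 / 3 * (π / 2) ^ 6 * axisMoment 1 ∧
    besselMoment 2 6 1 = 8 * (π / 2) ^ 4 * (axisMoment 2 - (π / 2) ^ 2 * axisMoment 0 / 7) := by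
  have I2 : Complex.I ^ 2 = -1 := Complex.I_sq
  have I3 : Complex.I ^ 3 = -Complex.I := by rw [pow_succ, I2]; ring
  have I4 : Complex.I ^ 4 = 1 := Complex.I_pow_four
  have I5 : Complex.I ^ 5 = Complex.I := by rw [pow_succ, I4]; ring
  have I6 : Complex.I ^ 6 = -1 := by rw [pow_succ, I5, Complex.I_mul_I]
  have I7 : Complex.I ^ 7 = -Complex.I := by rw [pow_succ, I6]; ring
  have I8 : Complex.I ^ 8 = 1 := by rw [pow_succ, I7]; simp
  have c : ∀ b, b ≤ 8 → _ := fun b hb => prim_zero_re_im (b := b) hb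
  have h0 := (c 0 (by norm_num)).2
  have h1 := (c 1 (by norm_num)).2
  have h2 := (c 2 (by norm_num)).2
  have h3 := (c 3 (by norm_num)).2
  have h4 := (c 4 (by norm_num)).2
  have h5 := (c 5 (by norm_num)).2
  have h6 := (c 6 (by norm_num)).2
  have h7 := (c 7 (by norm_num)).2
  have h8 := (c 8 (by norm_num)).2
  have r6 := (c 6 (by norm_num)).1
  have r7 := (c 7 (by norm_num)).1
  rw [prim_zero_im (by norm_num) (by norm_num)] at h4 h5 h6 h7 h8
  rw [prim_zero_eq (by norm_num) (by norm_num), Complex.ofReal_re] at r6 r7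
  have hpi : π ≠ 0 := Real.pi_ne_zero
  simp [Finset.sum_range_succ, Nat.choose, I2, I3, I4, I5, I6, I7, I8] at h0 h1 h2 h3 h4 h5 h6 h7 h8 r6 r7
  set q := π / 2 with hq
  have hq0 : q ≠ 0 := by positivity
  have hp : π = 2 * q := by rw [hq]; ring
  have m3 : axisMoment 3 = q ^ 2 * axisMoment 1 := by
    apply mul_left_cancel₀ hq0; linear_combination -h4 / 4
  have m5 : axisMoment 5 = 7 / 3 * q ^ 4 * axisMoment 1 := by
    apply mul_left_cancel₀ hq0; rw [m3] at h6; linear_combination -h6 / 6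
  have m7 : axisMoment 7 = 31 / 3 * q ^ 6 * axisMoment 1 := by
    apply mul_left_cancel₀ hq0; rw [m3, m5] at h8; linear_combination -h8 / 8
  have m4 : axisMoment 4 = 2 * q ^ 2 * axisMoment 2 - q ^ 4 * axisMoment 0 / 5 := by
    apply mul_left_cancel₀ hq0; linear_combination -h5 / 5
  have m6 : axisMoment 6 = 7 * q ^ 4 * axisMoment 2 - 6 / 7 * q ^ 6 * axisMoment 0 := by
    apply mul_left_cancel₀ hq0; rw [m4] at h7; linear_combination -h7 / 7
  refine ⟨h0, h1, ?_, ?_, ?_, ?_⟩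
  · rw [h2, hp]
  · rw [h3, hp]; ring
  · rw [r7, m7, m5, m3]; ring
  · rw [r6, m6, m4]; ring

/-- The solution in `z` of Bessel's equation vanishing at `s`. -/
noncomputable def kernel (s z : ℂ) : ℂ := cI z * cK s - cK z * cI s

/-- Eighth-power transform `i ∫₀^∞ kernel(s, s + iu)⁸ (s + iu) du`. -/
noncomputable def hfun (s : ℂ) : ℂ :=
  ∑ b ∈ Finset.range 9, (Nat.choose 8 b * (-1) ^ b * cK s ^ (8 - b) * cI s ^ b) * prim b s

lemma kernel_pow (s z : ℂ) : kernel s z ^ 8 * z =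
    ∑ b ∈ Finset.range 9, (Nat.choose 8 b * (-1) ^ b * cK s ^ (8 - b) * cI s ^ b) * weight b z := by
  rw [kernel, sub_eq_neg_add, add_pow, Finset.sum_mul]
  refine Finset.sum_congr rfl fun b _ => ?_
  rw [weight, neg_pow, mul_pow, mul_pow]
  ring

lemma integrableOn_weight {b : ℕ} (hb : b ≤ 8) {s : ℂ} (hs : s ∈ quad) :
    IntegrableOn (fun u : ℝ => weight b (s + u * Complex.I)) (Ioi 0) :=
  (weight_vertDecay hb).integrableOn hs

lemma integrableOn_kernel {s : ℂ} (hs : s ∈ quad) :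
    IntegrableOn (fun u : ℝ => kernel s (s + u * Complex.I) ^ 8 * (s + u * Complex.I)) (Ioi 0) := by
  simp_rw [kernel_pow]
  refine integrable_finsetSum _ fun b hb => ?_
  exact (integrableOn_weight (Nat.lt_succ_iff.1 (Finset.mem_range.1 hb)) hs).const_mul _

lemma hfun_eq {s : ℂ} (hs : s ∈ quad) :
    hfun s = Complex.I *
      ∫ u in Ioi (0 : ℝ), kernel s (s + u * Complex.I) ^ 8 * (s + u * Complex.I) := by
  simp_rw [kernel_pow]
  rw [integral_finsetSum, Finset.mul_sum]
  · refine Finset.sum_congr rfl fun b _ => ?_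
    rw [integral_const_mul, prim, vert]
    ring
  · intro b hb
    exact (integrableOn_weight (Nat.lt_succ_iff.1 (Finset.mem_range.1 hb)) hs).const_mul _

lemma kernel_oscillation {s : ℂ} (hs : s ∈ quad) (h1 : 1 ≤ ‖s‖) {u : ℝ} (hu : 0 ≤ u) :
    ‖csqrt (s + u * Complex.I) * (csqrt s * kernel s (s + u * Complex.I))
      - Complex.I * Real.sin u‖ ≤ 16 / ‖s‖ := by
  have hs0 : s ≠ 0 := norm_pos_iff.1 (by linarith)
  have hw := cI_cK_wronskian hs0
  have hsol := isBesselSol_cI.linComb isBesselSol_cK (csqrt s * cK s) (-(csqrt s * cI s))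
  have e0 : csqrt s * cK s * cI s + -(csqrt s * cI s) * cK s = 0 := by ring
  have e1 : liouville' (fun z => csqrt s * cK s * cI z + -(csqrt s * cI s) * cK z)
      (fun z => csqrt s * cK s * cI' z + -(csqrt s * cI s) * cK' z) s = 1 := by
    simp only [liouville', e0]
    rw [← hw]
    have := csqrt_sq hs0
    linear_combination (cI' s * cK s - cI s * cK' s) * this
  have key := hsol.oscillation hs h1 one_pos (by simp only [e0]; simp) (by rw [e1]; simp) hu
  simp only [e0, e1, mul_zero, zero_mul, zero_add, mul_one] at key
  convert key using 4
  rw [kernel]; ring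

lemma norm_pow_sub_pow_le_of_norm_le {w v : ℂ} {R : ℝ} (hw : ‖w‖ ≤ R) (hv : ‖v‖ ≤ R) (n : ℕ) :
    ‖w ^ n - v ^ n‖ ≤ n * R ^ (n - 1) * ‖w - v‖ := by
  have hR : 0 ≤ R := (norm_nonneg _).trans hw
  rw [← geom_sum₂_mul, norm_mul]
  gcongr
  have : ∀ i ∈ Finset.range n, ‖w ^ i * v ^ (n - 1 - i)‖ ≤ R ^ (n - 1) := by
    intro i hi
    rw [norm_mul, norm_pow, norm_pow]
    have hi' : i ≤ n - 1 := by have := Finset.mem_range.1 hi; omega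
    calc ‖w‖ ^ i * ‖v‖ ^ (n - 1 - i) ≤ R ^ i * R ^ (n - 1 - i) := by gcongr
      _ = R ^ (n - 1) := by rw [← pow_add, Nat.add_sub_cancel' hi']
  simpa using norm_sum_le_of_le _ this

/-- A periodic primitive of `sin⁸ - 35/128`. -/
noncomputable def sinPrim (u : ℝ) : ℝ :=
  -(Real.cos u * (Real.sin u ^ 7 / 8 + 7 / 48 * Real.sin u ^ 5 + 35 / 192 * Real.sin u ^ 3
    + 35 / 128 * Real.sin u))

lemma hasDerivAt_sinPrim (u : ℝ) : HasDerivAt sinPrim (Real.sin u ^ 8 - 35 / 128) u := by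
  have hs := Real.hasDerivAt_sin u
  have hc := Real.hasDerivAt_cos u
  have h := (hc.mul (((((hs.pow 7).div_const 8).add ((hs.pow 5).const_mul (7 / 48))).add
    ((hs.pow 3).const_mul (35 / 192))).add (hs.const_mul (35 / 128)))).neg
  refine h.congr_deriv ?_
  have e : Real.cos u ^ 2 = 1 - Real.sin u ^ 2 := by rw [← Real.sin_sq_add_cos_sq u]; ring
  simp only [Pi.add_apply, Pi.pow_apply]
  push_cast
  ring_nf
  rw [e]
  ring

lemma abs_sinPrim_le (u : ℝ) : |sinPrim u| ≤ 1 := by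
  have hs : |Real.sin u| ≤ 1 := Real.abs_sin_le_one u
  have hc : |Real.cos u| ≤ 1 := Real.abs_cos_le_one u
  have hp : ∀ n, |Real.sin u ^ n| ≤ 1 := fun n => by
    rw [abs_pow]; exact pow_le_one₀ (abs_nonneg _) hs
  rw [sinPrim, abs_neg, abs_mul]
  refine mul_le_one₀ hc (abs_nonneg _) ?_
  have h7 := abs_le.1 (hp 7)
  have h5 := abs_le.1 (hp 5)
  have h3 := abs_le.1 (hp 3)
  have h1 := abs_le.1 hs
  rw [abs_le]
  constructor <;> linarith [h7.1, h7.2, h5.1, h5.2, h3.1, h3.2, h1.1, h1.2]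

lemma tendsto_arctan_div {r : ℝ} (hr : 0 < r) :
    Tendsto (fun u => Real.arctan (u / r) / r) atTop (𝓝 (π / 2 / r)) := by
  have := (Real.tendsto_arctan_atTop.mono_right nhdsWithin_le_nhds).comp
    (tendsto_id.atTop_div_const hr)
  exact this.div_const r

lemma integrableOn_inv_sq_add_sq {r : ℝ} (hr : 0 < r) :
    IntegrableOn (fun u : ℝ => 1 / (r ^ 2 + u ^ 2)) (Ioi 0) :=
  integrableOn_Ioi_deriv_of_nonneg' (fun x _ => hasDerivAt_arctan_div_div hr x)
    (fun x _ => by positivity) (tendsto_arctan_div hr)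

lemma integral_inv_sq_add_sq {r : ℝ} (hr : 0 < r) :
    ∫ u in Ioi (0 : ℝ), 1 / (r ^ 2 + u ^ 2) = π / 2 / r := by
  rw [integral_Ioi_of_hasDerivAt_of_nonneg' (fun x _ => hasDerivAt_arctan_div_div hr x)
    (fun x _ => by positivity) (tendsto_arctan_div hr)]
  simp

lemma norm_inv_pow_le {s : ℂ} (hs : s ∈ quad) (h1 : 1 ≤ ‖s‖) {u : ℝ} (hu : 0 ≤ u) (n : ℕ) :
    ‖((s + u * Complex.I) ^ (n + 2))⁻¹‖ ≤ 1 / ‖s‖ ^ n * (1 / (‖s‖ ^ 2 + u ^ 2)) := by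
  have hs0 : 0 < ‖s‖ := by linarith
  have hz := norm_le_norm_add hs hu
  have hz2 := sq_add_sq_le_norm_sq hs hu
  rw [norm_inv, norm_pow, pow_add, mul_inv, inv_eq_one_div, inv_eq_one_div]
  gcongr

lemma integral_sin_pow_eight {s : ℂ} (hs : s ∈ quad) (h1 : 1 ≤ ‖s‖) :
    IntegrableOn (fun u : ℝ => (Real.sin u : ℂ) ^ 8 * ((s + u * Complex.I) ^ 3)⁻¹
      - 3 * Complex.I * sinPrim u * ((s + u * Complex.I) ^ 4)⁻¹) (Ioi 0) ∧
    ∫ u in Ioi (0 : ℝ), ((Real.sin u : ℂ) ^ 8 * ((s + u * Complex.I) ^ 3)⁻¹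
      - 3 * Complex.I * sinPrim u * ((s + u * Complex.I) ^ 4)⁻¹) =
      -(35 / 256 * Complex.I * (s ^ 2)⁻¹) := by
  have hs0 : 0 < ‖s‖ := by linarith
  have hne : ∀ u : ℝ, 0 ≤ u → s + u * Complex.I ≠ 0 := fun u hu =>
    norm_pos_iff.1 (by linarith [norm_le_norm_add hs hu])
  have hline : ∀ u : ℝ, HasDerivAt (fun u : ℝ => s + u * Complex.I) Complex.I u := fun u => by
    simpa using ((hasDerivAt_id u).ofReal_comp.mul_const Complex.I).const_add s
  have hder : ∀ u ∈ Ici (0 : ℝ), HasDerivAt (fun u : ℝ =>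
      35 / 256 * Complex.I * ((s + u * Complex.I) ^ 2)⁻¹
        + sinPrim u * ((s + u * Complex.I) ^ 3)⁻¹)
      ((Real.sin u : ℂ) ^ 8 * ((s + u * Complex.I) ^ 3)⁻¹
      - 3 * Complex.I * sinPrim u * ((s + u * Complex.I) ^ 4)⁻¹) u := by
    intro u hu
    have hz := hne u hu
    have hP := (hasDerivAt_sinPrim u).ofReal_comp
    have h2 := (((hline u).pow 2).inv (pow_ne_zero 2 hz)).const_mul (35 / 256 * Complex.I)
    have h3 := hP.mul (((hline u).pow 3).inv (pow_ne_zero 3 hz))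
    refine (h2.add h3).congr_deriv ?_
    push_cast
    simp only [Pi.pow_apply, Pi.inv_apply]
    have hI : Complex.I ^ 2 = -1 := Complex.I_sq
    set z := s + u * Complex.I
    field_simp
    ring_nf
    rw [hI]
    ring
  have hinteg : IntegrableOn (fun u : ℝ => (Real.sin u : ℂ) ^ 8 * ((s + u * Complex.I) ^ 3)⁻¹
      - 3 * Complex.I * sinPrim u * ((s + u * Complex.I) ^ 4)⁻¹) (Ioi 0) := by
    refine ((integrableOn_inv_sq_add_sq hs0).const_mul 4).mono' ?_ ?_
    · refine ContinuousOn.aestronglyMeasurable ?_ measurableSet_Ioi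
      have hc : Continuous sinPrim := by unfold sinPrim; fun_prop
      have h3 : ∀ n, ContinuousOn (fun u : ℝ => ((s + u * Complex.I) ^ n)⁻¹) (Ioi 0) := fun n =>
        ContinuousOn.inv₀ (by fun_prop) fun u hu => pow_ne_zero n (hne u (le_of_lt hu))
      have h33 := h3 3
      have h34 := h3 4
      fun_prop
    · refine (ae_restrict_mem measurableSet_Ioi).mono fun u hu => ?_
      have hu' : 0 ≤ u := le_of_lt hu
      have a3 := norm_inv_pow_le hs h1 hu' 1
      have a4 := norm_inv_pow_le hs h1 hu' 2
      have i1 : 1 / ‖s‖ ^ 1 ≤ 1 := by rw [div_le_one (by positivity)]; simpa using h1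
      have i2 : 1 / ‖s‖ ^ 2 ≤ 1 := by
        rw [div_le_one (by positivity)]; exact one_le_pow₀ h1
      have hE : 0 ≤ 1 / (‖s‖ ^ 2 + u ^ 2) := by positivity
      have n1 : ‖(Real.sin u : ℂ) ^ 8‖ ≤ 1 := by
        rw [norm_pow, Complex.norm_real]
        exact pow_le_one₀ (norm_nonneg _) (Real.abs_sin_le_one u)
      have n2 : ‖(3 * Complex.I * sinPrim u : ℂ)‖ ≤ 3 := by
        rw [norm_mul, norm_mul, Complex.norm_real, Complex.norm_I, Real.norm_eq_abs]
        have := abs_sinPrim_le u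
        norm_num
        linarith
      refine (norm_sub_le _ _).trans ?_
      rw [norm_mul, norm_mul]
      calc _ ≤ 1 * (1 * (1 / (‖s‖ ^ 2 + u ^ 2))) + 3 * (1 * (1 / (‖s‖ ^ 2 + u ^ 2))) := by
            gcongr
            · exact a3.trans (by gcongr)
            · exact a4.trans (by gcongr)
        _ = _ := by ring
  refine ⟨hinteg, ?_⟩
  have hlim : Tendsto (fun u : ℝ => 35 / 256 * Complex.I * ((s + u * Complex.I) ^ 2)⁻¹
        + sinPrim u * ((s + u * Complex.I) ^ 3)⁻¹) atTop (𝓝 0) := by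
    have ht : Tendsto (fun u : ℝ => 2 / u ^ 2) atTop (𝓝 0) :=
      (tendsto_pow_atTop two_ne_zero).const_div_atTop 2
    refine squeeze_zero_norm' ?_ ht
    filter_upwards [eventually_ge_atTop (1 : ℝ)] with u hu
    have hu' : 0 ≤ u := by linarith
    have a2 := norm_inv_pow_le hs h1 hu' 0
    have a3 := norm_inv_pow_le hs h1 hu' 1
    have i1 : 1 / ‖s‖ ^ 1 ≤ 1 := by rw [div_le_one (by positivity)]; simpa using h1
    have i2 : 1 / (‖s‖ ^ 2 + u ^ 2) ≤ 1 / u ^ 2 := by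
      gcongr
      nlinarith [sq_nonneg ‖s‖]
    have hE : 0 ≤ 1 / (‖s‖ ^ 2 + u ^ 2) := by positivity
    have n1 : ‖(35 / 256 * Complex.I : ℂ)‖ ≤ 1 := by
      rw [norm_mul, Complex.norm_I]; norm_num
    have n2 : ‖(sinPrim u : ℂ)‖ ≤ 1 := by
      rw [Complex.norm_real]; exact abs_sinPrim_le u
    refine (norm_add_le _ _).trans ?_
    rw [norm_mul _ ((s + u * Complex.I) ^ 2)⁻¹, norm_mul _ ((s + u * Complex.I) ^ 3)⁻¹]
    calc _ ≤ 1 * (1 * (1 / u ^ 2)) + 1 * (1 * (1 / u ^ 2)) := by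
          gcongr
          · exact a2.trans (by simpa using i2)
          · exact a3.trans (by gcongr)
      _ = _ := by ring
  rw [integral_Ioi_of_hasDerivAt_of_tendsto' hder hinteg hlim]
  simp [sinPrim]

/-- Asymptotics of `hfun` in the quadrant. -/
lemma hfun_asymptotic : ∃ C > 0, ∀ s ∈ quad, 1 ≤ ‖s‖ →
    ‖hfun s - 35 / 256 * (s ^ 6)⁻¹‖ ≤ C / ‖s‖ ^ 7 := by
  set K : ℝ := 8 * 17 ^ 7 * 16 + 3 with hK
  refine ⟨K * (π / 2), by positivity, fun s hs h1 => ?_⟩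
  have hs0 : 0 < ‖s‖ := by linarith
  have hsne : s ≠ 0 := norm_pos_iff.1 hs0
  obtain ⟨hinteg, hval⟩ := integral_sin_pow_eight hs h1
  have hk := integrableOn_kernel hs
  have e : hfun s - 35 / 256 * (s ^ 6)⁻¹ = Complex.I * (s ^ 4)⁻¹ *
      ∫ u in Ioi (0 : ℝ), (s ^ 4 * (kernel s (s + u * Complex.I) ^ 8 * (s + u * Complex.I)) -
        ((Real.sin u : ℂ) ^ 8 * ((s + u * Complex.I) ^ 3)⁻¹
      - 3 * Complex.I * sinPrim u * ((s + u * Complex.I) ^ 4)⁻¹)) := by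
    rw [integral_sub (hk.const_mul _) hinteg, hval, integral_const_mul, hfun_eq hs]
    set J := ∫ u in Ioi (0 : ℝ), kernel s (s + u * Complex.I) ^ 8 * (s + u * Complex.I)
    field_simp
    linear_combination -35 * Complex.I_sq
  rw [e, norm_mul, norm_mul, Complex.norm_I, norm_inv, norm_pow, one_mul]
  have hb : ‖∫ u in Ioi (0 : ℝ), (s ^ 4 * (kernel s (s + u * Complex.I) ^ 8 * (s + u * Complex.I)) -
        ((Real.sin u : ℂ) ^ 8 * ((s + u * Complex.I) ^ 3)⁻¹
      - 3 * Complex.I * sinPrim u * ((s + u * Complex.I) ^ 4)⁻¹))‖ ≤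
      ∫ u in Ioi (0 : ℝ), (K / ‖s‖ ^ 2) * (1 / (‖s‖ ^ 2 + u ^ 2)) := by
    refine norm_integral_le_of_norm_le ((integrableOn_inv_sq_add_sq hs0).const_mul _) ?_
    refine (ae_restrict_mem measurableSet_Ioi).mono fun u hu => ?_
    have hu' : 0 ≤ u := le_of_lt hu
    have a3 := norm_inv_pow_le hs h1 hu' 1
    have a4 := norm_inv_pow_le hs h1 hu' 2
    have hz : s + u * Complex.I ≠ 0 := norm_pos_iff.1 (by linarith [norm_le_norm_add hs hu'])
    have ho := kernel_oscillation hs h1 hu'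
    have hsq := csqrt_sq hsne
    have hzq := csqrt_sq hz
    set z := s + u * Complex.I with hzdef
    set w := csqrt z * (csqrt s * kernel s z) with hw
    have ew : s ^ 4 * (kernel s z ^ 8 * z) = w ^ 8 * (z ^ 3)⁻¹ := by
      rw [eq_mul_inv_iff_mul_eq₀ (pow_ne_zero 3 hz)]
      calc _ = s ^ 4 * z ^ 4 * kernel s z ^ 8 := by ring
        _ = (csqrt s ^ 2) ^ 4 * (csqrt z ^ 2) ^ 4 * kernel s z ^ 8 := by rw [hsq, hzq]
        _ = _ := by rw [hw]; ring
    have es : (Real.sin u : ℂ) ^ 8 = (Complex.I * Real.sin u) ^ 8 := by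
      rw [mul_pow, show 8 = 2 * 4 by norm_num, pow_mul Complex.I, Complex.I_sq]; norm_num
    have hv : ‖Complex.I * (Real.sin u : ℂ)‖ ≤ 1 := by
      rw [norm_mul, Complex.norm_I, one_mul, Complex.norm_real]; exact Real.abs_sin_le_one u
    have h16 : 16 / ‖s‖ ≤ 16 := div_le_self (by norm_num) h1
    have hw17 : ‖w‖ ≤ 17 := by
      have := norm_add_le (w - Complex.I * Real.sin u) (Complex.I * Real.sin u)
      rw [sub_add_cancel] at this
      linarith
    have hd := norm_pow_sub_pow_le_of_norm_le hw17 (hv.trans (by norm_num)) 8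
    have n2 : ‖(3 * Complex.I * sinPrim u : ℂ)‖ ≤ 3 := by
      rw [norm_mul, norm_mul, Complex.norm_real, Complex.norm_I, Real.norm_eq_abs]
      have := abs_sinPrim_le u
      norm_num
      linarith
    rw [ew, es, show w ^ 8 * (z ^ 3)⁻¹ - ((Complex.I * Real.sin u) ^ 8 * (z ^ 3)⁻¹ -
      3 * Complex.I * sinPrim u * (z ^ 4)⁻¹) = (w ^ 8 - (Complex.I * Real.sin u) ^ 8) * (z ^ 3)⁻¹
      + 3 * Complex.I * sinPrim u * (z ^ 4)⁻¹ by ring]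
    refine (norm_add_le _ _).trans ?_
    rw [norm_mul, norm_mul]
    calc _ ≤ ((8 : ℕ) * 17 ^ (8 - 1) * (16 / ‖s‖)) * (1 / ‖s‖ ^ 1 * (1 / (‖s‖ ^ 2 + u ^ 2)))
          + 3 * (1 / ‖s‖ ^ 2 * (1 / (‖s‖ ^ 2 + u ^ 2))) := by
            gcongr
            exact hd.trans (by gcongr)
      _ = _ := by rw [hK]; push_cast; field_simp
  rw [integral_const_mul, integral_inv_sq_add_sq hs0] at hb
  calc _ ≤ (‖s‖ ^ 4)⁻¹ * (K / ‖s‖ ^ 2 * (π / 2 / ‖s‖)) := by gcongr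
    _ = _ := by field_simp

/-- The cutoff `4a⁴/(4a⁴ + z⁴)`. -/
noncomputable def cutoff (a x : ℝ) : ℝ := 4 * a ^ 4 / (4 * a ^ 4 + x ^ 4)

/-- The zero `a(1+i)` of `4a⁴ + z⁴` in the quadrant. -/
noncomputable def diag (a : ℝ) : ℂ := a * (1 + Complex.I)

lemma diag_re (a : ℝ) : (diag a).re = a := by simp [diag]

lemma diag_im (a : ℝ) : (diag a).im = a := by simp [diag]

lemma diag_mem_quadInt {a : ℝ} (ha : 0 < a) : diag a ∈ quadInt :=
  ⟨by rwa [diag_re], by rwa [diag_im]⟩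

lemma diag_sq (a : ℝ) : diag a ^ 2 = 2 * a ^ 2 * Complex.I := by
  have := Complex.I_sq
  rw [diag]; linear_combination a ^ 2 * this

lemma diag_pow_four (a : ℝ) : diag a ^ 4 = -(4 * a ^ 4) := by
  rw [show 4 = 2 * 2 by norm_num, pow_mul, diag_sq]
  linear_combination 4 * a ^ 4 * Complex.I_sq

lemma add_diag_ne_zero {a : ℝ} (ha : 0 < a) {z : ℂ} (hz : z ∈ quad) : z + diag a ≠ 0 := by
  intro h
  have := congrArg Complex.re h
  simp [diag_re] at this
  linarith [hz.1]

lemma sq_add_diag_sq_ne_zero {a : ℝ} (ha : 0 < a) {z : ℂ} (hz : z ∈ quad) :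
    z ^ 2 + diag a ^ 2 ≠ 0 := by
  intro h
  have h2 := congrArg Complex.im h
  simp [pow_two, diag_re, diag_im] at h2
  nlinarith [mul_nonneg hz.1 hz.2]

lemma continuous_cutoff {a : ℝ} (ha : 0 < a) : Continuous (cutoff a) := by
  unfold cutoff
  refine Continuous.div (by fun_prop) (by fun_prop) fun x => ?_
  positivity

lemma abs_cutoff_le {a : ℝ} (ha : 0 < a) (x : ℝ) : |cutoff a x| ≤ 1 := by
  have : 0 < 4 * a ^ 4 + x ^ 4 := by positivity
  rw [cutoff, abs_of_nonneg (by positivity), div_le_one this]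
  have : 0 ≤ x ^ 4 := by positivity
  linarith

lemma hasDerivAt_arctan_sq {a : ℝ} (ha : 0 < a) (x : ℝ) :
    HasDerivAt (fun x => a ^ 2 * Real.arctan (x ^ 2 / (2 * a ^ 2))) (x * cutoff a x) x := by
  have h := ((((hasDerivAt_id x).pow 2).div_const (2 * a ^ 2)).arctan).const_mul (a ^ 2)
  refine h.congr_deriv ?_
  have : 0 < 4 * a ^ 4 + x ^ 4 := by positivity
  simp only [cutoff, Pi.pow_apply, id]
  field_simp
  ring

lemma tendsto_integral_mul_cutoff {a : ℝ} (ha : 0 < a) :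
    Tendsto (fun X : ℝ => ∫ x in (0 : ℝ)..X, x * cutoff a x) atTop (𝓝 (π / 2 * a ^ 2)) := by
  have hc := continuous_cutoff ha
  have e : ∀ X : ℝ, ∫ x in (0 : ℝ)..X, x * cutoff a x =
      a ^ 2 * Real.arctan (X ^ 2 / (2 * a ^ 2)) := by
    intro X
    rw [intervalIntegral.integral_eq_sub_of_hasDerivAt (fun x _ => hasDerivAt_arctan_sq ha x)
      (Continuous.intervalIntegrable (by fun_prop) _ _)]
    simp
  simp_rw [e]
  have h1 : Tendsto (fun X : ℝ => X ^ 2 / (2 * a ^ 2)) atTop atTop :=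
    (tendsto_pow_atTop two_ne_zero).atTop_div_const (by positivity)
  have h2 := (Real.tendsto_arctan_atTop.mono_right nhdsWithin_le_nhds).comp h1
  simpa [mul_comm] using h2.const_mul (a ^ 2)

section Contour

variable {F : ℂ → ℂ} {C : ℝ}

/-- `(F - βz) · cutoff` with `β = F(s₀)/s₀`, `s₀ = a(1+i)`, with its singularity removed. -/
noncomputable def contourFun (F : ℂ → ℂ) (a : ℝ) (z : ℂ) : ℂ :=
  4 * a ^ 4 * dslope (fun z => F z - F (diag a) / diag a * z) (diag a) z /
    ((z + diag a) * (z ^ 2 + diag a ^ 2))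

lemma contourFun_eq {a : ℝ} (ha : 0 < a) {z : ℂ} (hz : z ∈ quad) (hne : z ≠ diag a) :
    contourFun F a z = (F z - F (diag a) / diag a * z) * (4 * a ^ 4 / (4 * a ^ 4 + z ^ 4)) := by
  have h0 : diag a ≠ 0 := by
    intro h
    have := congrArg Complex.re h
    rw [diag_re] at this
    exact ha.ne' this
  rw [contourFun, dslope_of_ne _ hne, slope_def_field, div_mul_cancel₀ _ h0, sub_self, sub_zero]
  have h1 := add_diag_ne_zero ha hz
  have h2 := sq_add_diag_sq_ne_zero ha hz
  have h3 : z - diag a ≠ 0 := sub_ne_zero.2 hne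
  have h4 : 4 * (a : ℂ) ^ 4 + z ^ 4 = (z - diag a) * ((z + diag a) * (z ^ 2 + diag a ^ 2)) := by
    linear_combination diag_pow_four a
  rw [h4]
  field_simp

lemma continuousOn_contourFun (hc : ContinuousOn F quad) (hd : DifferentiableOn ℂ F quadInt)
    {a : ℝ} (ha : 0 < a) : ContinuousOn (contourFun F a) quad := by
  have hn : quadInt ∈ 𝓝 (diag a) := isOpen_quadInt.mem_nhds (diag_mem_quadInt ha)
  have hn' : quad ∈ 𝓝 (diag a) := mem_of_superset hn quadInt_subset_quad
  have hdiff : DifferentiableAt ℂ (fun z => F z - F (diag a) / diag a * z) (diag a) :=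
    ((hd.differentiableAt hn)).sub (by fun_prop)
  have h1 : ContinuousOn (dslope (fun z => F z - F (diag a) / diag a * z) (diag a)) quad :=
    (continuousOn_dslope hn').2 ⟨by fun_prop, hdiff⟩
  unfold contourFun
  exact (continuousOn_const.mul h1).div (by fun_prop) fun z hz =>
    mul_ne_zero (add_diag_ne_zero ha hz) (sq_add_diag_sq_ne_zero ha hz)

lemma differentiableOn_contourFun (hd : DifferentiableOn ℂ F quadInt)
    {a : ℝ} (ha : 0 < a) : DifferentiableOn ℂ (contourFun F a) quadInt := by
  have hn : quadInt ∈ 𝓝 (diag a) := isOpen_quadInt.mem_nhds (diag_mem_quadInt ha)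
  have h1 : DifferentiableOn ℂ (dslope (fun z => F z - F (diag a) / diag a * z) (diag a)) quadInt :=
    (Complex.differentiableOn_dslope hn).2 (by fun_prop)
  unfold contourFun
  exact ((differentiableOn_const _).mul h1).div (by fun_prop) fun z hz =>
    mul_ne_zero (add_diag_ne_zero ha (quadInt_subset_quad hz))
      (sq_add_diag_sq_ne_zero ha (quadInt_subset_quad hz))

lemma norm_contourFun_le (hC : 0 ≤ C) (hb : ∀ z ∈ quad, ‖F z‖ ≤ C * (1 + ‖z‖)) {a : ℝ}
    (ha : 0 < a) : ∃ K, ∀ X, 2 * a + 1 ≤ X → ∀ z ∈ quad, X ≤ ‖z‖ →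
      ‖contourFun F a z‖ ≤ K / X ^ 3 := by
  refine ⟨(2 * C + ‖F (diag a) / diag a‖) * (8 * a ^ 4), fun X hX z hz hzX => ?_⟩
  have hX0 : 0 < X := by linarith
  have hz0 : 0 < ‖z‖ := by linarith
  have hnd : ‖diag a‖ ^ 4 = 4 * a ^ 4 := by
    rw [← norm_pow, diag_pow_four, norm_neg, norm_mul, norm_pow, Complex.norm_real,
      Real.norm_of_nonneg ha.le]
    norm_num
  have h16 : 16 * a ^ 4 ≤ ‖z‖ ^ 4 := by
    calc 16 * a ^ 4 = (2 * a) ^ 4 := by ring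
      _ ≤ ‖z‖ ^ 4 := by gcongr; linarith
  have ha4 : 0 < a ^ 4 := by positivity
  have hne : z ≠ diag a := by
    rintro rfl
    linarith
  rw [contourFun_eq ha hz hne, norm_mul, norm_div]
  have n1 : ‖(4 * a ^ 4 : ℂ)‖ = 4 * a ^ 4 := by
    rw [norm_mul, norm_pow, Complex.norm_real, Real.norm_of_nonneg ha.le]; norm_num
  have n2 : ‖z‖ ^ 4 / 2 ≤ ‖(4 * a ^ 4 + z ^ 4 : ℂ)‖ := by
    have := norm_sub_norm_le (z ^ 4) (-(4 * a ^ 4))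
    rw [sub_neg_eq_add, add_comm, norm_neg, norm_pow, n1] at this
    rw [add_comm] at this
    rw [add_comm (4 * (a : ℂ) ^ 4)]
    linarith
  have n3 : ‖F z - F (diag a) / diag a * z‖ ≤ (2 * C + ‖F (diag a) / diag a‖) * ‖z‖ := by
    refine (norm_sub_le _ _).trans ?_
    rw [norm_mul]
    have := hb z hz
    have h1 : 1 ≤ ‖z‖ := by linarith
    nlinarith
  calc _ ≤ ((2 * C + ‖F (diag a) / diag a‖) * ‖z‖) * (4 * a ^ 4 / (‖z‖ ^ 4 / 2)) := by
        rw [n1]; gcongr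
    _ = ((2 * C + ‖F (diag a) / diag a‖) * (8 * a ^ 4)) / ‖z‖ ^ 3 := by field_simp; ring
    _ ≤ _ := by gcongr

lemma ofReal_mem_quad {x : ℝ} (hx : 0 ≤ x) : (x : ℂ) ∈ quad := by
  simpa using mk_mem_quad hx (le_refl 0)

lemma mul_I_mem_quad {x : ℝ} (hx : 0 ≤ x) : (x * Complex.I : ℂ) ∈ quad := by
  simpa using mk_mem_quad (le_refl 0) hx

lemma contourFun_ofReal_im {a : ℝ} (ha : 0 < a) {x : ℝ} (hx : 0 ≤ x) :
    (contourFun F a x).im =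
      (F x).im * cutoff a x - (F (diag a) / diag a).im * (x * cutoff a x) := by
  rw [contourFun_eq ha (ofReal_mem_quad hx) (fun h => by
    have := congrArg Complex.im h
    rw [diag_im] at this
    simp at this
    linarith)]
  have : (4 * a ^ 4 / (4 * a ^ 4 + x ^ 4) : ℂ) = (cutoff a x : ℂ) := by
    simp [cutoff]
  rw [this, Complex.im_mul_ofReal, Complex.sub_im, Complex.im_mul_ofReal]
  ring

lemma contourFun_mul_I_re (hre : ∀ y : ℝ, 0 ≤ y → (F (y * Complex.I)).re = 0) {a : ℝ} (ha : 0 < a)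
    {y : ℝ} (hy : 0 ≤ y) :
    (contourFun F a (y * Complex.I)).re = (F (diag a) / diag a).im * (y * cutoff a y) := by
  rw [contourFun_eq ha (mul_I_mem_quad hy) (fun h => by
    have := congrArg Complex.re h
    rw [diag_re] at this
    simp at this
    linarith)]
  have : (4 * a ^ 4 / (4 * a ^ 4 + (y * Complex.I) ^ 4) : ℂ) = (cutoff a y : ℂ) := by
    simp [cutoff, mul_pow, Complex.I_pow_four]
  rw [this, Complex.re_mul_ofReal, Complex.sub_re, hre y hy, ← mul_assoc, Complex.mul_I_re,
    Complex.im_mul_ofReal]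
  ring

/-- The contour identity on the quadrant. -/
lemma integral_im_mul_cutoff (hc : ContinuousOn F quad) (hd : DifferentiableOn ℂ F quadInt)
    (hC : 0 ≤ C) (hb : ∀ z ∈ quad, ‖F z‖ ≤ C * (1 + ‖z‖))
    (hre : ∀ y : ℝ, 0 ≤ y → (F (y * Complex.I)).re = 0)
    (hinteg : IntegrableOn (fun x : ℝ => (F x).im) (Ioi 0)) {a : ℝ} (ha : 0 < a) :
    ∫ x in Ioi (0 : ℝ), (F x).im * cutoff a x = π * a ^ 2 * (F (diag a) / diag a).im := by
  set β := (F (diag a) / diag a).im with hβ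
  have hcont := continuousOn_contourFun hc hd ha
  have hdiff := differentiableOn_contourFun hd ha
  obtain ⟨K, hK⟩ := norm_contourFun_le hC hb ha
  have hcut := continuous_cutoff ha
  have hinteg' : IntegrableOn (fun x : ℝ => (F x).im * cutoff a x) (Ioi 0) := by
    refine Integrable.mul_bdd (c := 1) hinteg hcut.aestronglyMeasurable ?_
    exact Eventually.of_forall fun x => abs_cutoff_le ha x
  have t1 := intervalIntegral_tendsto_integral_Ioi 0 hinteg' tendsto_id
  have t2 := (tendsto_integral_mul_cutoff ha).const_mul (2 * β)
  have t3 := t1.sub t2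
  have hz : Tendsto (fun X : ℝ => (∫ x in (0 : ℝ)..X, (F x).im * cutoff a x)
      - 2 * β * ∫ x in (0 : ℝ)..X, x * cutoff a x) atTop (𝓝 0) := by
    have ht : Tendsto (fun X : ℝ => 2 * K / X ^ 2) atTop (𝓝 0) :=
      (tendsto_pow_atTop two_ne_zero).const_div_atTop (2 * K)
    refine squeeze_zero_norm' ?_ ht
    filter_upwards [eventually_ge_atTop (2 * a + 1)] with X hX
    have hX0 : 0 < X := by linarith
    have hr := rect_quad hcont hdiff hX0.le hX0.le
    have i1 : IntervalIntegrable (fun x : ℝ => contourFun F a x) volume 0 X := by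
      refine ContinuousOn.intervalIntegrable ?_
      refine hcont.comp Complex.continuous_ofReal.continuousOn fun x hx => ?_
      rw [uIcc_of_le hX0.le] at hx
      exact ofReal_mem_quad hx.1
    have i2 : IntervalIntegrable (fun y : ℝ => contourFun F a (y * Complex.I)) volume 0 X := by
      refine ContinuousOn.intervalIntegrable ?_
      refine hcont.comp (Continuous.continuousOn (by fun_prop)) fun x hx => ?_
      rw [uIcc_of_le hX0.le] at hx
      exact mul_I_mem_quad hx.1
    have i3 : IntervalIntegrable (fun x : ℝ => (F x).im * cutoff a x) volume 0 X :=
      (intervalIntegrable_iff_integrableOn_Ioc_of_le hX0.le).2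
        (hinteg'.mono_set Ioc_subset_Ioi_self)
    have i4 : IntervalIntegrable (fun x : ℝ => β * (x * cutoff a x)) volume 0 X :=
      Continuous.intervalIntegrable (by fun_prop) _ _
    have j1 : (∫ x in (0 : ℝ)..X, contourFun F a x).im =
        (∫ x in (0 : ℝ)..X, (F x).im * cutoff a x) - β * ∫ x in (0 : ℝ)..X, x * cutoff a x := by
      rw [← intervalIntegral.integral_const_mul, ← intervalIntegral.integral_sub i3 i4]
      have := Complex.imCLM.intervalIntegral_comp_comm i1
      simp only [Complex.imCLM_apply] at this
      rw [← this]
      refine intervalIntegral.integral_congr fun x hx => ?_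
      rw [uIcc_of_le hX0.le] at hx
      exact contourFun_ofReal_im ha hx.1
    have j2 : (∫ y in (0 : ℝ)..X, contourFun F a (y * Complex.I)).re =
        β * ∫ x in (0 : ℝ)..X, x * cutoff a x := by
      rw [← intervalIntegral.integral_const_mul]
      have := Complex.reCLM.intervalIntegral_comp_comm i2
      simp only [Complex.reCLM_apply] at this
      rw [← this]
      refine intervalIntegral.integral_congr fun x hx => ?_
      rw [uIcc_of_le hX0.le] at hx
      exact contourFun_mul_I_re hre ha hx.1
    have k1 : ‖∫ x in (0 : ℝ)..X, contourFun F a (x + X * Complex.I)‖ ≤ K / X ^ 3 * |X - 0| := by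
      refine intervalIntegral.norm_integral_le_of_norm_le_const fun x hx => ?_
      rw [uIoc_of_le hX0.le] at hx
      refine hK X hX _ (mk_mem_quad hx.1.le hX0.le) ?_
      refine le_trans ?_ (Complex.abs_im_le_norm _)
      simp [abs_of_pos hX0]
    have k2 : ‖∫ y in (0 : ℝ)..X, contourFun F a (X + y * Complex.I)‖ ≤ K / X ^ 3 * |X - 0| := by
      refine intervalIntegral.norm_integral_le_of_norm_le_const fun x hx => ?_
      rw [uIoc_of_le hX0.le] at hx
      refine hK X hX _ (mk_mem_quad hX0.le hx.1.le) ?_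
      refine le_trans ?_ (Complex.abs_re_le_norm _)
      simp [abs_of_pos hX0]
    have him := congrArg Complex.im hr
    simp only [Complex.sub_im, Complex.add_im, Complex.I_mul_im, Complex.zero_im] at him
    rw [j1, j2] at him
    have l1 := (Complex.abs_im_le_norm _).trans k1
    have l2 := (Complex.abs_re_le_norm _).trans k2
    have e : K / X ^ 3 * |X - 0| = K / X ^ 2 := by
      rw [sub_zero, abs_of_pos hX0]; field_simp
    rw [e] at l1 l2
    rw [Real.norm_eq_abs, show (∫ x in (0 : ℝ)..X, (F x).im * cutoff a x)
      - 2 * β * ∫ x in (0 : ℝ)..X, x * cutoff a x =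
      (∫ x in (0 : ℝ)..X, contourFun F a (x + X * Complex.I)).im -
      (∫ y in (0 : ℝ)..X, contourFun F a (X + y * Complex.I)).re by linarith]
    refine (abs_sub _ _).trans ?_
    rw [two_mul, add_div]
    linarith
  have := tendsto_nhds_unique t3 hz
  linarith

/-- The contour identity after removing the cutoff. -/
lemma tendsto_diag (hc : ContinuousOn F quad) (hd : DifferentiableOn ℂ F quadInt)
    (hC : 0 ≤ C) (hb : ∀ z ∈ quad, ‖F z‖ ≤ C * (1 + ‖z‖))
    (hre : ∀ y : ℝ, 0 ≤ y → (F (y * Complex.I)).re = 0)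
    (hinteg : IntegrableOn (fun x : ℝ => (F x).im) (Ioi 0)) :
    Tendsto (fun a : ℝ => π * a ^ 2 * (F (diag a) / diag a).im) atTop
      (𝓝 (∫ x in Ioi (0 : ℝ), (F x).im)) := by
  have h : Tendsto (fun a : ℝ => ∫ x in Ioi (0 : ℝ), (F x).im * cutoff a x) atTop
      (𝓝 (∫ x in Ioi (0 : ℝ), (F x).im)) := by
    refine tendsto_integral_filter_of_dominated_convergence (fun x => ‖(F x).im‖) ?_ ?_ hinteg.norm ?_
    · filter_upwards [eventually_gt_atTop (0 : ℝ)] with a ha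
      exact hinteg.aestronglyMeasurable.mul (continuous_cutoff ha).aestronglyMeasurable
    · filter_upwards [eventually_gt_atTop (0 : ℝ)] with a ha
      refine Eventually.of_forall fun x => ?_
      rw [norm_mul]
      exact mul_le_of_le_one_right (norm_nonneg _) (abs_cutoff_le ha x)
    · refine Eventually.of_forall fun x => ?_
      have h1 : Tendsto (fun a : ℝ => 1 - x ^ 4 / (4 * a ^ 4 + x ^ 4)) atTop (𝓝 (1 - 0)) := by
        refine tendsto_const_nhds.sub (Tendsto.const_div_atTop ?_ _)
        exact tendsto_atTop_add_const_right _ _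
          ((tendsto_pow_atTop (by norm_num)).const_mul_atTop (by norm_num))
      have h2 : Tendsto (fun a : ℝ => cutoff a x) atTop (𝓝 1) := by
        rw [sub_zero] at h1
        refine h1.congr' ?_
        filter_upwards [eventually_gt_atTop (0 : ℝ)] with a ha
        have : 0 < 4 * a ^ 4 + x ^ 4 := by positivity
        rw [cutoff]; field_simp; ring
      simpa using h2.const_mul (F x).im
  refine h.congr' ?_
  filter_upwards [eventually_gt_atTop (0 : ℝ)] with a ha
  exact integral_im_mul_cutoff hc hd hC hb hre hinteg ha

end Contour

/-- The product `K₀ (K₀ + iπ I₀)`. -/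
noncomputable def prodK (z : ℂ) : ℂ := cK z * (cK z + π * Complex.I * cI z)

/-- The coefficient that removes `I₀³K₀⁵` from the imaginary part. -/
noncomputable def lam : ℝ := -(14 * (prim 3 0).im / π ^ 3)

/-- The combination of `hfun` and `prodK⁴`. -/
noncomputable def core (z : ℂ) : ℂ := hfun z + lam * prodK z ^ 4

/-- The function integrated along the boundary of the quadrant. -/
noncomputable def contourF (z : ℂ) : ℂ := core z * (32 * z ^ 3 - 64 * z ^ 5)

lemma prodK_bound_large : ∃ D > 0, ∀ z ∈ quad, 1 ≤ ‖z‖ → ‖z * prodK z‖ ≤ D := by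
  obtain ⟨D1, hD1, h1⟩ := cI_quad_bound
  obtain ⟨D2, hD2, h2⟩ := cK_quad_bound
  refine ⟨D2 * (D2 + π * D1), by positivity, fun z hz hn => ?_⟩
  have a := h1 z hz hn
  have k := h2 z hz hn
  have hs : √‖z‖ * √‖z‖ = ‖z‖ := Real.mul_self_sqrt (norm_nonneg z)
  have hmono : Real.exp (-z.re) ≤ Real.exp z.re := Real.exp_le_exp.2 (by linarith [hz.1])
  have hE : Real.exp (-z.re) * Real.exp z.re = 1 := by rw [← Real.exp_add]; simp
  have hsum : √‖z‖ * ‖cK z + π * Complex.I * cI z‖ ≤ (D2 + π * D1) * Real.exp z.re := by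
    have h3 : ‖cK z + π * Complex.I * cI z‖ ≤ ‖cK z‖ + π * ‖cI z‖ := by
      refine (norm_add_le _ _).trans ?_
      rw [norm_mul, norm_mul, Complex.norm_real, Complex.norm_I, Real.norm_of_nonneg Real.pi_pos.le,
        mul_one]
    calc _ ≤ √‖z‖ * (‖cK z‖ + π * ‖cI z‖) := by gcongr
      _ = √‖z‖ * ‖cK z‖ + π * (√‖z‖ * ‖cI z‖) := by ring
      _ ≤ D2 * Real.exp z.re + π * (D1 * Real.exp z.re) := by
        have k2 : √‖z‖ * ‖cK z‖ ≤ D2 * Real.exp z.re := k.trans (by gcongr)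
        gcongr ?_ + π * ?_
      _ = _ := by ring
  calc ‖z * prodK z‖ = (√‖z‖ * ‖cK z‖) * (√‖z‖ * ‖cK z + π * Complex.I * cI z‖) := by
        rw [prodK, norm_mul, norm_mul, ← hs]
        rw [Real.sqrt_mul_self (Real.sqrt_nonneg _)]
        ring
    _ ≤ (D2 * Real.exp (-z.re)) * ((D2 + π * D1) * Real.exp z.re) := by gcongr
    _ = D2 * (D2 + π * D1) * (Real.exp (-z.re) * Real.exp z.re) := by ring
    _ = _ := by rw [hE, mul_one]

lemma core_bound_large : ∃ C > 0, ∀ z ∈ quad, 1 ≤ ‖z‖ → ‖core z‖ ≤ C / ‖z‖ ^ 4 := by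
  obtain ⟨C, hC, h⟩ := hfun_asymptotic
  obtain ⟨D, hD, hp⟩ := prodK_bound_large
  refine ⟨C + 1 + |lam| * D ^ 4, by positivity, fun z hz hn => ?_⟩
  have hz0 : 0 < ‖z‖ := by linarith
  have a := h z hz hn
  have b := hp z hz hn
  rw [norm_mul] at b
  have h1 : ‖hfun z‖ ≤ (C + 1) / ‖z‖ ^ 4 := by
    have e := norm_add_le (hfun z - 35 / 256 * (z ^ 6)⁻¹) (35 / 256 * (z ^ 6)⁻¹)
    rw [sub_add_cancel] at e
    have e2 : ‖(35 / 256 * (z ^ 6)⁻¹ : ℂ)‖ ≤ 1 / ‖z‖ ^ 4 := by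
      rw [norm_mul, norm_inv, norm_pow, ← one_div]
      have : ‖(35 / 256 : ℂ)‖ ≤ 1 := by norm_num
      calc _ ≤ 1 * (1 / ‖z‖ ^ 4) := by
            gcongr
            norm_num
        _ = _ := one_mul _
    have e3 : C / ‖z‖ ^ 7 ≤ C / ‖z‖ ^ 4 := by
      gcongr
      norm_num
    rw [add_div]
    linarith
  have h2 : ‖prodK z‖ ^ 4 ≤ D ^ 4 / ‖z‖ ^ 4 := by
    rw [le_div_iff₀ (by positivity), ← mul_pow, mul_comm]
    gcongr
  rw [core]
  refine (norm_add_le _ _).trans ?_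
  rw [norm_mul, norm_pow, Complex.norm_real, Real.norm_eq_abs, add_div, mul_div_assoc]
  gcongr

lemma core_bound_small : ∃ C > 0, ∀ z ∈ quad, ‖z‖ ≤ 1 → ‖core z‖ * ‖z‖ ≤ C := by
  obtain ⟨D, hD, h⟩ := small_bounds
  have hw : 0 < weightC := (weight_vertDecay (b := 0) (by norm_num)).pos
  set G : ℝ := 2 * (weightC * Real.exp 8) with hG
  have hG0 : 0 < G := by positivity
  refine ⟨(∑ b ∈ Finset.range 9, (Nat.choose 8 b : ℝ)) * D ^ 8 * G
    + |lam| * (D * ((1 + π) * D)) ^ 4 + 1, by positivity, fun z hz hn => ?_⟩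
  rcases eq_or_ne z 0 with rfl | h0
  · simp only [norm_zero, mul_zero]; positivity
  have hz0 : 0 < ‖z‖ := norm_pos_iff.2 h0
  obtain ⟨a, k⟩ := h z h0 hn
  set P := ‖z‖ ^ (-(1 / 16) : ℝ) with hP
  have hP0 : 0 < P := Real.rpow_pos_of_pos hz0 _
  have hone : 1 ≤ P := Real.one_le_rpow_of_pos_of_le_one_of_nonpos hz0 hn (by norm_num)
  have e7 : P ^ 8 * ‖z‖ ≤ 1 := by
    have : P ^ 8 * ‖z‖ = √‖z‖ := by
      rw [hP, ← Real.rpow_natCast, ← Real.rpow_mul hz0.le, Real.sqrt_eq_rpow]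
      nth_rewrite 2 [← Real.rpow_one ‖z‖]
      rw [← Real.rpow_add hz0]
      norm_num
    rw [this]
    exact Real.sqrt_le_one.2 hn
  have hre : z.re ≤ 1 := (Complex.re_le_norm z).trans hn
  have hprim : ∀ b ≤ 8, ‖prim b z‖ ≤ G := by
    intro b hb
    refine ((weight_vertDecay hb).norm_vert_le hz).trans ?_
    have : (0 : ℝ) ≤ b := by positivity
    have : (8 - 2 * (b : ℝ)) * z.re ≤ 8 := by nlinarith [hz.1]
    rw [hG]
    gcongr
  have b1 : ‖hfun z‖ ≤ (∑ b ∈ Finset.range 9, (Nat.choose 8 b : ℝ)) * D ^ 8 * G * P ^ 8 := by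
    rw [hfun, Finset.sum_mul, Finset.sum_mul, Finset.sum_mul]
    refine norm_sum_le_of_le _ fun b hb => ?_
    have hb8 : b ≤ 8 := Nat.lt_succ_iff.1 (Finset.mem_range.1 hb)
    rw [norm_mul, norm_mul, norm_mul, norm_mul, norm_pow, norm_pow, norm_pow, norm_neg, norm_one,
      one_pow, mul_one, Complex.norm_natCast]
    have e6 : D ^ 8 = D ^ (8 - b) * D ^ b := by rw [← pow_add, Nat.sub_add_cancel hb8]
    calc _ ≤ (Nat.choose 8 b : ℝ) * (D * P) ^ (8 - b) * D ^ b * G := by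
          gcongr
          exact hprim b hb8
      _ = (Nat.choose 8 b : ℝ) * D ^ 8 * G * P ^ (8 - b) := by rw [e6, mul_pow]; ring
      _ ≤ _ := by
          gcongr
          omega
  have b2 : ‖prodK z‖ ≤ D * ((1 + π) * D) * P ^ 2 := by
    rw [prodK, norm_mul]
    have h3 : ‖cK z + π * Complex.I * cI z‖ ≤ ‖cK z‖ + π * ‖cI z‖ := by
      refine (norm_add_le _ _).trans ?_
      rw [norm_mul, norm_mul, Complex.norm_real, Complex.norm_I, Real.norm_of_nonneg Real.pi_pos.le,
        mul_one]
    have h4 : ‖cK z + π * Complex.I * cI z‖ ≤ (1 + π) * D * P := by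
      have : D ≤ D * P := le_mul_of_one_le_right hD.le hone
      calc _ ≤ D * P + π * (D * P) := h3.trans (by gcongr; exact a.trans this)
        _ = _ := by ring
    calc _ ≤ (D * P) * ((1 + π) * D * P) := by gcongr
      _ = _ := by ring
  have b3 : ‖core z‖ ≤ ((∑ b ∈ Finset.range 9, (Nat.choose 8 b : ℝ)) * D ^ 8 * G
    + |lam| * (D * ((1 + π) * D)) ^ 4) * P ^ 8 := by
    rw [core]
    refine (norm_add_le _ _).trans ?_
    rw [norm_mul, norm_pow, Complex.norm_real, Real.norm_eq_abs]
    calc _ ≤ (∑ b ∈ Finset.range 9, (Nat.choose 8 b : ℝ)) * D ^ 8 * G * P ^ 8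
          + |lam| * (D * ((1 + π) * D) * P ^ 2) ^ 4 := by gcongr
      _ = _ := by ring
  calc _ ≤ (((∑ b ∈ Finset.range 9, (Nat.choose 8 b : ℝ)) * D ^ 8 * G
    + |lam| * (D * ((1 + π) * D)) ^ 4) * P ^ 8) * ‖z‖ := by gcongr
    _ = ((∑ b ∈ Finset.range 9, (Nat.choose 8 b : ℝ)) * D ^ 8 * G
    + |lam| * (D * ((1 + π) * D)) ^ 4) * (P ^ 8 * ‖z‖) := by ring
    _ ≤ _ := (mul_le_of_le_one_right (by positivity) e7).trans (by linarith)

lemma norm_poly_le (z : ℂ) : ‖(32 * z ^ 3 - 64 * z ^ 5 : ℂ)‖ ≤ 32 * ‖z‖ ^ 3 + 64 * ‖z‖ ^ 5 := by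
  refine (norm_sub_le _ _).trans ?_
  rw [norm_mul, norm_mul, norm_pow, norm_pow]
  norm_num

lemma contourF_bound_small : ∃ C > 0, ∀ z ∈ quad, ‖z‖ ≤ 1 → ‖contourF z‖ ≤ C * ‖z‖ := by
  obtain ⟨C, hC, h⟩ := core_bound_small
  refine ⟨C * 96, by positivity, fun z hz hn => ?_⟩
  have h1 := h z hz hn
  rw [contourF, norm_mul]
  have hz0 := norm_nonneg z
  have p4 : ‖z‖ ^ 4 ≤ ‖z‖ := by simpa using pow_le_pow_of_le_one hz0 hn (show 1 ≤ 4 by norm_num)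
  have p2 : ‖z‖ ^ 2 ≤ ‖z‖ := by simpa using pow_le_pow_of_le_one hz0 hn (show 1 ≤ 2 by norm_num)
  calc _ ≤ ‖core z‖ * (32 * ‖z‖ ^ 3 + 64 * ‖z‖ ^ 5) := by gcongr; exact norm_poly_le z
    _ = (‖core z‖ * ‖z‖) * (32 * ‖z‖ ^ 2 + 64 * ‖z‖ ^ 4) := by ring
    _ ≤ C * (32 * ‖z‖ + 64 * ‖z‖) := by gcongr
    _ = _ := by ring

lemma contourF_bound : ∃ C ≥ 0, ∀ z ∈ quad, ‖contourF z‖ ≤ C * (1 + ‖z‖) := by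
  obtain ⟨C1, hC1, h1⟩ := contourF_bound_small
  obtain ⟨C2, hC2, h2⟩ := core_bound_large
  refine ⟨C1 + 96 * C2, by positivity, fun z hz => ?_⟩
  have hz0 := norm_nonneg z
  rcases le_total ‖z‖ 1 with hn | hn
  · refine (h1 z hz hn).trans ?_
    gcongr
    · linarith
    · linarith
  · rw [contourF, norm_mul]
    have hzp : 0 < ‖z‖ := by linarith
    have p : ‖z‖ ^ 3 ≤ ‖z‖ ^ 5 := pow_le_pow_right₀ hn (by norm_num)
    calc _ ≤ (C2 / ‖z‖ ^ 4) * (32 * ‖z‖ ^ 5 + 64 * ‖z‖ ^ 5) := by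
          gcongr
          · exact h2 z hz hn
          · exact (norm_poly_le z).trans (by gcongr)
      _ = 96 * C2 * ‖z‖ := by field_simp; ring
      _ ≤ _ := by gcongr <;> linarith

lemma differentiableAt_prodK {z : ℂ} (hz : z ∈ Complex.slitPlane) : DifferentiableAt ℂ prodK z := by
  have h1 := (isBesselSol_cI z hz).1.differentiableAt
  have h2 := (isBesselSol_cK z hz).1.differentiableAt
  unfold prodK
  fun_prop

lemma differentiableOn_hfun : DifferentiableOn ℂ hfun quadInt := by
  unfold hfun
  refine DifferentiableOn.fun_sum fun b hb => ?_
  have hb8 : b ≤ 8 := Nat.lt_succ_iff.1 (Finset.mem_range.1 hb)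
  have hG : DifferentiableOn ℂ (prim b) quadInt := (weight_vertDecay hb8).differentiableOn_vert
  have h1 : DifferentiableOn ℂ cI quadInt := fun z hz =>
    (isBesselSol_cI z (quadInt_subset_slitPlane hz)).1.differentiableAt.differentiableWithinAt
  have h2 : DifferentiableOn ℂ cK quadInt := fun z hz =>
    (isBesselSol_cK z (quadInt_subset_slitPlane hz)).1.differentiableAt.differentiableWithinAt
  fun_prop

lemma differentiableOn_contourF : DifferentiableOn ℂ contourF quadInt := by
  have h1 := differentiableOn_hfun
  have h2 : DifferentiableOn ℂ prodK quadInt := fun z hz =>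
    (differentiableAt_prodK (quadInt_subset_slitPlane hz)).differentiableWithinAt
  unfold contourF core
  fun_prop

lemma continuousOn_contourF : ContinuousOn contourF quad := by
  intro z hz
  rcases eq_or_ne z 0 with rfl | h0
  · obtain ⟨C, hC, h⟩ := contourF_bound_small
    have e : contourF 0 = 0 := by simp [contourF]
    rw [ContinuousWithinAt, e]
    have ht : Tendsto (fun z : ℂ => C * ‖z‖) (𝓝[quad] 0) (𝓝 0) := by
      have : Continuous fun z : ℂ => C * ‖z‖ := by fun_prop
      simpa using (this.tendsto 0).mono_left nhdsWithin_le_nhds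
    refine squeeze_zero_norm' ?_ ht
    filter_upwards [self_mem_nhdsWithin,
      nhdsWithin_le_nhds (Metric.ball_mem_nhds (0 : ℂ) one_pos)] with w hw hw1
    exact h w hw (mem_ball_zero_iff.1 hw1).le
  · have hsl := mem_slitPlane_of_mem_quad hz h0
    have h1 : ContinuousWithinAt cI quad z := continuous_cI.continuousWithinAt
    have h2 : ContinuousWithinAt cK quad z := (isBesselSol_cK z hsl).1.continuousAt.continuousWithinAt
    have h3 : ∀ b ∈ Finset.range 9, ContinuousWithinAt (prim b) quad z := fun b hb =>
      (weight_vertDecay (Nat.lt_succ_iff.1 (Finset.mem_range.1 hb))).continuousOn_vert z hz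
    have h4 : ContinuousWithinAt hfun quad z := by
      unfold hfun
      refine tendsto_finsetSum _ fun b hb => ?_
      have h3b := h3 b hb
      have : ContinuousWithinAt (fun s => (Nat.choose 8 b * (-1) ^ b * cK s ^ (8 - b) * cI s ^ b)
        * prim b s) quad z := by fun_prop
      exact this
    unfold contourF core prodK
    fun_prop

lemma kernel_mul_I {y v : ℝ} (hy : 0 < y) (hv : 0 < v) :
    kernel (y * Complex.I) (v * Complex.I) =
      ((realJ v * realX y - realX v * realJ y : ℝ) : ℂ) := by
  rw [kernel, cI_mul_I, cI_mul_I, cK_mul_I hy, cK_mul_I hv]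
  push_cast
  ring

lemma hfun_mul_I {y : ℝ} (hy : 0 < y) : (hfun (y * Complex.I)).im = 0 := by
  rw [hfun_eq (mul_I_mem_quad hy.le), ← integral_const_mul]
  rw [setIntegral_congr_fun measurableSet_Ioi (g := fun u : ℝ =>
    ((-((realJ (y + u) * realX y - realX (y + u) * realJ y) ^ 8 * (y + u)) : ℝ) : ℂ))]
  · rw [integral_complex_ofReal, Complex.ofReal_im]
  · intro u hu
    have hu' : 0 < u := hu
    simp only
    rw [show (y * Complex.I + u * Complex.I : ℂ) = ((y + u : ℝ) : ℂ) * Complex.I by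
      push_cast; ring, kernel_mul_I hy (by linarith)]
    push_cast
    linear_combination ((realJ (y + u) * realX y - realX (y + u) * realJ y) ^ 8 * (y + u))
      * Complex.I_sq

lemma prodK_mul_I {y : ℝ} (hy : 0 < y) :
    prodK (y * Complex.I) = ((realX y ^ 2 + (π / 2) ^ 2 * realJ y ^ 2 : ℝ) : ℂ) := by
  rw [prodK, cI_mul_I, cK_mul_I hy]
  push_cast
  linear_combination (-(π / 2) ^ 2 * realJ y ^ 2 : ℂ) * Complex.I_sq

lemma contourF_mul_I_re {y : ℝ} (hy : 0 ≤ y) : (contourF (y * Complex.I)).re = 0 := by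
  rcases hy.eq_or_lt with rfl | hy
  · simp [contourF]
  have h1 : core (y * Complex.I) = ((core (y * Complex.I)).re : ℂ) := by
    refine Complex.ext (by simp) ?_
    rw [Complex.ofReal_im, core, Complex.add_im, hfun_mul_I hy, prodK_mul_I hy, ← Complex.ofReal_pow,
      ← Complex.ofReal_mul, Complex.ofReal_im, add_zero]
  have h2 : (32 * (y * Complex.I) ^ 3 - 64 * (y * Complex.I) ^ 5 : ℂ) =
      ((-(32 * y ^ 3) - 64 * y ^ 5 : ℝ) : ℂ) * Complex.I := by
    have I3 : Complex.I ^ 3 = -Complex.I := by rw [pow_succ, Complex.I_sq]; ring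
    have I5 : Complex.I ^ 5 = Complex.I := by rw [pow_succ, Complex.I_pow_four]; ring
    rw [mul_pow, mul_pow, I3, I5]
    push_cast
    ring
  rw [contourF, h1, h2, ← mul_assoc, ← Complex.ofReal_mul, Complex.mul_I_re, Complex.ofReal_im,
    neg_zero]

lemma contourF_ofReal_im {x : ℝ} (hx : 0 < x) : (contourF x).im =
    (32 * x ^ 3 - 64 * x ^ 5) *
      ((-8 * (prim 1 0).im - 56 * (prim 3 0).im / π ^ 2) * (besselI0 x ^ 1 * besselK0 x ^ 7)
        + 28 * (prim 2 0).im * (besselI0 x ^ 2 * besselK0 x ^ 6)) := by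
  have hp : (32 * x ^ 3 - 64 * x ^ 5 : ℂ) = ((32 * x ^ 3 - 64 * x ^ 5 : ℝ) : ℂ) := by push_cast; rfl
  rw [contourF, hp, Complex.im_mul_ofReal, mul_comm]
  congr 1
  rw [core, Complex.add_im, Complex.im_ofReal_mul]
  have h1 : (hfun x).im = -8 * (prim 1 0).im * (besselK0 x ^ 7 * besselI0 x)
      + 28 * (prim 2 0).im * (besselK0 x ^ 6 * besselI0 x ^ 2)
      - 56 * (prim 3 0).im * (besselK0 x ^ 5 * besselI0 x ^ 3) := by
    have e : hfun x = ∑ b ∈ Finset.range 9,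
        ((Nat.choose 8 b * (-1) ^ b * besselK0 x ^ (8 - b) * besselI0 x ^ b : ℝ) : ℂ)
          * prim b x := by
      rw [hfun, cI_ofReal, cK_ofReal hx]
      refine Finset.sum_congr rfl fun b _ => ?_
      push_cast
      rfl
    rw [e, Complex.im_sum]
    have e2 : ∀ b ∈ Finset.range 9,
        (((Nat.choose 8 b * (-1) ^ b * besselK0 x ^ (8 - b) * besselI0 x ^ b : ℝ) : ℂ)
          * prim b x).im = (Nat.choose 8 b * (-1) ^ b * besselK0 x ^ (8 - b) * besselI0 x ^ b)
          * (prim b 0).im := by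
      intro b hb
      rw [Complex.im_ofReal_mul,
        prim_ofReal_im (Nat.lt_succ_iff.1 (Finset.mem_range.1 hb)) hx.le]
    rw [Finset.sum_congr rfl e2]
    have z0 := moment_relations.1
    have z4 := prim_zero_im (b := 4) (by norm_num) (by norm_num)
    have z5 := prim_zero_im (b := 5) (by norm_num) (by norm_num)
    have z6 := prim_zero_im (b := 6) (by norm_num) (by norm_num)
    have z7 := prim_zero_im (b := 7) (by norm_num) (by norm_num)
    have z8 := prim_zero_im (b := 8) (by norm_num) (by norm_num)
    simp [Finset.sum_range_succ, Nat.choose, z0, z4, z5, z6, z7, z8]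
    ring
  have h2 : (prodK x ^ 4).im = 4 * π * (besselK0 x ^ 7 * besselI0 x)
      - 4 * π ^ 3 * (besselK0 x ^ 5 * besselI0 x ^ 3) := by
    have e : prodK x ^ 4 = ((besselK0 x ^ 8 - 6 * π ^ 2 * besselK0 x ^ 6 * besselI0 x ^ 2
        + π ^ 4 * besselK0 x ^ 4 * besselI0 x ^ 4 : ℝ) : ℂ) +
        ((4 * π * (besselK0 x ^ 7 * besselI0 x)
      - 4 * π ^ 3 * (besselK0 x ^ 5 * besselI0 x ^ 3) : ℝ) : ℂ) * Complex.I := by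
      rw [prodK, cI_ofReal, cK_ofReal hx]
      push_cast
      have I2 : Complex.I ^ 2 = -1 := Complex.I_sq
      have I3 : Complex.I ^ 3 = -Complex.I := by rw [pow_succ, I2]; ring
      have I4 : Complex.I ^ 4 = 1 := Complex.I_pow_four
      ring_nf
      rw [I2, I3, I4]
      ring
    rw [e]
    simp only [Complex.add_im, Complex.ofReal_im, Complex.mul_I_im, Complex.ofReal_re, zero_add]
  rw [h1, h2, lam]
  have hpi := Real.pi_ne_zero
  field_simp
  ring

lemma integrableOn_contourF_im : IntegrableOn (fun x : ℝ => (contourF x).im) (Ioi 0) ∧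
    ∫ x in Ioi (0 : ℝ), (contourF x).im =
      (-8 * (prim 1 0).im - 56 * (prim 3 0).im / π ^ 2) *
        (32 * besselMoment 1 7 3 - 64 * besselMoment 1 7 5)
        + 28 * (prim 2 0).im * (32 * besselMoment 2 6 3 - 64 * besselMoment 2 6 5) := by
  set A := -8 * (prim 1 0).im - 56 * (prim 3 0).im / π ^ 2 with hA
  set B := 28 * (prim 2 0).im with hB
  have i1 := (integrableOn_besselMoment (b := 7) (by norm_num) (by norm_num) 2).const_mul (A * 32)
  have i2 := (integrableOn_besselMoment (b := 7) (by norm_num) (by norm_num) 4).const_mul (A * 64)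
  have i3 := (integrableOn_besselMoment (b := 6) (by norm_num) (by norm_num) 2).const_mul (B * 32)
  have i4 := (integrableOn_besselMoment (b := 6) (by norm_num) (by norm_num) 4).const_mul (B * 64)
  have e : EqOn (fun x : ℝ => (contourF x).im) (fun x : ℝ =>
      ((A * 32) * (besselI0 x ^ (8 - 7) * besselK0 x ^ 7 * x ^ (2 + 1)) -
      (A * 64) * (besselI0 x ^ (8 - 7) * besselK0 x ^ 7 * x ^ (4 + 1))) +
      ((B * 32) * (besselI0 x ^ (8 - 6) * besselK0 x ^ 6 * x ^ (2 + 1)) -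
      (B * 64) * (besselI0 x ^ (8 - 6) * besselK0 x ^ 6 * x ^ (4 + 1)))) (Ioi 0) := by
    intro x hx
    simp only
    rw [contourF_ofReal_im hx]
    norm_num
    ring
  refine ⟨((i1.sub i2).add (i3.sub i4)).congr
    ((ae_restrict_mem measurableSet_Ioi).mono fun x hx => (e hx).symm), ?_⟩
  have i12 : Integrable (fun x => A * 32 * (besselI0 x ^ (8 - 7) * besselK0 x ^ 7 * x ^ (2 + 1)) -
      A * 64 * (besselI0 x ^ (8 - 7) * besselK0 x ^ 7 * x ^ (4 + 1))) (volume.restrict (Ioi 0)) :=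
    i1.sub i2
  have i34 : Integrable (fun x => B * 32 * (besselI0 x ^ (8 - 6) * besselK0 x ^ 6 * x ^ (2 + 1)) -
      B * 64 * (besselI0 x ^ (8 - 6) * besselK0 x ^ 6 * x ^ (4 + 1))) (volume.restrict (Ioi 0)) :=
    i3.sub i4
  rw [setIntegral_congr_fun measurableSet_Ioi e, integral_add i12 i34,
    integral_sub i1 i2, integral_sub i3 i4]
  simp only [integral_const_mul, besselMoment]
  norm_num
  ring

/-- The derivative of `z prodK z`. -/
noncomputable def prodD (z : ℂ) : ℂ :=
  prodK z + z * (cK' z * (cK z + π * Complex.I * cI z) + cK z * (cK' z + π * Complex.I * cI' z))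

/-- The second derivative of `z prodK z`. -/
noncomputable def prodDD (z : ℂ) : ℂ :=
  cK' z * (cK z + π * Complex.I * cI z) + cK z * (cK' z + π * Complex.I * cI' z)
    + 2 * z * prodK z + 2 * z * (cK' z * (cK' z + π * Complex.I * cI' z))

lemma hasDerivAt_mul_prodK {z : ℂ} (hz : z ∈ Complex.slitPlane) :
    HasDerivAt (fun z => z * prodK z) (prodD z) z := by
  have hI := (isBesselSol_cI z hz).1
  have hK := (isBesselSol_cK z hz).1
  have h := (hasDerivAt_id z).mul (hK.mul (hK.add (hI.const_mul (π * Complex.I))))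
  refine h.congr_deriv ?_
  simp only [prodD, prodK, id, Pi.add_apply, Pi.mul_apply]
  ring

lemma hasDerivAt_prodD {z : ℂ} (hz : z ∈ Complex.slitPlane) :
    HasDerivAt prodD (prodDD z) z := by
  have hI := (isBesselSol_cI z hz).1
  have hK := (isBesselSol_cK z hz).1
  have hI' := (isBesselSol_cI z hz).2
  have hK' := (isBesselSol_cK z hz).2
  have hS := hK.add (hI.const_mul (π * Complex.I))
  have hS' := hK'.add (hI'.const_mul (π * Complex.I))
  have h := (hK.mul hS).add ((hasDerivAt_id z).mul ((hK'.mul hS).add (hK.mul hS')))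
  refine h.congr_deriv ?_
  have hz0 := Complex.slitPlane_ne_zero hz
  simp only [prodDD, prodK, id, Pi.add_apply, Pi.mul_apply]
  field_simp
  ring

lemma prodK_first_integral {z : ℂ} (hz : z ≠ 0) :
    2 * (z * prodK z) * prodDD z - prodD z ^ 2 = (4 - 1 / z ^ 2) * (z * prodK z) ^ 2 + π ^ 2 := by
  have hw := cI_cK_wronskian hz
  have e : (4 - 1 / z ^ 2) * (z * prodK z) ^ 2 = (4 * z ^ 2 - 1) * prodK z ^ 2 := by
    field_simp
  rw [e, prodDD, prodD, prodK]
  have hI := Complex.I_sq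
  have h2 : (z * (cI' z * cK z - cI z * cK' z)) ^ 2 = 1 := by rw [hw, one_pow]
  linear_combination (-π ^ 2 * (z * (cI' z * cK z - cI z * cK' z)) ^ 2) * hI + π ^ 2 * h2

/-- Cauchy's estimate on translated quadrants. -/
lemma norm_deriv_le_of_quadrant {f f' : ℂ → ℂ} (hf : ∀ z ∈ quadInt, HasDerivAt f (f' z) z)
    {c r M : ℝ} (hc : 0 < c) (hr : 0 < r) (hM : ∀ z : ℂ, c ≤ z.re → c ≤ z.im → ‖f z‖ ≤ M)
    {z : ℂ} (h1 : c + r ≤ z.re) (h2 : c + r ≤ z.im) : ‖f' z‖ ≤ M / r := by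
  have hsub : ∀ w ∈ Metric.closedBall z r, c ≤ w.re ∧ c ≤ w.im := by
    intro w hw
    rw [mem_closedBall_iff_norm] at hw
    have a1 := abs_le.1 ((Complex.abs_re_le_norm (w - z)).trans hw)
    have a2 := abs_le.1 ((Complex.abs_im_le_norm (w - z)).trans hw)
    simp only [Complex.sub_re, Complex.sub_im] at a1 a2
    exact ⟨by linarith [a1.1], by linarith [a2.1]⟩
  have hq : ∀ w ∈ Metric.closedBall z r, w ∈ quadInt := fun w hw =>
    ⟨lt_of_lt_of_le hc (hsub w hw).1, lt_of_lt_of_le hc (hsub w hw).2⟩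
  have hd : DifferentiableOn ℂ f (Metric.closedBall z r) := fun w hw =>
    (hf w (hq w hw)).differentiableAt.differentiableWithinAt
  have hz : z ∈ Metric.closedBall z r := Metric.mem_closedBall_self hr.le
  rw [← (hf z (hq z hz)).deriv]
  refine Complex.norm_deriv_le_of_forall_mem_sphere_norm_le hr (hd.diffContOnCl_ball subset_rfl) fun w hw => ?_
  have := hsub w (Metric.sphere_subset_closedBall hw)
  exact hM w this.1 this.2

lemma first_integral_small : ∃ C A D : ℝ, 0 < C ∧ 1 ≤ A ∧ 0 < D ∧ ∀ a ≥ A,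
    ‖diag a * prodK (diag a)‖ ≤ D ∧
    ‖(4 - 1 / diag a ^ 2) * (diag a * prodK (diag a)) ^ 2 + π ^ 2‖ ≤ C / a ^ 4 := by
  obtain ⟨D, hD, hV⟩ := prodK_bound_large
  refine ⟨625 * D ^ 2 + 3 * (63 * D ^ 2) ^ 2, 10 * D + 5, D, by positivity, by linarith, hD,
    fun a ha => ?_⟩
  have ha5 : 5 ≤ a := by linarith
  have ha0 : 0 < a := by linarith
  have hsl := quadInt_subset_slitPlane
  have hne : ∀ z : ℂ, a / 5 ≤ z.re → a / 5 ≤ ‖z‖ := fun z h => h.trans (Complex.re_le_norm z)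
  have hV0 : ∀ z : ℂ, a / 5 ≤ z.re → a / 5 ≤ z.im → ‖z * prodK z‖ ≤ D := fun z h1 h2 =>
    hV z ⟨by linarith, by linarith⟩ (by linarith [hne z h1])
  have hV1 : ∀ z : ℂ, a / 5 + a / 5 ≤ z.re → a / 5 + a / 5 ≤ z.im → ‖prodD z‖ ≤ D / (a / 5) :=
    fun z h1 h2 => norm_deriv_le_of_quadrant (fun z hz => hasDerivAt_mul_prodK (hsl hz))
      (by positivity) (by positivity) hV0 h1 h2
  have hV2 : ∀ z : ℂ, a / 5 + a / 5 + a / 5 ≤ z.re → a / 5 + a / 5 + a / 5 ≤ z.im →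
      ‖prodDD z‖ ≤ D / (a / 5) / (a / 5) :=
    fun z h1 h2 => norm_deriv_le_of_quadrant (fun z hz => hasDerivAt_prodD (hsl hz))
      (by positivity) (by positivity) hV1 h1 h2
  have hU : ∀ z : ℂ, a / 5 + a / 5 + a / 5 ≤ z.re → a / 5 + a / 5 + a / 5 ≤ z.im →
      ‖4 * (z * prodK z) ^ 2 + π ^ 2‖ ≤ 100 * D ^ 2 / a ^ 2 := by
    intro z h1 h2
    have n0 := hne z (by linarith)
    have hzp : 0 < ‖z‖ := by linarith
    have v0 := hV0 z (by linarith) (by linarith)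
    have v1 := hV1 z (by linarith) (by linarith)
    have v2 := hV2 z h1 h2
    have e : 4 * (z * prodK z) ^ 2 + (π : ℂ) ^ 2 =
        2 * (z * prodK z) * prodDD z - prodD z ^ 2 + (1 / z ^ 2) * (z * prodK z) ^ 2 := by
      rw [prodK_first_integral (norm_pos_iff.1 hzp)]; ring
    rw [e]
    have t1 : ‖2 * (z * prodK z) * prodDD z‖ ≤ 2 * D * (D / (a / 5) / (a / 5)) := by
      rw [norm_mul, norm_mul 2]
      norm_num only [Complex.norm_ofNat]
      gcongr
    have t2 : ‖prodD z ^ 2‖ ≤ (D / (a / 5)) ^ 2 := by rw [norm_pow]; gcongr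
    have t3 : ‖(1 / z ^ 2) * (z * prodK z) ^ 2‖ ≤ 1 / (a / 5) ^ 2 * D ^ 2 := by
      rw [norm_mul, norm_div, norm_pow, norm_pow, norm_one]; gcongr
    calc _ ≤ ‖2 * (z * prodK z) * prodDD z‖ + ‖prodD z ^ 2‖
          + ‖(1 / z ^ 2) * (z * prodK z) ^ 2‖ :=
            (norm_add_le _ _).trans (by gcongr; exact norm_sub_le _ _)
      _ ≤ 2 * D * (D / (a / 5) / (a / 5)) + (D / (a / 5)) ^ 2 + 1 / (a / 5) ^ 2 * D ^ 2 := by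
            gcongr
      _ = _ := by field_simp; norm_num
  have dU : ∀ z ∈ quadInt, HasDerivAt (fun z => 4 * (z * prodK z) ^ 2 + (π : ℂ) ^ 2)
      (8 * (z * prodK z) * prodD z) z := fun z hz => by
    refine ((((hasDerivAt_mul_prodK (hsl hz)).pow 2).const_mul 4).add_const _).congr_deriv ?_
    push_cast
    ring
  have dU2 : ∀ z ∈ quadInt, HasDerivAt (fun z => 8 * (z * prodK z) * prodD z)
      (8 * prodD z ^ 2 + 8 * (z * prodK z) * prodDD z) z := fun z hz => by
    refine ((((hasDerivAt_mul_prodK (hsl hz)).const_mul 8)).mul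
      (hasDerivAt_prodD (hsl hz))).congr_deriv ?_
    ring
  have hU1 : ∀ z : ℂ, a / 5 + a / 5 + a / 5 + a / 5 ≤ z.re → a / 5 + a / 5 + a / 5 + a / 5 ≤ z.im →
      ‖8 * (z * prodK z) * prodD z‖ ≤ 100 * D ^ 2 / a ^ 2 / (a / 5) :=
    fun z h1 h2 => norm_deriv_le_of_quadrant dU (by positivity) (by positivity) hU h1 h2
  have hU2 : ∀ z : ℂ, a / 5 + a / 5 + a / 5 + a / 5 + a / 5 ≤ z.re →
      a / 5 + a / 5 + a / 5 + a / 5 + a / 5 ≤ z.im →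
      ‖8 * prodD z ^ 2 + 8 * (z * prodK z) * prodDD z‖ ≤ 100 * D ^ 2 / a ^ 2 / (a / 5) / (a / 5) :=
    fun z h1 h2 => norm_deriv_le_of_quadrant dU2 (by positivity) (by positivity) hU1 h1 h2
  set s := diag a with hs
  have hre : s.re = a := diag_re a
  have him : s.im = a := diag_im a
  have hsne : s ≠ 0 := norm_pos_iff.1 (by
    have := hne s (by linarith)
    linarith)
  have v0 := hV0 s (by linarith) (by linarith)
  refine ⟨v0, ?_⟩
  have u0 := hU s (by linarith) (by linarith)
  have u1 := hU1 s (by linarith) (by linarith)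
  have u2 := hU2 s (by linarith) (by linarith)
  rw [← prodK_first_integral hsne]
  have hsmall : 100 * D ^ 2 / a ^ 2 ≤ 1 := by
    rw [div_le_one (by positivity)]
    nlinarith
  have hlow : 1 ≤ ‖s * prodK s‖ := by
    have h1 := norm_sub_norm_le ((π : ℂ) ^ 2) (-(4 * (s * prodK s) ^ 2))
    rw [sub_neg_eq_add, norm_neg, add_comm, norm_mul, norm_pow, norm_pow, Complex.norm_real,
      Real.norm_of_nonneg Real.pi_pos.le, Complex.norm_ofNat] at h1
    rw [add_comm] at h1
    rw [add_comm] at u0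
    have hpi : 9 < π ^ 2 := by nlinarith [Real.pi_gt_three]
    by_contra! hlt
    nlinarith [norm_nonneg (s * prodK s)]
  have hD1 : ‖prodD s‖ ≤ 63 * D ^ 2 / a ^ 3 := by
    rw [norm_mul, norm_mul, Complex.norm_ofNat] at u1
    have e1 : 100 * D ^ 2 / a ^ 2 / (a / 5) = 500 * D ^ 2 / a ^ 3 := by field_simp; norm_num
    rw [e1] at u1
    have : 8 * 1 * ‖prodD s‖ ≤ 500 * D ^ 2 / a ^ 3 := le_trans (by gcongr) u1
    have e2 : 500 * D ^ 2 / a ^ 3 ≤ 8 * (63 * D ^ 2 / a ^ 3) := by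
      rw [← mul_div_assoc]
      gcongr ?_ / _
      nlinarith [sq_nonneg D]
    linarith
  have e : 2 * (s * prodK s) * prodDD s - prodD s ^ 2 =
      (1 / 4) * (8 * prodD s ^ 2 + 8 * (s * prodK s) * prodDD s) - 3 * prodD s ^ 2 := by ring
  rw [e]
  refine (norm_sub_le _ _).trans ?_
  rw [norm_mul, norm_mul 3, norm_pow, Complex.norm_ofNat]
  have n4 : ‖(1 / 4 : ℂ)‖ = 1 / 4 := by norm_num
  rw [n4]
  have ha1 : a ^ 4 ≤ a ^ 6 := pow_le_pow_right₀ (by linarith) (by norm_num)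
  calc _ ≤ 1 / 4 * (100 * D ^ 2 / a ^ 2 / (a / 5) / (a / 5)) + 3 * (63 * D ^ 2 / a ^ 3) ^ 2 := by
        gcongr
    _ = 625 * D ^ 2 / a ^ 4 + 3 * (63 * D ^ 2) ^ 2 / a ^ 6 := by field_simp; ring
    _ ≤ 625 * D ^ 2 / a ^ 4 + 3 * (63 * D ^ 2) ^ 2 / a ^ 4 := by gcongr
    _ = _ := by ring

lemma diag_hfun_part : ∃ C > 0, ∀ a ≥ (1 : ℝ),
    ‖hfun (diag a) * (32 * diag a ^ 2 - 64 * diag a ^ 4) + 35 / 4 * (diag a ^ 2)⁻¹‖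
      ≤ C / a ^ 3 := by
  obtain ⟨C, hC, h⟩ := hfun_asymptotic
  refine ⟨96 * C + 5, by positivity, fun a ha => ?_⟩
  have ha0 : 0 < a := by linarith
  have hq := quadInt_subset_quad (diag_mem_quadInt ha0)
  have hn : a ≤ ‖diag a‖ := by
    have := Complex.re_le_norm (diag a)
    rwa [diag_re] at this
  set s := diag a
  have hn1 : 1 ≤ ‖s‖ := ha.trans hn
  have hn0 : 0 < ‖s‖ := by linarith
  have hs0 : s ≠ 0 := norm_pos_iff.1 hn0
  have hs := h s hq hn1
  have e : hfun s * (32 * s ^ 2 - 64 * s ^ 4) + 35 / 4 * (s ^ 2)⁻¹ =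
      (hfun s - 35 / 256 * (s ^ 6)⁻¹) * (32 * s ^ 2 - 64 * s ^ 4) + 35 / 8 * (s ^ 4)⁻¹ := by
    field_simp
    ring
  have np : ‖(32 * s ^ 2 - 64 * s ^ 4 : ℂ)‖ ≤ 96 * ‖s‖ ^ 4 := by
    refine (norm_sub_le _ _).trans ?_
    rw [norm_mul, norm_mul, norm_pow, norm_pow, Complex.norm_ofNat, Complex.norm_ofNat]
    have : ‖s‖ ^ 2 ≤ ‖s‖ ^ 4 := pow_le_pow_right₀ hn1 (by norm_num)
    linarith
  rw [e]
  refine (norm_add_le _ _).trans ?_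
  rw [norm_mul, norm_mul, norm_inv, norm_pow]
  have n3 : ‖(35 / 8 : ℂ)‖ ≤ 5 := by norm_num
  have hi : (‖s‖ ^ 4)⁻¹ ≤ (‖s‖ ^ 3)⁻¹ := by
    gcongr
    norm_num
  calc _ ≤ C / ‖s‖ ^ 7 * (96 * ‖s‖ ^ 4) + 5 * (‖s‖ ^ 3)⁻¹ := by gcongr
    _ = (96 * C + 5) / ‖s‖ ^ 3 := by field_simp
    _ ≤ _ := by gcongr

lemma diag_prodK_part : ∃ C A : ℝ, 0 < C ∧ 1 ≤ A ∧ ∀ a ≥ A,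
    ‖prodK (diag a) ^ 4 * (32 * diag a ^ 2 - 64 * diag a ^ 4) + 4 * π ^ 4‖ ≤ C / a ^ 4 := by
  obtain ⟨C, A, D, hC, hA, hD, h⟩ := first_integral_small
  refine ⟨4 * (2 * π ^ 2 * C + C ^ 2 + D ^ 4), A, by positivity, hA, fun a ha => ?_⟩
  have ha1 : 1 ≤ a := hA.trans ha
  have ha0 : 0 < a := by linarith
  obtain ⟨hV, hE⟩ := h a ha
  have hn : a ≤ ‖diag a‖ := by
    have := Complex.re_le_norm (diag a)
    rwa [diag_re] at this
  set s := diag a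
  have hn0 : 0 < ‖s‖ := by linarith
  have hs0 : s ≠ 0 := norm_pos_iff.1 hn0
  set E := (4 - 1 / s ^ 2) * (s * prodK s) ^ 2 + (π : ℂ) ^ 2 with hEdef
  have e : prodK s ^ 4 * (32 * s ^ 2 - 64 * s ^ 4) + 4 * (π : ℂ) ^ 4 =
      4 * (2 * π ^ 2 * E - E ^ 2 + (s * prodK s) ^ 4 * (s ^ 4)⁻¹) := by
    rw [hEdef]
    field_simp
    ring
  rw [e, norm_mul, Complex.norm_ofNat]
  have t1 : ‖2 * (π : ℂ) ^ 2 * E‖ ≤ 2 * π ^ 2 * (C / a ^ 4) := by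
    rw [norm_mul, norm_mul, norm_pow, Complex.norm_ofNat, Complex.norm_real,
      Real.norm_of_nonneg Real.pi_pos.le]
    gcongr
  have t2 : ‖E ^ 2‖ ≤ C ^ 2 / a ^ 4 := by
    rw [norm_pow]
    have : a ^ 4 ≤ a ^ 8 := pow_le_pow_right₀ ha1 (by norm_num)
    calc _ ≤ (C / a ^ 4) ^ 2 := by gcongr
      _ = C ^ 2 / a ^ 8 := by rw [div_pow]; ring_nf
      _ ≤ _ := by gcongr
  have t3 : ‖(s * prodK s) ^ 4 * (s ^ 4)⁻¹‖ ≤ D ^ 4 / a ^ 4 := by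
    rw [norm_mul, norm_inv, norm_pow, norm_pow, ← div_eq_mul_inv]
    gcongr
  calc _ ≤ 4 * (2 * π ^ 2 * (C / a ^ 4) + C ^ 2 / a ^ 4 + D ^ 4 / a ^ 4) := by
        gcongr
        exact (norm_add_le _ _).trans (add_le_add ((norm_sub_le _ _).trans (add_le_add t1 t2)) t3)
    _ = _ := by ring

lemma tendsto_diag_contourF :
    Tendsto (fun a : ℝ => π * a ^ 2 * (contourF (diag a) / diag a).im) atTop
      (𝓝 (35 * π / 8)) := by
  obtain ⟨C1, hC1, h1⟩ := diag_hfun_part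
  obtain ⟨C2, A, hC2, hA, h2⟩ := diag_prodK_part
  rw [tendsto_iff_norm_sub_tendsto_zero]
  have ht : Tendsto (fun a : ℝ => π * (C1 + |lam| * C2) / a) atTop (𝓝 0) :=
    tendsto_id.const_div_atTop _
  refine squeeze_zero' (Eventually.of_forall fun _ => norm_nonneg _) ?_ ht
  filter_upwards [eventually_ge_atTop A] with a ha
  have ha1 : 1 ≤ a := hA.trans ha
  have ha0 : 0 < a := by linarith
  have b1 := (Complex.abs_im_le_norm _).trans (h1 a ha1)
  have b2 := (Complex.abs_im_le_norm _).trans (h2 a ha)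
  have hsq := diag_sq a
  have hs0 : diag a ≠ 0 := by
    intro h
    have := congrArg Complex.re h
    rw [diag_re] at this
    exact ha0.ne' this
  have hinv : (35 / 4 * (diag a ^ 2)⁻¹ : ℂ) = ((-(35 / (8 * a ^ 2)) : ℝ) : ℂ) * Complex.I := by
    rw [hsq, mul_inv, Complex.inv_I]
    push_cast
    have : (a : ℂ) ≠ 0 := by exact_mod_cast ha0.ne'
    field_simp
    norm_num
  have hpi4 : (4 * π ^ 4 : ℂ) = ((4 * π ^ 4 : ℝ) : ℂ) := by push_cast; rfl
  rw [hinv, Complex.add_im, Complex.mul_I_im, Complex.ofReal_re] at b1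
  rw [hpi4, Complex.add_im, Complex.ofReal_im, add_zero] at b2
  have e : contourF (diag a) / diag a = hfun (diag a) * (32 * diag a ^ 2 - 64 * diag a ^ 4)
      + (lam : ℂ) * (prodK (diag a) ^ 4 * (32 * diag a ^ 2 - 64 * diag a ^ 4)) := by
    rw [contourF, core]
    field_simp
  rw [e, Complex.add_im, Complex.im_ofReal_mul]
  set H := (hfun (diag a) * (32 * diag a ^ 2 - 64 * diag a ^ 4)).im
  set W := (prodK (diag a) ^ 4 * (32 * diag a ^ 2 - 64 * diag a ^ 4)).im
  have e3 : π * a ^ 2 * (H + lam * W) - 35 * π / 8 =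
      π * a ^ 2 * ((H + -(35 / (8 * a ^ 2))) + lam * W) := by
    field_simp
    ring
  rw [e3, Real.norm_eq_abs, abs_mul, abs_of_pos (show 0 < π * a ^ 2 by positivity)]
  have hle : C2 / a ^ 4 ≤ C2 / a ^ 3 := by
    gcongr
    norm_num
  calc _ ≤ π * a ^ 2 * (C1 / a ^ 3 + |lam| * (C2 / a ^ 3)) := by
        gcongr
        refine (abs_add_le _ _).trans (add_le_add b1 ?_)
        rw [abs_mul]
        gcongr
        exact b2.trans hle
    _ = _ := by field_simp

lemma det_eq : besselMoment 1 7 1 * (32 * besselMoment 2 6 3 - 64 * besselMoment 2 6 5) -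
        besselMoment 2 6 1 * (32 * besselMoment 1 7 3 - 64 * besselMoment 1 7 5) =
      5 * π ^ 6 / 192 := by
  obtain ⟨hinteg, hval⟩ := integrableOn_contourF_im
  obtain ⟨C, hC, hb⟩ := contourF_bound
  have ht := tendsto_diag continuousOn_contourF differentiableOn_contourF hC hb
    (fun y hy => contourF_mul_I_re hy) hinteg
  have hlim := tendsto_nhds_unique tendsto_diag_contourF ht
  rw [hval] at hlim
  obtain ⟨-, m1, m2, m3, e1, e2⟩ := moment_relations
  rw [m1, m2, m3] at hlim
  rw [e1, e2]
  set P := 32 * besselMoment 2 6 3 - 64 * besselMoment 2 6 5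
  set Q := 32 * besselMoment 1 7 3 - 64 * besselMoment 1 7 5
  have hpi := Real.pi_ne_zero
  field_simp at hlim ⊢
  linear_combination -96 * hlim

end BesselMoment

/-- The 6-loop determinant:
`M(1,7,1)(32M(2,6,3) - 64M(2,6,5)) - M(2,6,1)(32M(1,7,3) - 64M(1,7,5)) = 5π⁶/192`. -/
theorem bessel_moment_det :
    besselMoment 1 7 1 * (32 * besselMoment 2 6 3 - 64 * besselMoment 2 6 5) -
        besselMoment 2 6 1 * (32 * besselMoment 1 7 3 - 64 * besselMoment 1 7 5) =
      5 * π ^ 6 / 192 := by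
  exact BesselMoment.det_eq
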